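/- For every ε > 0 there exists a constant C > 0 (depending only on ε) such that for every integer N ≥ 2, (1/N) ∑_{n=1}^{N} |(1/N) ∑_{m=1}^{N} μ(m) μ(m+n)| ≤ C/(log N)^ε. -/

import Mathlib

section

open Complex MeasureTheory Filter Topology

/-- Partial sums of a bounded periodic sequence grow linearly with bounded error. -/
lemma norm_sum_range_sub_mean_le {q : ℕ} (hq : 0 < q) {f : ℕ → ℂ} (hper : ∀ n, f (q + n) = f n)
    (hf : ∀ n, ‖f n‖ ≤ 1) (n : ℕ) :
    ‖∑ k ∈ Finset.range n, f k - (∑ k ∈ Finset.range q, f k) / q * n‖ ≤ 2 * q := by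
  have hq0 : (q : ℂ) ≠ 0 := by exact_mod_cast hq.ne'
  have hb : ∀ m : ℕ, ‖∑ k ∈ Finset.range m, f k‖ ≤ m := fun m ↦ by
    simpa using norm_sum_le_of_le (Finset.range m) (fun k _ ↦ hf k)
  induction n using Nat.strong_induction_on with
  | _ n ih =>
    rcases lt_or_ge n q with h | h
    · have h1 : ‖(∑ k ∈ Finset.range q, f k) / q * n‖ ≤ n := by
        rw [norm_mul, norm_div, norm_natCast, norm_natCast]
        have : ‖∑ k ∈ Finset.range q, f k‖ / q ≤ 1 := by
          rw [div_le_one (by exact_mod_cast hq)]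
          exact hb q
        nlinarith [Nat.cast_nonneg (α := ℝ) n]
      have h2 : (n : ℝ) ≤ q := by exact_mod_cast h.le
      linarith [norm_sub_le (∑ k ∈ Finset.range n, f k) ((∑ k ∈ Finset.range q, f k) / q * n), hb n]
    · obtain ⟨m, rfl⟩ := Nat.exists_eq_add_of_le h
      have := ih m (by omega)
      rw [Finset.sum_range_add]
      simp only [hper]
      convert this using 2
      push_cast
      field_simp
      ring

/-- The mean value of a Dirichlet character. -/
noncomputable def charMean {q : ℕ} (χ : DirichletCharacter ℂ q) : ℂ :=
  (∑ k ∈ Finset.range q, χ k) / q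

/-- The coefficients of a Dirichlet character beyond `M`. -/
noncomputable def charTail {q : ℕ} (χ : DirichletCharacter ℂ q) (M n : ℕ) : ℂ :=
  if M < n then χ n else 0

/-- The fluctuating part of the summatory function of `charTail χ M`. -/
noncomputable def charFluct {q : ℕ} (χ : DirichletCharacter ℂ q) (M : ℕ) : ℝ → ℂ :=
  (Set.Ioi (M : ℝ)).indicator fun u ↦
    ∑ k ∈ Finset.Icc 1 ⌊u⌋₊, charTail χ M k - charMean χ * (u - M)

section

set_option linter.unusedSectionVars false

variable {q : ℕ} [NeZero q] (χ : DirichletCharacter ℂ q)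

lemma norm_charMean_le_one : ‖charMean χ‖ ≤ 1 := by
  rw [charMean, norm_div, norm_natCast, div_le_one (by exact_mod_cast NeZero.pos q)]
  simpa using norm_sum_le_of_le (Finset.range q) (fun k _ ↦ χ.norm_le_one k)

lemma charMean_eq_zero {χ : DirichletCharacter ℂ q} (hχ : χ ≠ 1) : charMean χ = 0 := by
  have h : ∑ k ∈ Finset.range q, χ k = ∑ a : ZMod q, χ a := by
    refine Finset.sum_bij (fun k _ ↦ (k : ZMod q)) (by simp) ?_ ?_ (by simp)
    · intro a ha b hb hab
      simp only [Finset.mem_range] at ha hb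
      have := (ZMod.natCast_eq_natCast_iff' a b q).mp hab
      rwa [Nat.mod_eq_of_lt ha, Nat.mod_eq_of_lt hb] at this
    · intro b _
      exact ⟨b.val, by simp [ZMod.val_lt], by simp⟩
  rw [charMean, h, MulChar.sum_eq_zero_of_ne_one hχ, zero_div]

lemma norm_charTail_le_one (M n : ℕ) : ‖charTail χ M n‖ ≤ 1 := by
  unfold charTail
  split_ifs
  · exact χ.norm_le_one _
  · simp

lemma sum_charTail_of_le {M N : ℕ} (h : N ≤ M) : ∑ k ∈ Finset.Icc 1 N, charTail χ M k = 0 :=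
  Finset.sum_eq_zero fun k hk ↦ if_neg (by have := (Finset.mem_Icc.mp hk).2; omega)

lemma sum_charTail {M N : ℕ} (h : M ≤ N) :
    ∑ k ∈ Finset.Icc 1 N, charTail χ M k =
      ∑ k ∈ Finset.range (N + 1), χ k - ∑ k ∈ Finset.range (M + 1), χ k := by
  rw [eq_sub_iff_add_eq, add_comm]
  induction N, h using Nat.le_induction with
  | base => rw [sum_charTail_of_le χ le_rfl, add_zero]
  | succ n hn ih =>
    rw [Finset.sum_Icc_succ_top (by omega), ← add_assoc, ih, Finset.sum_range_succ _ (n + 1),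
      charTail, if_pos (by omega)]

lemma norm_charFluct_le (M : ℕ) (u : ℝ) : ‖charFluct χ M u‖ ≤ 5 * q := by
  have hq1 : (1 : ℝ) ≤ q := by exact_mod_cast NeZero.one_le
  by_cases hu : u ∈ Set.Ioi (M : ℝ)
  · rw [charFluct, Set.indicator_of_mem hu]
    have hu0 : 0 ≤ u := (Nat.cast_nonneg M).trans (le_of_lt hu)
    rw [sum_charTail χ (Nat.le_floor (le_of_lt hu))]
    have hper : ∀ n : ℕ, χ ((q + n : ℕ) : ZMod q) = χ n := fun n ↦ by simp
    have hb : ∀ n : ℕ, ‖χ (n : ZMod q)‖ ≤ 1 := fun n ↦ χ.norm_le_one _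
    have h1 := norm_sum_range_sub_mean_le (NeZero.pos q) (f := fun n : ℕ ↦ χ n) hper hb (⌊u⌋₊ + 1)
    have h2 := norm_sum_range_sub_mean_le (NeZero.pos q) (f := fun n : ℕ ↦ χ n) hper hb (M + 1)
    have h3 : ‖charMean χ * ((⌊u⌋₊ : ℂ) - u)‖ ≤ 1 := by
      have : ‖((⌊u⌋₊ : ℂ) - u)‖ ≤ 1 := by
        rw [← ofReal_natCast, ← ofReal_sub, norm_real, Real.norm_eq_abs, abs_le]
        constructor <;> linarith [Nat.floor_le hu0, Nat.lt_floor_add_one u]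
      rw [norm_mul]
      nlinarith [norm_charMean_le_one χ, norm_nonneg (charMean χ), norm_nonneg ((⌊u⌋₊ : ℂ) - u)]
    calc _ = ‖(∑ k ∈ Finset.range (⌊u⌋₊ + 1), χ k - charMean χ * ((⌊u⌋₊ + 1 : ℕ) : ℂ)) -
          (∑ k ∈ Finset.range (M + 1), χ k - charMean χ * ((M + 1 : ℕ) : ℂ)) +
          charMean χ * ((⌊u⌋₊ : ℂ) - u)‖ := by
            congr 1; push_cast; ring
      _ ≤ 2 * q + 2 * q + 1 := (norm_add_le _ _).trans
            (add_le_add ((norm_sub_le _ _).trans (add_le_add h1 h2)) h3)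
      _ ≤ _ := by linarith
  · rw [charFluct, Set.indicator_of_notMem hu, norm_zero]
    positivity

lemma measurable_charFluct (M : ℕ) : Measurable (charFluct χ M) := by
  refine Measurable.indicator ?_ measurableSet_Ioi
  refine Measurable.sub ?_ (by fun_prop)
  exact (measurable_from_nat (f := fun n ↦ ∑ k ∈ Finset.Icc 1 n, charTail χ M k)).comp
    Nat.measurable_floor

/-- The Mellin-type integral of `charFluct`. -/
noncomputable def charInt {q : ℕ} (χ : DirichletCharacter ℂ q) (M : ℕ) (s : ℂ) : ℂ :=
  mellin (charFluct χ M) (-s)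

lemma differentiableAt_charInt {M : ℕ} (hM : 0 < M) {s : ℂ} (hs : 0 < s.re) :
    DifferentiableAt ℂ (charInt χ M) s := by
  have : DifferentiableAt ℂ (mellin (charFluct χ M)) (-s) := by
    refine mellin_differentiableAt_of_isBigO_rpow (a := 0) (b := -s.re - 1) ?_ ?_ (by simpa using hs)
      ?_ (by simp)
    · refine LocallyIntegrable.locallyIntegrableOn ?_ _
      refine (locallyIntegrable_const (5 * q : ℝ)).mono
        (measurable_charFluct χ M).aestronglyMeasurable (ae_of_all _ fun u ↦ ?_)
      refine (norm_charFluct_le χ M u).trans (le_abs_self _)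
    · refine Asymptotics.IsBigO.of_bound (5 * q) (Eventually.of_forall fun u ↦ ?_)
      simpa using norm_charFluct_le χ M u
    · refine (Asymptotics.isBigO_zero _ _).congr' ?_ EventuallyEq.rfl
      have : Set.Iio (M : ℝ) ∈ 𝓝 (0 : ℝ) := Iio_mem_nhds (by exact_mod_cast hM)
      filter_upwards [mem_nhdsWithin_of_mem_nhds this] with u hu
      rw [charFluct, Set.indicator_of_notMem]
      simpa using le_of_lt hu
  exact this.comp s differentiable_neg.differentiableAt

lemma charInt_eq {M : ℕ} (s : ℂ) :
    charInt χ M s = ∫ u in Set.Ioi (M : ℝ), charFluct χ M u * (u : ℂ) ^ (-(s + 1)) := by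
  rw [charInt, mellin]
  have h : ∀ u : ℝ, (u : ℂ) ^ (-s - 1) • charFluct χ M u =
      (Set.Ioi (M : ℝ)).indicator (fun u ↦ charFluct χ M u * (u : ℂ) ^ (-(s + 1))) u := by
    intro u
    by_cases hu : u ∈ Set.Ioi (M : ℝ)
    · rw [Set.indicator_of_mem hu, smul_eq_mul, mul_comm, neg_add, sub_eq_add_neg]
    · rw [Set.indicator_of_notMem hu, charFluct, Set.indicator_of_notMem hu, smul_zero]
  simp_rw [h]
  rw [setIntegral_indicator measurableSet_Ioi, Set.inter_eq_self_of_subset_right]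
  exact Set.Ioi_subset_Ioi (Nat.cast_nonneg M)

lemma integrableOn_charFluct {M : ℕ} (hM : 0 < M) {s : ℂ} (hs : 0 < s.re) :
    IntegrableOn (fun u : ℝ ↦ charFluct χ M u * (u : ℂ) ^ (-(s + 1))) (Set.Ioi (M : ℝ)) := by
  have h := integrableOn_Ioi_cpow_of_lt (a := -(s + 1)) (by simp; linarith)
    (show (0 : ℝ) < M by exact_mod_cast hM)
  exact Integrable.bdd_mul h (measurable_charFluct χ M).aestronglyMeasurable
    (ae_of_all _ (norm_charFluct_le χ M))

lemma norm_charInt_le {M : ℕ} (hM : 0 < M) {s : ℂ} (hs : 0 < s.re) :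
    ‖charInt χ M s‖ ≤ 5 * q * (M : ℝ) ^ (-s.re) / s.re := by
  have hM' : (0 : ℝ) < M := by exact_mod_cast hM
  rw [charInt_eq]
  have hint := (integrableOn_Ioi_rpow_of_lt (a := -(s.re + 1)) (by linarith) hM').const_mul
    (5 * q : ℝ)
  refine (norm_integral_le_of_norm_le hint ?_).trans (le_of_eq ?_)
  · refine (ae_restrict_mem measurableSet_Ioi).mono fun u hu ↦ ?_
    rw [norm_mul, norm_cpow_eq_rpow_re_of_pos (hM'.trans hu)]
    simp only [neg_re, add_re, one_re]
    exact mul_le_mul_of_nonneg_right (norm_charFluct_le χ M u)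
      (Real.rpow_nonneg (hM'.trans hu).le _)
  · rw [integral_const_mul, integral_Ioi_rpow_of_lt (by linarith) hM']
    rw [show -(s.re + 1) + 1 = -s.re by ring]
    field_simp

/-- The main terms in the truncated formula for `L(s, χ)`. -/
noncomputable def charApprox {q : ℕ} (χ : DirichletCharacter ℂ q) (M : ℕ) (s : ℂ) : ℂ :=
  ∑ n ∈ Finset.Icc 1 M, χ n * (n : ℂ) ^ (-s) + charMean χ * ((M : ℂ) ^ (1 - s) / (s - 1)) +
    s * charInt χ M s

lemma LSeries_charTail {M : ℕ} (hM : 0 < M) {s : ℂ} (hs : 1 < s.re) :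
    LSeries (charTail χ M) s = charMean χ * ((M : ℂ) ^ (1 - s) / (s - 1)) + s * charInt χ M s := by
  have hM' : (0 : ℝ) < M := by exact_mod_cast hM
  have hMc : (M : ℂ) ≠ 0 := by exact_mod_cast hM.ne'
  have hs0 : s ≠ 0 := fun h ↦ by simp [h] at hs; linarith
  have hs1 : s - 1 ≠ 0 := fun h ↦ by rw [sub_eq_zero.mp h] at hs; simp at hs
  rw [LSeries_eq_mul_integral' (charTail χ M) zero_le_one hs]
  swap
  · refine Asymptotics.IsBigO.of_bound 1 (Eventually.of_forall fun n ↦ ?_)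
    have : ∑ k ∈ Finset.Icc 1 n, ‖charTail χ M k‖ ≤ n := by
      simpa using Finset.sum_le_sum (s := Finset.Icc 1 n) (fun k _ ↦ norm_charTail_le_one χ M k)
    rw [Real.norm_of_nonneg (by positivity)]
    simpa using this
  have e1 : ∫ t in Set.Ioi (1 : ℝ), (∑ k ∈ Finset.Icc 1 ⌊t⌋₊, charTail χ M k) * (t : ℂ) ^ (-(s + 1))
      = ∫ t in Set.Ioi (M : ℝ),
        (∑ k ∈ Finset.Icc 1 ⌊t⌋₊, charTail χ M k) * (t : ℂ) ^ (-(s + 1)) := by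
    refine setIntegral_eq_of_subset_of_forall_sdiff_eq_zero measurableSet_Ioi
      (Set.Ioi_subset_Ioi (by exact_mod_cast hM)) fun t ht ↦ ?_
    have htM : t ≤ M := by simpa using ht.2
    rw [sum_charTail_of_le χ (by simpa using Nat.floor_le_floor htM), zero_mul]
  have e2 : ∫ t in Set.Ioi (M : ℝ),
        (∑ k ∈ Finset.Icc 1 ⌊t⌋₊, charTail χ M k) * (t : ℂ) ^ (-(s + 1)) =
      ∫ t in Set.Ioi (M : ℝ), (charFluct χ M t * (t : ℂ) ^ (-(s + 1)) +
        (charMean χ * (t : ℂ) ^ (-s) - charMean χ * M * (t : ℂ) ^ (-(s + 1)))) := by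
    refine setIntegral_congr_fun measurableSet_Ioi fun t ht ↦ ?_
    have ht0 : (t : ℂ) ≠ 0 := by exact_mod_cast (hM'.trans ht).ne'
    simp only [charFluct]
    rw [Set.indicator_of_mem ht, show -s = -(s + 1) + 1 by ring, cpow_add _ _ ht0, cpow_one]
    ring
  have i1 := integrableOn_Ioi_cpow_of_lt (a := -s) (by simpa using hs) hM'
  have i2 := integrableOn_Ioi_cpow_of_lt (a := -(s + 1)) (by simp; linarith) hM'
  rw [e1, e2, integral_add (integrableOn_charFluct χ hM (by linarith)),
    integral_sub, ← charInt_eq, integral_const_mul, integral_const_mul,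
    integral_Ioi_cpow_of_lt (by simpa using hs) hM',
    integral_Ioi_cpow_of_lt (by simp; linarith) hM']
  · rw [ofReal_natCast, show -(s + 1) + 1 = -s by ring, show -s + 1 = 1 - s by ring,
      show 1 - s = -s + 1 by ring, cpow_add _ _ hMc, cpow_one]
    have : -s + 1 ≠ 0 := fun h ↦ hs1 (by linear_combination -h)
    field_simp
    ring
  · exact i1.const_mul _
  · exact i2.const_mul _
  · exact (i1.const_mul _).sub (i2.const_mul _)

lemma LSeries_eq_charApprox {M : ℕ} (hM : 0 < M) {s : ℂ} (hs : 1 < s.re) :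
    LSeries (fun n : ℕ ↦ χ n) s = charApprox χ M s := by
  have hs0 : s ≠ 0 := fun h ↦ by simp [h] at hs; linarith
  have hhead : LSeries (fun n ↦ if n ∈ Finset.Icc 1 M then χ n else 0) s =
      ∑ n ∈ Finset.Icc 1 M, χ n * (n : ℂ) ^ (-s) := by
    rw [LSeries, tsum_eq_sum (s := Finset.Icc 1 M)]
    · refine Finset.sum_congr rfl fun n hn ↦ ?_
      have : n ≠ 0 := by have := (Finset.mem_Icc.mp hn).1; omega
      rw [LSeries.term_of_ne_zero this, if_pos hn, cpow_neg, div_eq_mul_inv]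
    · intro n hn
      rw [LSeries.term_def, if_neg hn, zero_div, ite_self]
  have hS : LSeriesSummable (charTail χ M) s :=
    LSeriesSummable_of_bounded_of_one_lt_re (m := 1) (fun n _ ↦ norm_charTail_le_one χ M n) hs
  have hS' : LSeriesSummable (fun n ↦ if n ∈ Finset.Icc 1 M then χ n else 0) s :=
    LSeriesSummable_of_bounded_of_one_lt_re (m := 1) (fun n _ ↦ by
      split_ifs
      · exact χ.norm_le_one _
      · simp) hs
  rw [charApprox, add_assoc, ← LSeries_charTail χ hM hs, ← hhead, ← LSeries_add hS' hS]
  refine LSeries_congr (fun {n} hn ↦ ?_) s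
  simp only [Pi.add_apply, charTail, Finset.mem_Icc]
  by_cases h : M < n
  · simp [h]
  · simp [h, not_lt.mp h, Nat.one_le_iff_ne_zero.mpr hn]

/-- Analytic continuation of the truncated formula to a convex region. -/
lemma LFunction_eq_charApprox {M : ℕ} (hM : 0 < M) {U : Set ℂ} (hU : Convex ℝ U) (hUo : IsOpen U)
    (hre : ∀ s ∈ U, 0 < s.re) (h1 : χ ≠ 1 ∨ (1 : ℂ) ∉ U) {w : ℂ} (hw : w ∈ U) (hw1 : 1 < w.re)
    {s : ℂ} (hs : s ∈ U) : χ.LFunction s = charApprox χ M s := by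
  have hd1 : DifferentiableOn ℂ χ.LFunction U := fun z hz ↦
    (χ.differentiableAt_LFunction z (h1.symm.imp (fun h hz1 ↦ h (hz1 ▸ hz)) id)).differentiableWithinAt
  have hd2 : DifferentiableOn ℂ (charApprox χ M) U := by
    intro z hz
    refine DifferentiableAt.differentiableWithinAt ?_
    have hMc : (M : ℂ) ≠ 0 := by exact_mod_cast hM.ne'
    have hA : DifferentiableAt ℂ
        (fun s ↦ ∑ n ∈ Finset.Icc 1 M, χ n * (n : ℂ) ^ (-s)) z := by
      refine DifferentiableAt.fun_sum fun n hn ↦ ?_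
      have : (n : ℂ) ≠ 0 := by
        have := (Finset.mem_Icc.mp hn).1
        exact_mod_cast (by omega : n ≠ 0)
      exact (differentiableAt_id.neg.const_cpow (Or.inl this)).const_mul _
    have hB : DifferentiableAt ℂ
        (fun s ↦ charMean χ * ((M : ℂ) ^ (1 - s) / (s - 1))) z := by
      rcases h1 with h1 | h1
      · simp [charMean_eq_zero h1]
      · refine DifferentiableAt.const_mul (DifferentiableAt.div
          (DifferentiableAt.const_cpow (by fun_prop) (Or.inl hMc)) (by fun_prop) ?_) _
        intro h
        exact h1 (sub_eq_zero.mp h ▸ hz)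
    exact (hA.add hB).add (differentiableAt_id.mul (differentiableAt_charInt χ hM (hre z hz)))
  refine (hd1.analyticOnNhd hUo).eqOn_of_preconnected_of_eventuallyEq
    (hd2.analyticOnNhd hUo) hU.isPreconnected hw ?_ hs
  have : {z : ℂ | 1 < z.re} ∈ 𝓝 w := (isOpen_lt continuous_const continuous_re).mem_nhds hw1
  filter_upwards [this] with z hz
  rw [χ.LFunction_eq_LSeries hz, LSeries_eq_charApprox χ hM hz]

end

section

variable {q : ℕ} [NeZero q] (χ : DirichletCharacter ℂ q)

/-- The analytic conductor `q (|t| + 2)`. -/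
noncomputable def conductorSize (q : ℕ) (t : ℝ) : ℝ := q * (|t| + 2)

lemma two_le_conductorSize (q : ℕ) [NeZero q] (t : ℝ) : 2 ≤ conductorSize q t := by
  have hq1 : (1 : ℝ) ≤ q := by exact_mod_cast NeZero.one_le
  unfold conductorSize
  nlinarith [abs_nonneg t]

lemma norm_charApprox_le {ε : ℝ} (hε : 0 < ε) (hε1 : ε ≤ 1) :
    ∃ C : ℝ, 1 ≤ C ∧ ∀ (q : ℕ) [NeZero q] (χ : DirichletCharacter ℂ q) (s : ℂ),
      1 - ε / 2 ≤ s.re → s.re ≤ 3 →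
        ‖charApprox χ ⌈conductorSize q s.im⌉₊ s‖ ≤
          C * conductorSize q s.im ^ ε * (1 + ‖charMean χ‖ / ‖s - 1‖) := by
  refine ⟨(1 + 2 / ε + 20 + 1) * 2 ^ ε, ?_, ?_⟩
  · have : (1 : ℝ) ≤ 2 ^ ε := Real.one_le_rpow (by norm_num) hε.le
    have : 0 < 2 / ε := by positivity
    nlinarith
  intro q _ χ s hs1 hs2
  set Y := conductorSize q s.im with hY
  have hY2 : 2 ≤ Y := two_le_conductorSize q s.im
  set M := ⌈Y⌉₊ with hM
  have hMY : Y ≤ M := Nat.le_ceil Y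
  have hM2 : (M : ℝ) ≤ 2 * Y := by linarith [Nat.ceil_lt_add_one (show 0 ≤ Y by linarith)]
  have hM1 : (1 : ℝ) ≤ M := by linarith
  have hM0 : (0 : ℝ) < M := by linarith
  have hMpos : 0 < M := by exact_mod_cast hM0
  have hσ : 1 / 2 ≤ s.re := by linarith
  have hp1 : (1 : ℝ) ≤ (M : ℝ) ^ (ε / 2) := Real.one_le_rpow hM1 (by linarith)
  have hpp : (M : ℝ) ^ ε = (M : ℝ) ^ (ε / 2) * (M : ℝ) ^ (ε / 2) := by
    rw [← Real.rpow_add hM0]; ring_nf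
  have hsum : ‖∑ n ∈ Finset.Icc 1 M, χ n * (n : ℂ) ^ (-s)‖ ≤ (1 + 2 / ε) * (M : ℝ) ^ ε := by
    have h1 : ‖∑ n ∈ Finset.Icc 1 M, χ n * (n : ℂ) ^ (-s)‖ ≤
        ∑ n ∈ Finset.Icc 1 M, (M : ℝ) ^ (ε / 2) * ((n : ℝ)⁻¹) := by
      refine norm_sum_le_of_le _ fun n hn ↦ ?_
      have hn1 := (Finset.mem_Icc.mp hn).1
      have hn0 : (0 : ℝ) < n := by exact_mod_cast hn1
      have hnM : (n : ℝ) ≤ M := by exact_mod_cast (Finset.mem_Icc.mp hn).2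
      rw [norm_mul, norm_natCast_cpow_of_pos (by omega)]
      calc _ ≤ 1 * (n : ℝ) ^ (-s).re :=
            mul_le_mul_of_nonneg_right (χ.norm_le_one _) (Real.rpow_nonneg hn0.le _)
        _ ≤ (n : ℝ) ^ (ε / 2 + -1) := by
            rw [one_mul]
            refine Real.rpow_le_rpow_of_exponent_le (by exact_mod_cast hn1) ?_
            simp only [neg_re]; linarith
        _ = (n : ℝ) ^ (ε / 2) * (n : ℝ)⁻¹ := by
            rw [Real.rpow_add hn0, Real.rpow_neg_one]
        _ ≤ _ := by
            gcongr
    rw [← Finset.mul_sum] at h1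
    have h2 : ∑ n ∈ Finset.Icc 1 M, ((n : ℝ)⁻¹) ≤ 1 + Real.log M := by
      have := harmonic_le_one_add_log M
      rw [harmonic_eq_sum_Icc] at this
      push_cast at this
      exact this
    have h3 : Real.log M ≤ (M : ℝ) ^ (ε / 2) / (ε / 2) :=
      Real.log_le_rpow_div hM0.le (by linarith)
    have h4 : 1 + Real.log M ≤ (1 + 2 / ε) * (M : ℝ) ^ (ε / 2) := by
      have : (M : ℝ) ^ (ε / 2) / (ε / 2) = 2 / ε * (M : ℝ) ^ (ε / 2) := by field_simp
      linarith
    refine h1.trans ((mul_le_mul_of_nonneg_left (h2.trans h4) (by positivity)).trans (le_of_eq ?_))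
    rw [hpp]; ring
  have hpole : ‖charMean χ * ((M : ℂ) ^ (1 - s) / (s - 1))‖ ≤
      (M : ℝ) ^ ε * (‖charMean χ‖ / ‖s - 1‖) := by
    rw [norm_mul, norm_div, norm_natCast_cpow_of_pos hMpos]
    have : (M : ℝ) ^ (1 - s).re ≤ (M : ℝ) ^ ε := by
      refine Real.rpow_le_rpow_of_exponent_le hM1 ?_
      simp only [sub_re, one_re]; linarith
    rw [mul_div_assoc', mul_comm, mul_div_assoc']
    gcongr
  have hint : ‖s * charInt χ M s‖ ≤ 20 * (M : ℝ) ^ ε := by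
    have hs3 : ‖s‖ ≤ 2 * (|s.im| + 2) := by
      have := norm_le_abs_re_add_abs_im s
      rw [abs_of_nonneg (by linarith : 0 ≤ s.re)] at this
      linarith [abs_nonneg s.im]
    have h1 := norm_charInt_le χ hMpos (s := s) (by linarith)
    have h2 : (M : ℝ) ^ (-s.re) ≤ (M : ℝ) ^ (-1 : ℝ) * (M : ℝ) ^ ε := by
      rw [← Real.rpow_add hM0]
      exact Real.rpow_le_rpow_of_exponent_le hM1 (by linarith)
    rw [norm_mul]
    calc _ ≤ (2 * (|s.im| + 2)) * (5 * q * (M : ℝ) ^ (-s.re) / s.re) := by gcongr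
      _ ≤ (2 * (|s.im| + 2)) * (5 * q * ((M : ℝ) ^ (-1 : ℝ) * (M : ℝ) ^ ε) / (1 / 2)) := by
          gcongr
      _ = 20 * (Y / M) * (M : ℝ) ^ ε := by
          rw [Real.rpow_neg_one, hY, conductorSize]; ring
      _ ≤ 20 * 1 * (M : ℝ) ^ ε := by
          gcongr
          rwa [div_le_one hM0]
      _ = _ := by ring
  have hMe : (M : ℝ) ^ ε ≤ 2 ^ ε * Y ^ ε := by
    rw [← Real.mul_rpow (by norm_num) (by linarith)]
    exact Real.rpow_le_rpow hM0.le hM2 hε.le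
  have hd0 : 0 ≤ ‖charMean χ‖ / ‖s - 1‖ := by positivity
  have hMe0 : 0 < (M : ℝ) ^ ε := by positivity
  have hε2 : 0 < 2 / ε := by positivity
  calc _ ≤ (1 + 2 / ε) * (M : ℝ) ^ ε + (M : ℝ) ^ ε * (‖charMean χ‖ / ‖s - 1‖) +
        20 * (M : ℝ) ^ ε := by
        rw [charApprox]
        exact (norm_add_le _ _).trans (add_le_add ((norm_add_le _ _).trans
          (add_le_add hsum hpole)) hint)
    _ ≤ (1 + 2 / ε + 20 + 1) * (M : ℝ) ^ ε * (1 + ‖charMean χ‖ / ‖s - 1‖) := by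
        nlinarith [mul_nonneg hMe0.le hd0, mul_nonneg (mul_nonneg hMe0.le hd0) hε2.le]
    _ ≤ (1 + 2 / ε + 20 + 1) * (2 ^ ε * Y ^ ε) * (1 + ‖charMean χ‖ / ‖s - 1‖) := by gcongr
    _ = _ := by ring

lemma convex_re_pos : Convex ℝ {z : ℂ | 0 < z.re} := convex_halfSpace_re_gt 0

lemma LFunction_eq_charApprox_of_im {M : ℕ} (hM : 0 < M) {s : ℂ} (hs : 0 < s.re)
    (h : χ ≠ 1 ∨ s.im ≠ 0) : χ.LFunction s = charApprox χ M s := by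
  have ho : IsOpen {z : ℂ | 0 < z.re} := isOpen_lt continuous_const continuous_re
  by_cases hχ : χ ≠ 1
  · exact LFunction_eq_charApprox χ hM convex_re_pos ho (fun _ h ↦ h) (Or.inl hχ) (w := 2)
      (by simp) (by simp) hs
  · have him := h.resolve_left hχ
    rcases lt_or_gt_of_ne him with him | him
    · refine LFunction_eq_charApprox χ hM (U := {z : ℂ | 0 < z.re} ∩ {z : ℂ | z.im < 0})
        (convex_re_pos.inter (convex_halfSpace_im_lt 0))
        (ho.inter (isOpen_lt continuous_im continuous_const)) (fun _ h ↦ h.1)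
        (Or.inr (by simp)) (w := ⟨2, -1⟩) (by simp) (by simp) ⟨hs, him⟩
    · refine LFunction_eq_charApprox χ hM (U := {z : ℂ | 0 < z.re} ∩ {z : ℂ | 0 < z.im})
        (convex_re_pos.inter (convex_halfSpace_im_gt 0))
        (ho.inter (isOpen_lt continuous_const continuous_im)) (fun _ h ↦ h.1)
        (Or.inr (by simp)) (w := ⟨2, 1⟩) (by simp) (by simp) ⟨hs, him⟩

end

/-- Bound for `L(s, χ)` slightly to the left of the line `re s = 1`. -/
lemma norm_LFunction_le {ε : ℝ} (hε : 0 < ε) (hε1 : ε ≤ 1) :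
    ∃ C : ℝ, 1 ≤ C ∧ ∀ (q : ℕ) [NeZero q] (χ : DirichletCharacter ℂ q) (s : ℂ),
      1 - ε / 2 ≤ s.re → s.re ≤ 3 → (χ ≠ 1 ∨ s.im ≠ 0) →
        ‖χ.LFunction s‖ ≤ C * conductorSize q s.im ^ ε * (1 + ‖charMean χ‖ / ‖s - 1‖) := by
  obtain ⟨C, hC, h⟩ := norm_charApprox_le hε hε1
  refine ⟨C, hC, fun q _ χ s hs1 hs2 hχ ↦ ?_⟩
  have hY2 := two_le_conductorSize q s.im
  rw [LFunction_eq_charApprox_of_im χ (M := ⌈conductorSize q s.im⌉₊)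
    (Nat.ceil_pos.mpr (by linarith)) (by linarith) hχ]
  exact h q χ s hs1 hs2

lemma norm_LFunction_le_of_far {ε : ℝ} (hε : 0 < ε) (hε1 : ε ≤ 1) :
    ∃ C : ℝ, 1 ≤ C ∧ ∀ (q : ℕ) [NeZero q] (χ : DirichletCharacter ℂ q) (s : ℂ),
      1 - ε / 2 ≤ s.re → s.re ≤ 3 → (χ ≠ 1 ∨ 1 / 4 ≤ |s.im|) →
        ‖χ.LFunction s‖ ≤ C * conductorSize q s.im ^ ε := by
  obtain ⟨C, hC, h⟩ := norm_LFunction_le hε hε1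
  refine ⟨5 * C, by linarith, fun q _ χ s hs1 hs2 hχ ↦ ?_⟩
  have hY2 := two_le_conductorSize q s.im
  have hχ' : χ ≠ 1 ∨ s.im ≠ 0 := hχ.imp id fun h h0 ↦ by rw [h0] at h; norm_num at h
  refine (h q χ s hs1 hs2 hχ').trans ?_
  have : ‖charMean χ‖ / ‖s - 1‖ ≤ 4 := by
    rcases hχ with hχ | him
    · simp [charMean_eq_zero hχ]
    · have h1 : 1 / 4 ≤ ‖s - 1‖ := him.trans (by simpa using abs_im_le_norm (s - 1))
      rw [div_le_iff₀ (by linarith)]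
      linarith [norm_charMean_le_one χ]
  calc _ ≤ C * conductorSize q s.im ^ ε * (1 + 4) := by gcongr
    _ = _ := by ring

lemma norm_LFunction_le_of_mem_closedBall {q : ℕ} [NeZero q] {χ : DirichletCharacter ℂ q}
    (hχ : χ ≠ 1) {s : ℂ} (hs : s ∈ Metric.closedBall (2 : ℂ) (3 / 2)) :
    ‖χ.LFunction s‖ ≤ 41 * q := by
  have hq1 : (1 : ℝ) ≤ q := by exact_mod_cast NeZero.one_le
  rw [mem_closedBall_iff_norm] at hs
  have hre : 1 / 2 ≤ s.re := by
    have := (abs_le.mp ((abs_re_le_norm (s - 2)).trans hs)).1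
    simp at this
    linarith
  have hs4 : ‖s‖ ≤ 4 := by
    have := norm_le_norm_sub_add s 2
    simp at this
    linarith
  rw [LFunction_eq_charApprox_of_im χ one_pos (by linarith) (Or.inl hχ), charApprox,
    charMean_eq_zero hχ]
  have h1 := norm_charInt_le χ one_pos (s := s) (by linarith)
  simp only [Nat.cast_one, Real.one_rpow, mul_one] at h1
  have h2 : 5 * (q : ℝ) / s.re ≤ 10 * q := by
    rw [div_le_iff₀ (by linarith)]
    nlinarith
  simp only [Finset.Icc_self, Finset.sum_singleton, Nat.cast_one, one_cpow, zero_mul, add_zero,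
    map_one, mul_one]
  refine (norm_add_le _ _).trans ?_
  rw [norm_one, norm_mul]
  nlinarith [norm_nonneg s, norm_nonneg (charInt χ 1 s),
    mul_le_mul hs4 (h1.trans h2) (norm_nonneg _) (by norm_num)]

section

open scoped ComplexOrder

lemma iteratedDeriv_inv_sub_one_two (m : ℕ) (w : ℂ) :
    iteratedDeriv m (fun s : ℂ ↦ w * (s - 1)⁻¹) 2 = w * ((-1) ^ m * m.factorial) := by
  have h := congrFun (iter_deriv_inv_linear_sub (𝕜 := ℂ) m 1 1) 2
  rw [← iteratedDeriv_eq_iterate] at h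
  simp only [one_mul, one_pow, mul_one] at h
  rw [iteratedDeriv_const_mul_field, h]
  norm_num

/-- **Estermann's lemma**: lower bound for the residue at `1` of a Dirichlet series with
nonnegative coefficients. -/
lemma residue_lower_bound {f : ℕ → ℂ} (hf : 0 ≤ f) (hf1 : 1 ≤ f 1)
    (hab : LSeries.abscissaOfAbsConv f ≤ 1) {W : ℂ → ℂ} (hW : Differentiable ℂ W)
    (hWf : ∀ s : ℂ, 1 < s.re → W s = (s - 1) * LSeries f s) {K : ℝ} (hK1 : 1 ≤ K)
    (hK : ∀ s ∈ Metric.closedBall (2 : ℂ) (3 / 2), ‖W s‖ ≤ K) {x : ℝ} (hx : 3 / 4 ≤ x)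
    (hx1 : x < 1) (hWx : 0 ≤ (W x).re) :
    (1 - x) / (2 * Real.exp 1) * (48 * K) ^ (-(6 * (1 - x))) ≤ (W 1).re := by
  set w := W 1 with hw
  set E : ℂ → ℂ := dslope W 1 with hE
  have hEd : Differentiable ℂ E := by
    rw [← differentiableOn_univ]
    exact (Complex.differentiableOn_dslope univ_mem).mpr hW.differentiableOn
  have hEs : ∀ s, s ≠ 1 → E s = (W s - w) / (s - 1) := fun s hs ↦ by
    rw [hE, dslope_of_ne _ hs, slope_def_field]
  set e : ℕ → ℂ := fun m ↦ (-1) ^ m * iteratedDeriv m E 2 / m.factorial with he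
  have hfac : ∀ m : ℕ, (m.factorial : ℂ) ≠ 0 := fun m ↦ by
    exact_mod_cast m.factorial_ne_zero
  have hbd : ∀ m, ‖e m‖ ≤ 4 * K * (2 / 3) ^ m := by
    intro m
    have h1 : ‖iteratedDeriv m E 2‖ ≤ m.factorial * (4 * K) / (3 / 2) ^ m := by
      refine Complex.norm_iteratedDeriv_le_of_forall_mem_sphere_norm_le m (by norm_num)
        hEd.diffContOnCl fun z hz ↦ ?_
      have hz1 : 1 / 2 ≤ ‖z - 1‖ := by
        rw [mem_sphere_iff_norm] at hz
        have := norm_sub_norm_le (z - 2) (-1)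
        rw [norm_neg, norm_one, hz] at this
        have e1 : z - 2 - -1 = z - 1 := by ring
        rw [e1] at this
        linarith
      have hz0 : z ≠ 1 := fun h ↦ by rw [h] at hz1; norm_num at hz1
      rw [hEs z hz0, norm_div, div_le_iff₀ (by linarith)]
      have h2 := hK z (Metric.sphere_subset_closedBall hz)
      have h3 : ‖w‖ ≤ K := hK 1 (by rw [mem_closedBall_iff_norm]; norm_num)
      nlinarith [norm_sub_le (W z) w]
    have hf0 : (0 : ℝ) < m.factorial := by exact_mod_cast m.factorial_pos
    simp only [he, norm_div, norm_mul, norm_pow, norm_neg, norm_one, one_pow, one_mul, norm_natCast]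
    rw [div_le_iff₀ hf0]
    refine h1.trans (le_of_eq ?_)
    rw [div_pow, div_pow]
    field_simp
  have hlow : ∀ m, -w.re ≤ (e m).re := by
    intro m
    have h0 : E =ᶠ[𝓝 2] fun s ↦ LSeries f s - w * (s - 1)⁻¹ := by
      have : {s : ℂ | 1 < s.re} ∈ 𝓝 (2 : ℂ) :=
        (isOpen_lt continuous_const continuous_re).mem_nhds (by simp)
      filter_upwards [this] with s hs
      have hs1 : s ≠ 1 := fun h ↦ by rw [h] at hs; simp at hs
      have hs2 : s - 1 ≠ 0 := sub_ne_zero.mpr hs1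
      rw [hEs s hs1, hWf s hs]
      field_simp
    have hlt : LSeries.abscissaOfAbsConv f < (2 : ℝ) :=
      lt_of_le_of_lt hab (by exact_mod_cast one_lt_two)
    have hA : ContDiffAt ℂ m (LSeries f) 2 := by
      have : AnalyticAt ℂ (LSeries f) 2 := LSeries_analyticOnNhd f 2 (by simpa using hlt)
      exact this.contDiffAt
    have hB : ContDiffAt ℂ m (fun s : ℂ ↦ w * (s - 1)⁻¹) 2 := by
      refine contDiffAt_const.mul (ContDiffAt.inv (by fun_prop) (by norm_num))
    have h1 : iteratedDeriv m E 2 =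
        iteratedDeriv m (LSeries f) 2 - w * ((-1) ^ m * m.factorial) := by
      rw [h0.iteratedDeriv_eq, ← iteratedDeriv_inv_sub_one_two]
      exact iteratedDeriv_fun_sub hA hB
    have h2 := LSeries.iteratedDeriv_alternating hf hlt m
    have h3 : e m = ((-1) ^ m * iteratedDeriv m (LSeries f) 2) / m.factorial - w := by
      simp only [he, h1]
      have := hfac m
      have h5 : ((-1 : ℂ) ^ m) * (-1) ^ m = 1 := by rw [← mul_pow]; norm_num
      field_simp
      linear_combination (-w * (m.factorial : ℂ)) * h5
    have h4 : 0 ≤ (((-1) ^ m * iteratedDeriv m (LSeries f) 2) / m.factorial : ℂ).re := by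
      rw [div_natCast_re]
      have := (Complex.le_def.mp h2).1
      simp only [ofReal_ofNat, zero_re] at this
      positivity
    rw [h3, sub_re]
    linarith
  have hlow0 : 1 - w.re ≤ (e 0).re := by
    have h1 : e 0 = LSeries f 2 - w := by
      simp only [he, pow_zero, one_mul, iteratedDeriv_zero, Nat.factorial_zero, Nat.cast_one,
        div_one]
      rw [hEs 2 (by norm_num), hWf 2 (by simp)]
      norm_num
    have hs : LSeriesSummable f 2 := LSeriesSummable_of_abscissaOfAbsConv_lt_re
      (lt_of_le_of_lt hab (by simpa using (by exact_mod_cast one_lt_two : (1 : EReal) < (2 : ℝ))))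
    have h2 : LSeries.term f 2 1 ≤ LSeries f 2 := by
      refine hs.le_tsum 1 fun j _ ↦ ?_
      simpa using LSeries.term_nonneg (hf j) 2
    have h3 : LSeries.term f 2 1 = f 1 := by simp
    rw [h3] at h2
    have h4 := (Complex.le_def.mp (hf1.trans h2)).1
    rw [h1, sub_re]
    simp only [one_re] at h4
    linarith
  set r : ℝ := 2 - x with hr
  have hr1 : 1 < r := by linarith
  have hsum : HasSum (fun m ↦ (e m).re * r ^ m) (E x).re := by
    have h := Complex.hasSum_taylorSeries_of_entire hEd 2 (x : ℂ)
    have h2 : HasSum (fun m ↦ e m * (r ^ m : ℝ)) (E x) := by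
      have he' : (fun m ↦ e m * ((r ^ m : ℝ) : ℂ)) =
          fun m : ℕ ↦ ((m.factorial : ℂ))⁻¹ • ((x : ℂ) - 2) ^ m • iteratedDeriv m E 2 := by
        funext m
        simp only [he, hr, smul_eq_mul]
        push_cast
        have : ((x : ℂ) - 2) ^ m = (-1) ^ m * (2 - x) ^ m := by rw [← mul_pow]; ring_nf
        rw [this]
        have := hfac m
        field_simp
      rw [he']
      exact h
    have h3 := Complex.hasSum_re h2
    simpa only [re_mul_ofReal] using h3
  obtain ⟨M, hM1, hM2⟩ : ∃ M : ℕ, Real.log (48 * K) * 6 ≤ M ∧ (M : ℝ) < Real.log (48 * K) * 6 + 1 :=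
    ⟨_, Nat.le_ceil _, Nat.ceil_lt_add_one (by
      have := Real.log_nonneg (show (1 : ℝ) ≤ 48 * K by linarith); positivity)⟩
  have hlogpos := Real.log_nonneg (show (1 : ℝ) ≤ 48 * K by linarith)
  have hMpos : 0 < M := by
    have : 0 < Real.log (48 * K) := Real.log_pos (by linarith)
    exact_mod_cast (show (0 : ℝ) < M by linarith)
  have hgeo : (48 * K) * (5 / 6 : ℝ) ^ M ≤ 1 := by
    have h1 : (5 / 6 : ℝ) ^ M ≤ Real.exp (-(M / 6)) := by
      have : (5 / 6 : ℝ) ≤ Real.exp (-(1 / 6)) := by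
        have := Real.add_one_le_exp (-(1 / 6 : ℝ)); linarith
      calc _ ≤ (Real.exp (-(1 / 6))) ^ M := by gcongr
        _ = _ := by rw [← Real.exp_nat_mul]; congr 1; ring
    have h2 : 48 * K = Real.exp (Real.log (48 * K)) := (Real.exp_log (by linarith)).symm
    calc _ ≤ Real.exp (Real.log (48 * K)) * Real.exp (-(M / 6)) := by
          rw [← h2]; gcongr
      _ ≤ _ := by rw [← Real.exp_add, Real.exp_le_one_iff]; linarith
  have htail : HasSum (fun m ↦ 4 * K * (5 / 6 : ℝ) ^ M * (5 / 6) ^ m)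
      (4 * K * (5 / 6 : ℝ) ^ M * 6) := by
    have := (hasSum_geometric_of_lt_one (r := (5 / 6 : ℝ)) (by norm_num) (by norm_num)).mul_left
      (4 * K * (5 / 6 : ℝ) ^ M)
    norm_num at this ⊢
    exact this
  have hlower : 1 / 2 - w.re * ∑ m ∈ Finset.range M, r ^ m ≤ (E x).re := by
    have h1 := (hasSum_nat_add_iff' M).mpr hsum
    have h2 : -(4 * K * (5 / 6 : ℝ) ^ M * 6) ≤ (E x).re - ∑ m ∈ Finset.range M, (e m).re * r ^ m := by
      refine hasSum_le (fun m ↦ ?_) htail.neg h1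
      have h3 : |(e (m + M)).re * r ^ (m + M)| ≤ 4 * K * (5 / 6 : ℝ) ^ M * (5 / 6) ^ m := by
        rw [abs_mul, abs_of_nonneg (pow_nonneg (by linarith) _ : 0 ≤ r ^ (m + M))]
        have h4 := (abs_re_le_norm _).trans (hbd (m + M))
        calc _ ≤ 4 * K * (2 / 3) ^ (m + M) * (5 / 4) ^ (m + M) := by
              gcongr
              linarith
          _ = _ := by
              rw [mul_assoc, ← mul_pow, pow_add]; norm_num; ring
      linarith [neg_abs_le ((e (m + M)).re * r ^ (m + M))]
    have h5 : 1 - w.re * ∑ m ∈ Finset.range M, r ^ m ≤ ∑ m ∈ Finset.range M, (e m).re * r ^ m := by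
      obtain ⟨k, rfl⟩ : ∃ k, M = k + 1 := ⟨M - 1, by omega⟩
      rw [Finset.sum_range_succ', Finset.sum_range_succ', mul_add, Finset.mul_sum, pow_zero]
      have : ∑ i ∈ Finset.range k, -(w.re * r ^ (i + 1)) ≤
          ∑ i ∈ Finset.range k, (e (i + 1)).re * r ^ (i + 1) := by
        refine Finset.sum_le_sum fun i _ ↦ ?_
        have := mul_le_mul_of_nonneg_right (hlow (i + 1))
          (pow_nonneg (by linarith : 0 ≤ r) (i + 1))
        linarith
      rw [Finset.sum_neg_distrib] at this
      linarith
    linarith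
  have hupper : (E x).re * (1 - x) ≤ w.re := by
    have hx0 : (x : ℂ) ≠ 1 := by exact_mod_cast hx1.ne
    have h1 : W x = w + E x * ((x - 1 : ℝ) : ℂ) := by
      rw [hEs _ hx0]
      have : (x : ℂ) - 1 ≠ 0 := sub_ne_zero.mpr hx0
      push_cast
      field_simp
      ring
    rw [h1, add_re, re_mul_ofReal] at hWx
    linarith
  have hgs : (∑ m ∈ Finset.range M, r ^ m) * (1 - x) = r ^ M - 1 := by
    have := geom_sum_mul r M
    rw [hr] at this ⊢
    rw [← this]; ring
  have hkey : (1 - x) / 2 ≤ w.re * r ^ M := by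
    have := mul_le_mul_of_nonneg_right hlower (by linarith : 0 ≤ 1 - x)
    have e1 : (1 / 2 - w.re * ∑ m ∈ Finset.range M, r ^ m) * (1 - x) =
      (1 - x) / 2 - w.re * (r ^ M - 1) := by rw [← hgs]; ring
    rw [e1] at this
    linarith
  have hrM : r ^ M ≤ Real.exp 1 * (48 * K) ^ (6 * (1 - x)) := by
    have h1 : r ≤ Real.exp (1 - x) := by
      have := Real.add_one_le_exp (1 - x); linarith
    calc r ^ M ≤ (Real.exp (1 - x)) ^ M := by gcongr
      _ = Real.exp (M * (1 - x)) := by rw [← Real.exp_nat_mul]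
      _ ≤ Real.exp (1 + Real.log (48 * K) * (6 * (1 - x))) := by
          refine Real.exp_le_exp.mpr ?_
          nlinarith
      _ = _ := by rw [Real.exp_add, Real.rpow_def_of_pos (by linarith)]
  have hwpos : 0 < w.re := by
    by_contra h
    have : w.re * r ^ M ≤ 0 := mul_nonpos_of_nonpos_of_nonneg (not_lt.mp h) (by positivity)
    linarith
  have hp : 0 < (48 * K) ^ (6 * (1 - x)) := by positivity
  have hfin : (1 - x) / 2 ≤ w.re * (Real.exp 1 * (48 * K) ^ (6 * (1 - x))) :=
    hkey.trans (by gcongr)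
  rw [Real.rpow_neg (by linarith), ← div_eq_mul_inv, div_le_iff₀ hp, mul_comm (2 : ℝ),
    ← div_div, div_right_comm, div_le_iff₀ (Real.exp_pos 1)]
  linarith

end

section

open scoped ComplexOrder ArithmeticFunction.zeta
open DirichletCharacter

/-- A Dirichlet character as an arithmetic function. -/
noncomputable def charArith {q : ℕ} (χ : DirichletCharacter ℂ q) : ArithmeticFunction ℂ :=
  toArithmeticFunction (χ ·)

lemma charArith_apply {q : ℕ} (χ : DirichletCharacter ℂ q) {n : ℕ} (hn : n ≠ 0) :
    charArith χ n = χ n :=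
  (χ.apply_eq_toArithmeticFunction_apply hn).symm

lemma isMultiplicative_charArith {q : ℕ} (χ : DirichletCharacter ℂ q) :
    (charArith χ).IsMultiplicative := isMultiplicative_toArithmeticFunction χ

lemma zetaMul_eq {q : ℕ} (χ : DirichletCharacter ℂ q) :
    zetaMul χ = ((ζ : ArithmeticFunction ℕ) : ArithmeticFunction ℂ) * charArith χ := rfl

lemma charArith_pmul_mul {q : ℕ} (χ : DirichletCharacter ℂ q) (f g : ArithmeticFunction ℂ) :
    (charArith χ).pmul (f * g) = (charArith χ).pmul f * (charArith χ).pmul g := by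
  ext n
  rcases eq_or_ne n 0 with rfl | hn
  · simp
  rw [ArithmeticFunction.pmul_apply, ArithmeticFunction.mul_apply, ArithmeticFunction.mul_apply,
    Finset.mul_sum]
  refine Finset.sum_congr rfl fun x hx ↦ ?_
  obtain ⟨h1, h2⟩ := Nat.mem_divisorsAntidiagonal.mp hx
  have hx1 : x.1 ≠ 0 := fun h ↦ by simp [h] at h1; omega
  have hx2 : x.2 ≠ 0 := fun h ↦ by simp [h] at h1; omega
  rw [ArithmeticFunction.pmul_apply, ArithmeticFunction.pmul_apply, charArith_apply χ hn,
    charArith_apply χ hx1, charArith_apply χ hx2, ← h1, Nat.cast_mul, map_mul]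
  ring

variable {q₁ q : ℕ} (χ₁ : DirichletCharacter ℂ q₁) (χ : DirichletCharacter ℂ q)

/-- The coefficients of `ζ(s) L(s, χ₁) L(s, χ) L(s, χ₁ χ)`. -/
noncomputable def siegelCoeff : ArithmeticFunction ℂ :=
  zetaMul χ₁ * (charArith χ * (charArith χ).pmul (charArith χ₁))

lemma siegelCoeff_eq : siegelCoeff χ₁ χ = zetaMul χ₁ * (charArith χ).pmul (zetaMul χ₁) := by
  rw [siegelCoeff, zetaMul_eq, charArith_pmul_mul, ArithmeticFunction.pmul_zeta]

lemma siegelCoeff_comm : siegelCoeff χ₁ χ = siegelCoeff χ χ₁ := by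
  rw [siegelCoeff, siegelCoeff, zetaMul_eq, zetaMul_eq, ArithmeticFunction.pmul_comm]
  ring

lemma isMultiplicative_siegelCoeff : (siegelCoeff χ₁ χ).IsMultiplicative := by
  rw [siegelCoeff_eq]
  exact (isMultiplicative_zetaMul χ₁).mul
    ((isMultiplicative_charArith χ).pmul (isMultiplicative_zetaMul χ₁))

lemma siegelCoeff_prime_pow_nonneg_aux {χ₁ : DirichletCharacter ℂ q₁} {χ : DirichletCharacter ℂ q}
    (hχ₁ : χ₁ ^ 2 = 1) (hχ : χ ^ 2 = 1) {p : ℕ} (hp : p.Prime)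
    (h : χ₁ p = -1 ∨ 0 ≤ χ p) (k : ℕ) : 0 ≤ siegelCoeff χ₁ χ (p ^ k) := by
  rw [siegelCoeff_eq, ArithmeticFunction.mul_apply]
  refine Finset.sum_nonneg fun x hx ↦ mul_nonneg (zetaMul_nonneg hχ₁ _) ?_
  obtain ⟨h1, h2⟩ := Nat.mem_divisorsAntidiagonal.mp hx
  obtain ⟨j, -, hj⟩ := (Nat.dvd_prime_pow hp).mp (Dvd.intro_left _ h1)
  rw [ArithmeticFunction.pmul_apply, hj, charArith_apply χ (pow_ne_zero _ hp.ne_zero),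
    Nat.cast_pow, map_pow]
  rcases h with h | h
  · rcases Nat.even_or_odd j with hj | hj
    · refine mul_nonneg ?_ (zetaMul_nonneg hχ₁ _)
      rcases MulChar.isQuadratic_iff_sq_eq_one.mpr hχ p with h | h | h <;>
        simp [h, hj.neg_pow, pow_nonneg]
    · have : zetaMul χ₁ (p ^ j) = 0 := by
        rw [zetaMul_eq, ArithmeticFunction.coe_zeta_mul_apply, Nat.sum_divisors_prime_pow hp]
        have : ∀ i ∈ Finset.range (j + 1), charArith χ₁ (p ^ i) = (-1) ^ i := fun i _ ↦ by
          rw [charArith_apply _ (pow_ne_zero _ hp.ne_zero), Nat.cast_pow, map_pow, h]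
        rw [Finset.sum_congr rfl this, neg_one_geom_sum, if_pos hj.add_one]
      simp [this]
  · exact mul_nonneg (pow_nonneg h _) (zetaMul_nonneg hχ₁ _)

lemma siegelCoeff_nonneg {χ₁ : DirichletCharacter ℂ q₁} {χ : DirichletCharacter ℂ q}
    (hχ₁ : χ₁ ^ 2 = 1) (hχ : χ ^ 2 = 1) (n : ℕ) : 0 ≤ siegelCoeff χ₁ χ n := by
  rcases eq_or_ne n 0 with rfl | hn
  · simp
  rw [(isMultiplicative_siegelCoeff χ₁ χ).multiplicative_factorization _ hn]
  refine Finset.prod_nonneg fun p hp ↦ ?_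
  have hp := Nat.prime_of_mem_primeFactors hp
  rcases MulChar.isQuadratic_iff_sq_eq_one.mpr hχ₁ p with h | h | h
  · rw [siegelCoeff_comm]
    exact siegelCoeff_prime_pow_nonneg_aux hχ hχ₁ hp (Or.inr (by simp [h])) _
  · rw [siegelCoeff_comm]
    exact siegelCoeff_prime_pow_nonneg_aux hχ hχ₁ hp (Or.inr (by simp [h])) _
  · exact siegelCoeff_prime_pow_nonneg_aux hχ₁ hχ hp (Or.inl h) _

lemma LSeriesSummable_charArith {s : ℂ} (hs : 1 < s.re) : LSeriesSummable (charArith χ) s :=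
  LSeriesSummable_of_bounded_of_one_lt_re (m := 1) (fun n hn ↦ by
    rw [charArith_apply χ hn]; exact χ.norm_le_one _) hs

lemma LSeries_charArith [NeZero q] {s : ℂ} (hs : 1 < s.re) :
    LSeries (charArith χ) s = χ.LFunction s := by
  rw [χ.LFunction_eq_LSeries hs]
  exact LSeries_congr (fun {n} hn ↦ charArith_apply χ hn) s

lemma LSeries_zetaMul [NeZero q] {s : ℂ} (hs : 1 < s.re) :
    LSeries (zetaMul χ) s = riemannZeta s * χ.LFunction s := by
  have h0 : (⇑((ζ : ArithmeticFunction ℕ) : ArithmeticFunction ℂ)) =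
      fun n : ℕ ↦ ((ArithmeticFunction.zeta n : ℕ) : ℂ) := by
    funext n
    exact ArithmeticFunction.natCoe_apply
  have h : LSeries ((ζ : ArithmeticFunction ℕ) : ArithmeticFunction ℂ) s = riemannZeta s := by
    rw [h0, ArithmeticFunction.LSeries_zeta_eq_riemannZeta hs]
  have h' : LSeriesSummable ((ζ : ArithmeticFunction ℕ) : ArithmeticFunction ℂ) s := by
    rw [h0]
    exact ArithmeticFunction.LSeriesSummable_zeta_iff.mpr hs
  rw [zetaMul_eq, ArithmeticFunction.LSeries_mul' h' (LSeriesSummable_charArith χ hs),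
    LSeries_charArith χ hs, h]

/-- The product of two characters of different moduli. -/
noncomputable def charProd : DirichletCharacter ℂ (q₁ * q) :=
  changeLevel (Nat.dvd_mul_right q₁ q) χ₁ * changeLevel (Nat.dvd_mul_left q q₁) χ

lemma charArith_charProd : charArith (charProd χ₁ χ) = (charArith χ).pmul (charArith χ₁) := by
  ext n
  rcases eq_or_ne n 0 with rfl | hn
  · simp
  rw [ArithmeticFunction.pmul_apply, charArith_apply _ hn, charArith_apply _ hn,
    charArith_apply _ hn, charProd, MulChar.mul_apply]
  by_cases hc : n.Coprime (q₁ * q)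
  · have h1 : IsCoprime (n : ℤ) ((q₁ * q : ℕ) : ℤ) := Nat.isCoprime_iff_coprime.mpr hc
    have h2 := changeLevel_eq_cast_of_dvd' χ₁ (Nat.dvd_mul_right q₁ q) h1
    have h3 := changeLevel_eq_cast_of_dvd' χ (Nat.dvd_mul_left q q₁) h1
    simp only [Int.cast_natCast] at h2 h3
    rw [h2, h3, mul_comm]
  · have h1 : ¬ IsUnit (n : ZMod (q₁ * q)) := by rwa [ZMod.isUnit_iff_coprime]
    rw [MulChar.map_nonunit _ h1, zero_mul]
    rw [Nat.coprime_mul_iff_right, not_and_or] at hc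
    rcases hc with hc | hc
    · rw [MulChar.map_nonunit χ₁ (by rwa [ZMod.isUnit_iff_coprime]), mul_zero]
    · rw [MulChar.map_nonunit χ (by rwa [ZMod.isUnit_iff_coprime]), zero_mul]

lemma LSeriesSummable_siegelCoeff {s : ℂ} (hs : 1 < s.re) :
    LSeriesSummable (siegelCoeff χ₁ χ) s := by
  rw [siegelCoeff, ← charArith_charProd]
  exact ArithmeticFunction.LSeriesSummable_mul (LSeriesSummable_zetaMul χ₁ hs)
    (ArithmeticFunction.LSeriesSummable_mul (LSeriesSummable_charArith _ hs)
      (LSeriesSummable_charArith _ hs))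

lemma LSeries_siegelCoeff [NeZero q₁] [NeZero q] {s : ℂ} (hs : 1 < s.re) :
    LSeries (siegelCoeff χ₁ χ) s =
      riemannZeta s * χ₁.LFunction s * (χ.LFunction s * (charProd χ₁ χ).LFunction s) := by
  rw [siegelCoeff, ← charArith_charProd, ArithmeticFunction.LSeries_mul'
    (LSeriesSummable_zetaMul χ₁ hs) (ArithmeticFunction.LSeriesSummable_mul
      (LSeriesSummable_charArith _ hs) (LSeriesSummable_charArith _ hs)),
    ArithmeticFunction.LSeries_mul' (LSeriesSummable_charArith _ hs)
      (LSeriesSummable_charArith _ hs), LSeries_zetaMul _ hs, LSeries_charArith _ hs,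
      LSeries_charArith _ hs]

/-- `(s - 1) ζ(s)`, extended to an entire function. -/
noncomputable def zetaEntire : ℂ → ℂ := LFunctionTrivChar₁ 1

lemma differentiable_zetaEntire : Differentiable ℂ zetaEntire := differentiable_LFunctionTrivChar₁ 1

lemma zetaEntire_one : zetaEntire 1 = 1 := by simp [zetaEntire]

lemma zetaEntire_of_ne {s : ℂ} (hs : s ≠ 1) : zetaEntire s = (s - 1) * riemannZeta s := by
  simp [zetaEntire, Function.update_of_ne hs, LFunctionTrivChar]

lemma exists_norm_zetaEntire_le (R : ℝ) :
    ∃ K : ℝ, 1 ≤ K ∧ ∀ s ∈ Metric.closedBall (2 : ℂ) R, ‖zetaEntire s‖ ≤ K := by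
  obtain ⟨K, hK⟩ := (isCompact_closedBall (2 : ℂ) R).exists_bound_of_continuousOn
    differentiable_zetaEntire.continuous.continuousOn
  exact ⟨max 1 K, le_max_left _ _, fun s hs ↦ (hK s hs).trans (le_max_right _ _)⟩

lemma abscissaOfAbsConv_le_one {f : ℕ → ℂ} (h : ∀ s : ℂ, 1 < s.re → LSeriesSummable f s) :
    LSeries.abscissaOfAbsConv f ≤ 1 :=
  LSeries.abscissaOfAbsConv_le_of_forall_lt_LSeriesSummable' fun y hy ↦ h y (by
    simpa using (by exact_mod_cast hy : (1 : ℝ) < y))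

lemma re_LFunction_one_ge [NeZero q] {χ : DirichletCharacter ℂ q} (hχ : χ ^ 2 = 1) (hχ1 : χ ≠ 1)
    {K : ℝ} (hK1 : 1 ≤ K) (hK : ∀ s ∈ Metric.closedBall (2 : ℂ) (3 / 2), ‖zetaEntire s‖ ≤ K)
    {x : ℝ} (hx : 3 / 4 ≤ x) (hx1 : x < 1) (hWx : 0 ≤ (zetaEntire x * χ.LFunction x).re) :
    (1 - x) / (2 * Real.exp 1) * (48 * (K * (41 * q))) ^ (-(6 * (1 - x))) ≤ ‖χ.LFunction 1‖ := by
  have hq1 : (1 : ℝ) ≤ q := by exact_mod_cast NeZero.one_le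
  have := residue_lower_bound (f := zetaMul χ) (zetaMul_nonneg hχ)
    (by rw [(isMultiplicative_zetaMul χ).map_one])
    (abscissaOfAbsConv_le_one fun s hs ↦ LSeriesSummable_zetaMul χ hs)
    (W := fun s ↦ zetaEntire s * χ.LFunction s)
    (differentiable_zetaEntire.mul (differentiable_LFunction hχ1))
    (fun s hs ↦ by
      rw [LSeries_zetaMul χ hs, zetaEntire_of_ne (fun h ↦ by rw [h] at hs; simp at hs)]
      ring)
    (K := K * (41 * q)) (by nlinarith)
    (fun s hs ↦ by
      rw [norm_mul]
      exact mul_le_mul (hK s hs) (norm_LFunction_le_of_mem_closedBall hχ1 hs) (norm_nonneg _)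
        (by linarith)) hx hx1 hWx
  refine this.trans ((re_le_norm _).trans ?_)
  rw [zetaEntire_one, one_mul]

lemma norm_LFunction_product_one_ge [NeZero q₁] [NeZero q] {χ₁ : DirichletCharacter ℂ q₁}
    {χ : DirichletCharacter ℂ q} (hχ₁ : χ₁ ^ 2 = 1) (hχ : χ ^ 2 = 1) (hχ₁1 : χ₁ ≠ 1) (hχ1 : χ ≠ 1)
    (hψ : charProd χ₁ χ ≠ 1)
    {K : ℝ} (hK1 : 1 ≤ K) (hK : ∀ s ∈ Metric.closedBall (2 : ℂ) (3 / 2), ‖zetaEntire s‖ ≤ K)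
    {x : ℝ} (hx : 3 / 4 ≤ x) (hx1 : x < 1) (hWx : χ₁.LFunction x = 0) :
    (1 - x) / (2 * Real.exp 1) *
      (48 * (K * (41 * q₁) * ((41 * q) * (41 * (q₁ * q))))) ^ (-(6 * (1 - x))) ≤
      ‖χ₁.LFunction 1‖ * (‖χ.LFunction 1‖ * ‖(charProd χ₁ χ).LFunction 1‖) := by
  have hq1 : (1 : ℝ) ≤ q := by exact_mod_cast NeZero.one_le
  have hq₁1 : (1 : ℝ) ≤ q₁ := by exact_mod_cast NeZero.one_le
  have hqq : (1 : ℝ) ≤ q₁ * q := by nlinarith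
  have := residue_lower_bound (f := siegelCoeff χ₁ χ) (siegelCoeff_nonneg hχ₁ hχ)
    (by rw [(isMultiplicative_siegelCoeff χ₁ χ).map_one])
    (abscissaOfAbsConv_le_one fun s hs ↦ LSeriesSummable_siegelCoeff χ₁ χ hs)
    (W := fun s ↦ zetaEntire s * χ₁.LFunction s *
      (χ.LFunction s * (charProd χ₁ χ).LFunction s))
    ((differentiable_zetaEntire.mul (differentiable_LFunction hχ₁1)).mul
      ((differentiable_LFunction hχ1).mul (differentiable_LFunction hψ)))
    (fun s hs ↦ by
      rw [LSeries_siegelCoeff χ₁ χ hs, zetaEntire_of_ne (fun h ↦ by rw [h] at hs; simp at hs)]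
      ring)
    (K := K * (41 * q₁) * ((41 * q) * (41 * (q₁ * q))))
    (by
      refine one_le_mul_of_one_le_of_one_le (one_le_mul_of_one_le_of_one_le hK1 (by linarith))
        (one_le_mul_of_one_le_of_one_le (by linarith) (by linarith)))
    (fun s hs ↦ by
      have h1 := norm_LFunction_le_of_mem_closedBall hχ₁1 hs
      have h2 := norm_LFunction_le_of_mem_closedBall hχ1 hs
      have h3 := norm_LFunction_le_of_mem_closedBall hψ hs
      have h4 := hK s hs
      push_cast at h3
      rw [norm_mul, norm_mul, norm_mul]
      gcongr) hx hx1 (by simp [hWx])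
  refine this.trans ((re_le_norm _).trans ?_)
  rw [zetaEntire_one, one_mul, norm_mul, norm_mul]

end

section

open scoped ComplexOrder
open DirichletCharacter

lemma im_eq_zero_of_differentiable {W : ℂ → ℂ} (hW : Differentiable ℂ W)
    (h : ∀ x : ℝ, 1 < x → (W x).im = 0) (x : ℝ) : (W x).im = 0 := by
  set V : ℂ → ℂ := fun s ↦ (starRingEnd ℂ) (W ((starRingEnd ℂ) s)) with hV
  have hVd : Differentiable ℂ V := fun s ↦ by
    have := (hW ((starRingEnd ℂ) s)).conj_conj
    rwa [Complex.conj_conj] at this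
  have hWV : W = V := by
    refine AnalyticOnNhd.eq_of_frequently_eq (z₀ := 2) (fun z _ ↦ hW.analyticAt z)
      (fun z _ ↦ hVd.analyticAt z) ?_
    have h1 : Tendsto (fun n : ℕ ↦ ((2 + 1 / ((n : ℝ) + 1) : ℝ) : ℂ)) atTop (𝓝[≠] 2) := by
      refine tendsto_nhdsWithin_iff.mpr ⟨?_, Eventually.of_forall fun n ↦ ?_⟩
      · have := (tendsto_one_div_add_atTop_nhds_zero_nat (𝕜 := ℝ)).const_add 2
        rw [add_zero] at this
        have h3 := (continuous_ofReal.tendsto (2 : ℝ)).comp this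
        rw [ofReal_ofNat] at h3
        exact h3
      · have : (0 : ℝ) < 1 / ((n : ℝ) + 1) := by positivity
        simp only [Set.mem_compl_iff, Set.mem_singleton_iff]
        intro h
        have h' : (2 + 1 / ((n : ℝ) + 1) : ℝ) = 2 := by exact_mod_cast h
        linarith
    refine h1.frequently (Eventually.frequently (Eventually.of_forall fun n ↦ ?_))
    have : (0 : ℝ) < 1 / ((n : ℝ) + 1) := by positivity
    have h2 := h (2 + 1 / ((n : ℝ) + 1)) (by linarith)
    simp only [hV, conj_ofReal]
    exact (conj_eq_iff_im.mpr h2).symm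
  have : (starRingEnd ℂ) (W x) = W x := by
    conv_rhs => rw [hWV]
    simp [hV]
  exact conj_eq_iff_im.mp this

lemma exists_zetaEntire_ne_zero :
    ∃ δ : ℝ, 0 < δ ∧ ∀ s : ℂ, ‖s - 1‖ < δ → zetaEntire s ≠ 0 := by
  have h : ∀ᶠ s in 𝓝 (1 : ℂ), zetaEntire s ≠ 0 :=
    differentiable_zetaEntire.continuous.continuousAt.eventually_ne (by simp [zetaEntire_one])
  obtain ⟨δ, hδ, h⟩ := Metric.eventually_nhds_iff.mp h
  exact ⟨δ, hδ, fun s hs ↦ h (by rwa [dist_eq_norm])⟩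

lemma zetaEntire_ne_zero_of_one_le_re {s : ℂ} (hs : 1 ≤ s.re) : zetaEntire s ≠ 0 := by
  rcases eq_or_ne s 1 with rfl | h
  · simp [zetaEntire_one]
  · rw [zetaEntire_of_ne h]
    exact mul_ne_zero (sub_ne_zero.mpr h) (riemannZeta_ne_zero_of_one_le_re hs)

lemma re_zetaEntire_mul_nonneg {q : ℕ} [NeZero q] {χ : DirichletCharacter ℂ q} (hχ : χ ^ 2 = 1)
    (hχ1 : χ ≠ 1) {δ : ℝ} (hδ : ∀ s : ℂ, ‖s - 1‖ < δ → zetaEntire s ≠ 0) {x₀ : ℝ}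
    (hx₀ : 1 - δ < x₀) (hx1 : x₀ < 1) (h : ∀ x : ℝ, x₀ ≤ x → x < 1 → χ.LFunction x ≠ 0) :
    0 ≤ (zetaEntire x₀ * χ.LFunction x₀).re := by
  set W : ℂ → ℂ := fun s ↦ zetaEntire s * χ.LFunction s with hW
  have hWd : Differentiable ℂ W := differentiable_zetaEntire.mul (differentiable_LFunction hχ1)
  have hpos : ∀ x : ℝ, 1 < x → 0 < W x := by
    intro x hx
    have hab : LSeries.abscissaOfAbsConv (zetaMul χ) < x := lt_of_le_of_lt
      (abscissaOfAbsConv_le_one fun s hs ↦ LSeriesSummable_zetaMul χ hs) (by exact_mod_cast hx)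
    have h1 := LSeries.positive (a := zetaMul χ) (zetaMul_nonneg hχ)
      (by rw [(isMultiplicative_zetaMul χ).map_one]; exact one_pos) hab
    have h2 : W x = ((x - 1 : ℝ) : ℂ) * LSeries (zetaMul χ) x := by
      rw [LSeries_zetaMul χ (by simpa using hx), hW]
      simp only
      rw [zetaEntire_of_ne (by exact_mod_cast hx.ne')]
      push_cast; ring
    rw [h2]
    exact mul_pos (by rw [← ofReal_zero]; exact_mod_cast (by linarith : 0 < x - 1)) h1
  have him : ∀ x : ℝ, (W x).im = 0 :=
    im_eq_zero_of_differentiable hWd fun x hx ↦ (Complex.lt_def.mp (hpos x hx)).2.symm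
  have hne : ∀ x : ℝ, x₀ ≤ x → W x ≠ 0 := by
    intro x hx
    rcases lt_or_ge x 1 with hx' | hx'
    · refine mul_ne_zero (hδ _ ?_) (h x hx hx')
      rw [← ofReal_one, ← ofReal_sub, norm_real, Real.norm_eq_abs, abs_lt]
      constructor <;> linarith
    · exact mul_ne_zero (zetaEntire_ne_zero_of_one_le_re (by simpa using hx'))
        (LFunction_ne_zero_of_one_le_re χ (Or.inl hχ1) (by simpa using hx'))
  by_contra hneg
  have hc : ContinuousOn (fun x : ℝ ↦ (W x).re) (Set.Icc x₀ 2) :=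
    (continuous_re.comp (hWd.continuous.comp continuous_ofReal)).continuousOn
  have h2 : 0 < (W (2 : ℝ)).re := (Complex.lt_def.mp (hpos 2 (by norm_num))).1
  obtain ⟨x, hx, hx0⟩ := intermediate_value_Icc (by linarith) hc
    (show (0 : ℝ) ∈ Set.Icc _ _ from ⟨(not_le.mp hneg).le, h2.le⟩)
  exact hne x hx.1 (Complex.ext hx0 (him x))

lemma LFunction_eq_zero_of_charProd_eq_one {q₁ q : ℕ} [NeZero q₁] [NeZero q]
    {χ₁ : DirichletCharacter ℂ q₁} {χ : DirichletCharacter ℂ q} (hχ : χ ^ 2 = 1)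
    (h : charProd χ₁ χ = 1) {x : ℝ} (hx : 0 < x) (hx1 : x < 1) (h0 : χ₁.LFunction x = 0) :
    χ.LFunction x = 0 := by
  have hx' : (x : ℂ) ≠ 1 := by exact_mod_cast hx1.ne
  have h1 : changeLevel (Nat.dvd_mul_left q q₁) χ * changeLevel (Nat.dvd_mul_left q q₁) χ = 1 := by
    rw [← map_mul, ← sq, hχ, map_one]
  have h2 : changeLevel (Nat.dvd_mul_right q₁ q) χ₁ = changeLevel (Nat.dvd_mul_left q q₁) χ :=
    mul_right_cancel (h.trans h1.symm)
  have h3 := LFunction_changeLevel (Nat.dvd_mul_right q₁ q) χ₁ (s := x) (Or.inr hx')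
  rw [h0, zero_mul, h2, LFunction_changeLevel _ χ (Or.inr hx')] at h3
  refine (mul_eq_zero.mp h3).resolve_right (Finset.prod_ne_zero_iff.mpr fun p hp hp0 ↦ ?_)
  have hpp := Nat.prime_of_mem_primeFactors hp
  have h4 : ‖χ p * (p : ℂ) ^ (-(x : ℂ))‖ = 1 := by
    rw [← sub_eq_zero.mp hp0, norm_one]
  have h5 : ‖(p : ℂ) ^ (-(x : ℂ))‖ < 1 := by
    rw [norm_natCast_cpow_of_pos hpp.pos]
    exact Real.rpow_lt_one_of_one_lt_of_neg (by exact_mod_cast hpp.one_lt) (by simpa using hx)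
  rw [norm_mul] at h4
  nlinarith [χ.norm_le_one p, norm_nonneg (χ (p : ZMod q)), norm_nonneg ((p : ℂ) ^ (-(x : ℂ)))]

/-- **Siegel's theorem** on `L(1, χ)` for quadratic characters. -/
theorem siegel_lower_bound {η : ℝ} (hη : 0 < η) :
    ∃ c : ℝ, 0 < c ∧ ∀ (q : ℕ) [NeZero q] (χ : DirichletCharacter ℂ q), χ ^ 2 = 1 → χ ≠ 1 →
      c * (q : ℝ) ^ (-η) ≤ ‖χ.LFunction 1‖ := by
  obtain ⟨δ, hδ0, hδ⟩ := exists_zetaEntire_ne_zero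
  obtain ⟨K, hK1, hK⟩ := exists_norm_zetaEntire_le (3 / 2)
  obtain ⟨ε, hε0, hε1, hε2, hε3⟩ : ∃ ε : ℝ, 0 < ε ∧ ε ≤ 1 / 4 ∧ ε ≤ δ ∧ 13 * ε ≤ η :=
    ⟨min (1 / 4) (min δ (η / 13)), by positivity, min_le_left _ _,
      (min_le_right _ _).trans (min_le_left _ _), by
        have := (min_le_right (1 / 4) (min δ (η / 13))).trans (min_le_right _ _)
        linarith⟩
  have hexp : ∀ {x A : ℝ} {q : ℕ} [NeZero q], 1 ≤ A → x < 1 → 1 - x ≤ ε → ∀ j : ℕ,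
      (1 - x) / (2 * Real.exp 1) * (A ^ (-(6 * ε)) * (q : ℝ) ^ (-(6 * ε * j))) ≤
        (1 - x) / (2 * Real.exp 1) * (A * (q : ℝ) ^ j) ^ (-(6 * (1 - x))) := by
    intro x A q _ hA hx hxε j
    have hq1 : (1 : ℝ) ≤ q := by exact_mod_cast NeZero.one_le
    have hAq : 1 ≤ A * (q : ℝ) ^ j := one_le_mul_of_one_le_of_one_le hA (one_le_pow₀ hq1)
    have h1 : A ^ (-(6 * ε)) * (q : ℝ) ^ (-(6 * ε * j)) = (A * (q : ℝ) ^ j) ^ (-(6 * ε)) := by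
      rw [Real.mul_rpow (by linarith) (by positivity), ← Real.rpow_natCast,
        ← Real.rpow_mul (by linarith)]
      congr 2; ring
    rw [h1]
    refine mul_le_mul_of_nonneg_left (Real.rpow_le_rpow_of_exponent_le hAq (by linarith)) ?_
    exact div_nonneg (by linarith) (by positivity)
  by_cases hcase : ∃ (q₁ : ℕ) (_ : NeZero q₁) (χ₁ : DirichletCharacter ℂ q₁) (β : ℝ),
      χ₁ ^ 2 = 1 ∧ χ₁ ≠ 1 ∧ 1 - ε < β ∧ β < 1 ∧ χ₁.LFunction β = 0
  · obtain ⟨q₁, _, χ₁, β, hχ₁, hχ₁1, hβ, hβ1, hβ0⟩ := hcase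
    have hq₁1 : (1 : ℝ) ≤ q₁ := by exact_mod_cast NeZero.one_le
    obtain ⟨B, hB1, hB⟩ := norm_LFunction_le_of_far hε0 (by linarith : ε ≤ 1)
    set A := 48 * (K * (41 * q₁) * (41 * (41 * q₁))) with hA
    have hA1 : 1 ≤ A := one_le_mul_of_one_le_of_one_le (by norm_num)
      (one_le_mul_of_one_le_of_one_le (one_le_mul_of_one_le_of_one_le hK1 (by linarith))
        (by linarith))
    have hL1 : 0 < ‖χ₁.LFunction 1‖ := norm_pos_iff.mpr (LFunction_apply_one_ne_zero hχ₁1)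
    set D := ‖χ₁.LFunction 1‖ * (B * (2 * q₁) ^ ε) with hD
    have hD0 : 0 < D := by positivity
    set c₁ := (1 - β) / (2 * Real.exp 1) * A ^ (-(6 * ε)) / D with hc₁
    set c₂ := (1 - β) / (2 * Real.exp 1) * (48 * (K * 41)) ^ (-(6 * ε)) with hc₂
    have hβ' : 0 < (1 - β) / (2 * Real.exp 1) := div_pos (by linarith) (by positivity)
    have hc₁0 : 0 < c₁ := by positivity
    have hc₂0 : 0 < c₂ := by positivity
    refine ⟨min c₁ c₂, lt_min hc₁0 hc₂0, fun q _ χ hχ hχ1 ↦ ?_⟩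
    have hq1 : (1 : ℝ) ≤ q := by exact_mod_cast NeZero.one_le
    have hq0 : (0 : ℝ) < q := by linarith
    by_cases hψ : charProd χ₁ χ = 1
    · have h0 := LFunction_eq_zero_of_charProd_eq_one hχ hψ (by linarith) hβ1 hβ0
      have h1 := re_LFunction_one_ge hχ hχ1 hK1 hK (x := β) (by linarith) hβ1 (by simp [h0])
      have h2 := hexp (A := 48 * (K * 41)) (q := q) (by nlinarith) hβ1 (by linarith) 1
      rw [pow_one, show 48 * (K * 41) * (q : ℝ) = 48 * (K * (41 * q)) by ring] at h2
      refine le_trans ?_ (h2.trans h1)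
      rw [← mul_assoc]
      refine mul_le_mul (min_le_right _ _) (Real.rpow_le_rpow_of_exponent_le hq1 ?_)
        (by positivity) hc₂0.le
      push_cast; linarith
    · have h1 := norm_LFunction_product_one_ge hχ₁ hχ hχ₁1 hχ1 hψ hK1 hK (x := β)
        (by linarith) hβ1 hβ0
      have h2 := hexp (A := A) (q := q) hA1 hβ1 (by linarith) 2
      rw [show A * (q : ℝ) ^ 2 = 48 * (K * (41 * q₁) * ((41 * q) * (41 * (q₁ * q)))) by
        rw [hA]; ring] at h2
      have h3 := hB (q₁ * q) (charProd χ₁ χ) 1 (by simp; linarith) (by simp) (Or.inl hψ)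
      have h4 : conductorSize (q₁ * q) (1 : ℂ).im ^ ε = (2 * q₁) ^ ε * (q : ℝ) ^ ε := by
        rw [← Real.mul_rpow (by positivity) (by positivity), conductorSize]
        congr 1
        simp; ring
      rw [h4] at h3
      have h5 : (1 - β) / (2 * Real.exp 1) * (A ^ (-(6 * ε)) * (q : ℝ) ^ (-(6 * ε * (2 : ℕ)))) ≤
          D * (q : ℝ) ^ ε * ‖χ.LFunction 1‖ := by
        refine (h2.trans h1).trans ?_
        calc _ ≤ ‖χ₁.LFunction 1‖ * (‖χ.LFunction 1‖ * (B * ((2 * q₁) ^ ε * (q : ℝ) ^ ε))) := by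
              gcongr
          _ = _ := by rw [hD]; ring
      have h6 : c₁ * (q : ℝ) ^ (-(13 * ε)) ≤ ‖χ.LFunction 1‖ := by
        have h7 : (q : ℝ) ^ (-(13 * ε)) = (q : ℝ) ^ (-(6 * ε * (2 : ℕ))) * ((q : ℝ) ^ ε)⁻¹ := by
          rw [← Real.rpow_neg hq0.le, ← Real.rpow_add hq0]
          congr 1; push_cast; ring
        rw [h7, hc₁, div_mul_eq_mul_div, div_le_iff₀ hD0, ← mul_assoc, ← div_eq_mul_inv,
          div_le_iff₀ (by positivity)]
        linarith
      refine le_trans ?_ h6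
      exact mul_le_mul (min_le_left _ _) (Real.rpow_le_rpow_of_exponent_le hq1 (by linarith))
        (by positivity) hc₁0.le
  · push Not at hcase
    set c := (1 - (1 - ε / 2)) / (2 * Real.exp 1) * (48 * (K * 41)) ^ (-(6 * ε)) with hc
    have hc0 : 0 < c := by
      have : 0 < 1 - (1 - ε / 2) := by linarith
      positivity
    refine ⟨c, hc0, fun q _ χ hχ hχ1 ↦ ?_⟩
    have hq1 : (1 : ℝ) ≤ q := by exact_mod_cast NeZero.one_le
    have h0 := re_zetaEntire_mul_nonneg hχ hχ1 hδ (x₀ := 1 - ε / 2) (by linarith) (by linarith)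
      fun x hx hx1 ↦ hcase q inferInstance χ x hχ hχ1 (by linarith) hx1
    have h1 := re_LFunction_one_ge hχ hχ1 hK1 hK (x := 1 - ε / 2) (by linarith) (by linarith) h0
    have h2 := hexp (x := 1 - ε / 2) (A := 48 * (K * 41)) (q := q) (by nlinarith) (by linarith)
      (by linarith) 1
    rw [pow_one, show 48 * (K * 41) * (q : ℝ) = 48 * (K * (41 * q)) by ring] at h2
    refine le_trans ?_ (h2.trans h1)
    rw [← mul_assoc]
    refine mul_le_mul_of_nonneg_left (Real.rpow_le_rpow_of_exponent_le hq1 ?_) hc0.le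
    push_cast; linarith

end

section

open DirichletCharacter

lemma exists_norm_LSeries_le :
    ∃ K : ℝ, 1 ≤ K ∧ ∀ (f : ℕ → ℂ) (s : ℂ), (∀ n, ‖f n‖ ≤ 1) → 1 < s.re → s.re ≤ 3 →
      ‖LSeries f s‖ ≤ K / (s.re - 1) := by
  obtain ⟨K, hK, h⟩ := exists_norm_zetaEntire_le 1
  refine ⟨K, hK, fun f s hf hs hs3 ↦ ?_⟩
  have hre : 1 < ((s.re : ℝ) : ℂ).re := by simpa using hs
  have hsum : Summable fun n : ℕ ↦ 1 / (n : ℝ) ^ s.re := Real.summable_one_div_nat_rpow.mpr hs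
  have hterm (n : ℕ) : ‖LSeries.term f s n‖ ≤ 1 / (n : ℝ) ^ s.re := by
    rcases eq_or_ne n 0 with rfl | hn
    · simp only [LSeries.term_zero, norm_zero]; positivity
    · rw [LSeries.norm_term_eq, if_neg hn]
      gcongr
      exact hf n
  have h1 : ‖LSeries f s‖ ≤ ∑' n : ℕ, 1 / (n : ℝ) ^ s.re :=
    tsum_of_norm_bounded hsum.hasSum hterm
  have h2 : riemannZeta (s.re : ℂ) = ((∑' n : ℕ, 1 / (n : ℝ) ^ s.re : ℝ) : ℂ) := by
    rw [zeta_eq_tsum_one_div_nat_cpow hre, ofReal_tsum]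
    refine tsum_congr fun n ↦ ?_
    rw [ofReal_div, ofReal_one, ofReal_cpow n.cast_nonneg, ofReal_natCast]
  have hne : ((s.re : ℝ) : ℂ) ≠ 1 := by
    intro h
    rw [h] at hre
    simp at hre
  have h3 : ‖zetaEntire (s.re : ℂ)‖ ≤ K := by
    refine h _ ?_
    rw [mem_closedBall_iff_norm]
    have : ((s.re : ℝ) : ℂ) - 2 = ((s.re - 2 : ℝ) : ℂ) := by push_cast; ring
    rw [this, norm_real, Real.norm_eq_abs, abs_le]
    constructor <;> linarith
  rw [zetaEntire_of_ne hne, norm_mul, h2, norm_real, Real.norm_of_nonneg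
    (tsum_nonneg fun n ↦ by positivity)] at h3
  have h4 : ‖((s.re : ℝ) : ℂ) - 1‖ = s.re - 1 := by
    have : ((s.re : ℝ) : ℂ) - 1 = ((s.re - 1 : ℝ) : ℂ) := by push_cast; ring
    rw [this, norm_real, Real.norm_of_nonneg (by linarith)]
  rw [h4] at h3
  refine h1.trans ?_
  rw [le_div_iff₀ (by linarith), mul_comm]
  exact h3

lemma conductorSize_le_two_mul {q : ℕ} {t t' : ℝ} (h : |t'| ≤ 2 * |t| + 2) :
    conductorSize q t' ≤ 2 * conductorSize q t := by
  unfold conductorSize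
  have : (0 : ℝ) ≤ q := q.cast_nonneg
  nlinarith

lemma conductorSize_rpow_le {q : ℕ} [NeZero q] {t t' ε : ℝ} (hε : 0 < ε) (hε1 : ε ≤ 1)
    (h : |t'| ≤ 2 * |t| + 2) : conductorSize q t' ^ ε ≤ 2 * conductorSize q t ^ ε := by
  have h2 := two_le_conductorSize q t
  have h3 := two_le_conductorSize q t'
  calc conductorSize q t' ^ ε ≤ (2 * conductorSize q t) ^ ε := by
        gcongr
        exact conductorSize_le_two_mul h
    _ = 2 ^ ε * conductorSize q t ^ ε := Real.mul_rpow (by norm_num) (by linarith)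
    _ ≤ 2 * conductorSize q t ^ ε := by
        gcongr
        calc (2 : ℝ) ^ ε ≤ 2 ^ (1 : ℝ) := by gcongr; norm_num
          _ = 2 := Real.rpow_one 2

lemma norm_deriv_LFunction_le {ε : ℝ} (hε : 0 < ε) (hε1 : ε ≤ 1) :
    ∃ C : ℝ, 1 ≤ C ∧ ∀ (q : ℕ) [NeZero q] (χ : DirichletCharacter ℂ q) (s : ℂ),
      1 - ε / 4 ≤ s.re → s.re ≤ 5 / 2 → (χ ≠ 1 ∨ 3 / 8 ≤ |s.im|) →
        ‖deriv χ.LFunction s‖ ≤ C * conductorSize q s.im ^ ε := by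
  obtain ⟨C, hC, h⟩ := norm_LFunction_le_of_far hε hε1
  refine ⟨C * 2 / (ε / 8), ?_, fun q _ χ s hs1 hs2 hs ↦ ?_⟩
  · rw [le_div_iff₀ (by positivity)]; nlinarith
  have hball (z : ℂ) (hz : z ∈ Metric.closedBall s (ε / 8)) :
      |z.re - s.re| ≤ ε / 8 ∧ |z.im - s.im| ≤ ε / 8 := by
    rw [mem_closedBall_iff_norm] at hz
    have h1 := abs_re_le_norm (z - s)
    have h2 := abs_im_le_norm (z - s)
    rw [sub_re] at h1
    rw [sub_im] at h2
    exact ⟨h1.trans hz, h2.trans hz⟩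
  have hfar (z : ℂ) (hz : z ∈ Metric.closedBall s (ε / 8)) : χ ≠ 1 ∨ 1 / 4 ≤ |z.im| := by
    refine hs.imp_right fun h ↦ ?_
    have h1 := abs_sub_abs_le_abs_sub s.im z.im
    rw [abs_sub_comm] at h1
    linarith [(hball z hz).2]
  have hd : DiffContOnCl ℂ χ.LFunction (Metric.ball s (ε / 8)) := by
    refine DifferentiableOn.diffContOnCl_ball (fun z hz ↦ ?_) subset_rfl
    refine (χ.differentiableAt_LFunction z ?_).differentiableWithinAt
    refine (hfar z hz).symm.imp_left fun h h1 ↦ ?_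
    rw [h1, one_im, abs_zero] at h
    norm_num at h
  have := norm_deriv_le_of_forall_mem_sphere_norm_le (R := ε / 8) (by positivity) hd
    (C := C * (2 * conductorSize q s.im ^ ε)) fun z hz ↦ by
      have hz' := Metric.sphere_subset_closedBall hz
      obtain ⟨h1, h2⟩ := hball z hz'
      rw [abs_le] at h1
      refine (h q χ z (by linarith) (by linarith) (hfar z hz')).trans ?_
      gcongr
      refine conductorSize_rpow_le hε hε1 ?_
      have h3 := abs_sub_abs_le_abs_sub z.im s.im
      linarith [abs_nonneg s.im]
  refine this.trans (le_of_eq ?_)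
  ring

/-- The consequence of the `3-4-1` inequality away from the pole of `L(s, χ²)`. -/
lemma exists_pow_four_norm_LFunction_ge {δ κ : ℝ} (hδ : 0 < δ) (hδ1 : δ ≤ 1) (hκ : 0 < κ) :
    ∃ c : ℝ, 0 < c ∧ ∀ (q : ℕ) [NeZero q] (χ : DirichletCharacter ℂ q) (x t : ℝ),
      0 < x → x ≤ 1 → (χ ^ 2 ≠ 1 ∨ κ * conductorSize q t ^ (-(2 * δ)) ≤ |t|) →
        c * x ^ 3 * conductorSize q t ^ (-(3 * δ)) ≤ ‖χ.LFunction (1 + x + I * t)‖ ^ 4 := by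
  obtain ⟨K, hK, hK'⟩ := exists_norm_LSeries_le
  obtain ⟨C, hC, h⟩ := norm_LFunction_le hδ hδ1
  refine ⟨(K ^ 3 * (C * 2 * (1 + 1 / κ)))⁻¹, by positivity, fun q _ χ x t hx hx1 ht ↦ ?_⟩
  set Y := conductorSize q t with hY
  have hY2 : 2 ≤ Y := two_le_conductorSize q t
  have hP : 1 ≤ Y ^ δ := Real.one_le_rpow (by linarith) hδ.le
  have h1 : ‖LFunctionTrivChar q (1 + x)‖ ≤ K / x := by
    have : 1 < (1 + x : ℂ).re := by simpa using hx
    rw [LFunctionTrivChar, DirichletCharacter.LFunction_eq_LSeries 1 this]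
    have := hK' (fun n ↦ (1 : DirichletCharacter ℂ q) n) (1 + x)
      (fun n ↦ DirichletCharacter.norm_le_one _ _) this (by simp; linarith)
    simpa using this
  have h2 : ‖(χ ^ 2).LFunction (1 + x + 2 * I * t)‖ ≤ C * (2 * Y ^ δ) *
      (Y ^ (2 * δ) * (1 + 1 / κ)) := by
    have him : (1 + x + 2 * I * t : ℂ).im = 2 * t := by simp
    have hre : (1 + x + 2 * I * t : ℂ).re = 1 + x := by simp
    have hY2δ : 1 ≤ Y ^ (2 * δ) := Real.one_le_rpow (by linarith) (by linarith)
    have ht0 : χ ^ 2 ≠ 1 ∨ 0 < |t| := ht.imp_right fun h ↦ lt_of_lt_of_le (by positivity) h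
    have := h q (χ ^ 2) (1 + x + 2 * I * t) (by rw [hre]; linarith) (by rw [hre]; linarith)
      (by rw [him]; exact ht0.imp_right fun h ↦ mul_ne_zero two_ne_zero (abs_pos.mp h))
    refine this.trans ?_
    gcongr
    · rw [him]
      refine conductorSize_rpow_le hδ hδ1 ?_
      rw [abs_mul, abs_two]; linarith
    · by_cases hχ : χ ^ 2 = 1
      · have ht1 : κ * Y ^ (-(2 * δ)) ≤ |t| := ht.resolve_left (not_not.mpr hχ)
        have h3 : |t| ≤ ‖(1 + x + 2 * I * t : ℂ) - 1‖ := by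
          refine le_trans ?_ (abs_im_le_norm _)
          rw [sub_im, him, one_im, sub_zero, abs_mul, abs_two]
          linarith [abs_nonneg t]
        have h4 : 0 < κ * Y ^ (-(2 * δ)) := by positivity
        calc 1 + ‖charMean (χ ^ 2)‖ / ‖(1 + x + 2 * I * t : ℂ) - 1‖
            ≤ 1 + 1 / (κ * Y ^ (-(2 * δ))) := by
              gcongr
              · exact norm_charMean_le_one _
              · exact ht1.trans h3
          _ = 1 + Y ^ (2 * δ) * (1 / κ) := by
              rw [Real.rpow_neg (by linarith)]; field_simp
          _ ≤ _ := by rw [mul_add, mul_one]; gcongr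
      · rw [charMean_eq_zero hχ, norm_zero, zero_div, add_zero]
        have : 0 < 1 / κ := by positivity
        nlinarith
  have h3 := χ.norm_LFunction_product_ge_one hx t
  rw [norm_mul, norm_mul, norm_pow, norm_pow] at h3
  set L := ‖χ.LFunction (1 + x + I * t)‖
  have h4 : 1 ≤ (K / x) ^ 3 * L ^ 4 * (C * (2 * Y ^ δ) * (Y ^ (2 * δ) * (1 + 1 / κ))) := by
    refine h3.le.trans ?_
    gcongr
  have h5 : Y ^ (3 * δ) = Y ^ δ * Y ^ (2 * δ) := by
    rw [← Real.rpow_add (by linarith)]; ring_nf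
  rw [Real.rpow_neg (by linarith), h5]
  have hx3 : 0 < x ^ 3 := by positivity
  rw [inv_mul_eq_div, ← div_eq_mul_inv, div_div, div_le_iff₀ (by positivity)]
  rw [div_pow] at h4
  calc x ^ 3 = x ^ 3 * 1 := (mul_one _).symm
    _ ≤ x ^ 3 * (K ^ 3 / x ^ 3 * L ^ 4 * (C * (2 * Y ^ δ) * (Y ^ (2 * δ) * (1 + 1 / κ)))) := by
        gcongr
    _ = _ := by field_simp

end

section

open DirichletCharacter

lemma convex_reProdIm {s t : Set ℝ} (hs : Convex ℝ s) (ht : Convex ℝ t) : Convex ℝ (s ×ℂ t) :=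
  (hs.linear_preimage reLm).inter (ht.linear_preimage imLm)

lemma conductorSize_rpow_neg_nat_mul {q : ℕ} [NeZero q] {t δ : ℝ} (n : ℕ) :
    conductorSize q t ^ (-(n * δ)) = ((conductorSize q t ^ δ) ^ n)⁻¹ := by
  have := two_le_conductorSize q t
  rw [Real.rpow_neg (by linarith), mul_comm, Real.rpow_mul (by linarith), Real.rpow_natCast]

lemma exists_norm_LFunction_ge_of_sq_ne {δ κ : ℝ} (hδ : 0 < δ) (hδ1 : δ ≤ 1) (hκ : 0 < κ) :
    ∃ c : ℝ, 0 < c ∧ ∀ (q : ℕ) [NeZero q] (χ : DirichletCharacter ℂ q) (s : ℂ),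
      1 < s.re → s.re ≤ 2 → (χ ≠ 1 ∨ 3 / 8 ≤ |s.im|) →
      (χ ^ 2 ≠ 1 ∨ κ * conductorSize q s.im ^ (-(2 * δ)) ≤ |s.im|) →
        c * conductorSize q s.im ^ (-(7 * δ)) ≤ ‖χ.LFunction s‖ := by
  obtain ⟨c₀, hc₀, h₀⟩ := exists_pow_four_norm_LFunction_ge hδ hδ1 hκ
  obtain ⟨C, hC, h₁⟩ := norm_deriv_LFunction_le hδ hδ1
  set a := min 1 c₀ with ha
  have ha0 : 0 < a := lt_min one_pos hc₀
  have ha1 : a ≤ 1 := min_le_left _ _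
  refine ⟨a ^ 4 / (16 * C ^ 3), by positivity, fun q _ χ s hs1 hs2 hfar hsq ↦ ?_⟩
  set t := s.im with ht
  have e7 := conductorSize_rpow_neg_nat_mul (q := q) (t := t) (δ := δ) 7
  have e3 := conductorSize_rpow_neg_nat_mul (q := q) (t := t) (δ := δ) 3
  rw [Nat.cast_ofNat] at e7 e3
  rw [e7]
  have hY2 := two_le_conductorSize q t
  have hP1 : 1 ≤ conductorSize q t ^ δ := Real.one_le_rpow (by linarith) hδ.le
  have h₁' := fun z : ℂ ↦ h₁ q χ z
  have h₀' := fun x : ℝ ↦ h₀ q χ x t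
  simp only [e3] at h₀'
  set P := conductorSize q t ^ δ with hP
  set w := a / (2 * C * P ^ 2) with hw
  have hw0 : 0 < w := by positivity
  have hw1 : w ≤ 1 := by
    rw [hw, div_le_one (by positivity)]
    have : 1 ≤ P ^ 2 := one_le_pow₀ hP1
    nlinarith
  have hw4 : w ^ 4 ≤ 1 := pow_le_one₀ hw0.le hw1
  have hcP : a ^ 4 / (16 * C ^ 3) * (P ^ 7)⁻¹ = a * w ^ 3 / (2 * P) := by
    rw [hw]; field_simp; norm_num
  have key (x : ℝ) (hx : w ^ 4 ≤ x) (hx1 : x ≤ 1) :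
      a * w ^ 3 / P ≤ ‖χ.LFunction (1 + x + I * t)‖ := by
    have hx0 : 0 < x := lt_of_lt_of_le (by positivity) hx
    refine le_of_pow_le_pow_left₀ four_ne_zero (norm_nonneg _) (le_trans ?_ (h₀' x hx0 hx1 hsq))
    have h4 : a ^ 4 ≤ c₀ := by
      have h2 : a ^ 4 ≤ a := pow_le_of_le_one ha0.le ha1 four_ne_zero
      exact h2.trans (min_le_right _ _)
    calc (a * w ^ 3 / P) ^ 4 = a ^ 4 * (w ^ 4) ^ 3 * (P ^ 4)⁻¹ := by field_simp
      _ ≤ c₀ * x ^ 3 * (P ^ 3)⁻¹ := by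
        gcongr
        · norm_num
  rw [hcP]
  have hs_eq : s = 1 + ((s.re - 1 : ℝ) : ℂ) + I * t := by
    apply Complex.ext <;> simp [ht]
  by_cases hcase : w ^ 4 ≤ s.re - 1
  · have := key (s.re - 1) hcase (by linarith)
    rw [← hs_eq] at this
    refine le_trans ?_ this
    gcongr
    linarith
  · push Not at hcase
    have hconv : Convex ℝ (Set.Icc (1 : ℝ) 2 ×ℂ {t}) :=
      convex_reProdIm (convex_Icc 1 2) (convex_singleton t)
    have h2 := Convex.norm_image_sub_le_of_norm_deriv_le (f := χ.LFunction) (C := C * P)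
      (s := Set.Icc (1 : ℝ) 2 ×ℂ {t}) (x := s) (y := 1 + ((w ^ 4 : ℝ) : ℂ) + I * t)
      (fun z hz ↦ by
        rw [mem_reProdIm] at hz
        refine χ.differentiableAt_LFunction z (hfar.symm.imp_left fun h hz1 ↦ ?_)
        have : z.im = t := hz.2
        rw [← this, hz1, one_im, abs_zero] at h
        norm_num at h)
      (fun z hz ↦ by
        rw [mem_reProdIm] at hz
        have him : z.im = t := hz.2
        have := h₁' z (by linarith [hz.1.1]) (by linarith [hz.1.2]) (by rwa [him])
        rwa [him] at this) hconv
      (by rw [mem_reProdIm]; exact ⟨⟨hs1.le, hs2⟩, rfl⟩)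
      (by
        rw [mem_reProdIm]
        have : 0 < w ^ 4 := by positivity
        refine ⟨⟨?_, ?_⟩, ?_⟩
        · simp only [add_re, one_re, ofReal_re, mul_re, I_re, I_im, ofReal_im]; linarith
        · simp only [add_re, one_re, ofReal_re, mul_re, I_re, I_im, ofReal_im]; linarith
        · simp [-ofReal_pow])
    have h3 : ‖1 + ((w ^ 4 : ℝ) : ℂ) + I * t - s‖ ≤ w ^ 4 := by
      have : 1 + ((w ^ 4 : ℝ) : ℂ) + I * t - s = ((w ^ 4 - (s.re - 1) : ℝ) : ℂ) := by
        apply Complex.ext <;> simp [ht, -ofReal_pow]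
        ring
      rw [this, norm_real, Real.norm_eq_abs, abs_of_nonneg (by linarith)]
      linarith
    have h4 := key (w ^ 4) le_rfl hw4
    have h5 : C * P * w ^ 4 = a * w ^ 3 / (2 * P) := by
      rw [hw]; field_simp
    have h6 : a * w ^ 3 / P = 2 * (a * w ^ 3 / (2 * P)) := by field_simp
    have h7 := norm_sub_norm_le (χ.LFunction (1 + ((w ^ 4 : ℝ) : ℂ) + I * t)) (χ.LFunction s)
    have h8 : C * P * ‖1 + ((w ^ 4 : ℝ) : ℂ) + I * t - s‖ ≤ C * P * w ^ 4 := by gcongr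
    linarith

theorem exists_norm_LFunction_ge {ε : ℝ} (hε : 0 < ε) (hε1 : ε ≤ 1) :
    ∃ c : ℝ, 0 < c ∧ ∀ (q : ℕ) [NeZero q] (χ : DirichletCharacter ℂ q) (s : ℂ),
      1 < s.re → s.re ≤ 2 → (χ ≠ 1 ∨ 3 / 8 ≤ |s.im|) →
        c * conductorSize q s.im ^ (-ε) ≤ ‖χ.LFunction s‖ := by
  set δ := ε / 7 with hδε
  have hδ : 0 < δ := by positivity
  have hδ1 : δ ≤ 1 := by linarith
  obtain ⟨c₁, hc₁, hS⟩ := siegel_lower_bound hδ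
  obtain ⟨C, hC, hD⟩ := norm_deriv_LFunction_le hδ hδ1
  obtain ⟨K, hK, hK'⟩ := exists_norm_LSeries_le
  set κ := min (c₁ / (4 * C)) (3 / 8) with hκ
  have hκ0 : 0 < κ := lt_min (by positivity) (by norm_num)
  have hκ1 : κ ≤ 3 / 8 := min_le_right _ _
  have hκ2 : κ ≤ c₁ / (4 * C) := min_le_left _ _
  obtain ⟨c₂, hc₂, hA⟩ := exists_norm_LFunction_ge_of_sq_ne hδ hδ1 hκ0
  refine ⟨min c₂ (min (κ / K) (c₁ / 2)), by positivity, fun q _ χ s hs1 hs2 hfar ↦ ?_⟩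
  set t := s.im with ht
  have hY2 := two_le_conductorSize q t
  have hP1 : 1 ≤ conductorSize q t ^ δ := Real.one_le_rpow (by linarith) hδ.le
  have e7 := conductorSize_rpow_neg_nat_mul (q := q) (t := t) (δ := δ) 7
  have e2 := conductorSize_rpow_neg_nat_mul (q := q) (t := t) (δ := δ) 2
  rw [Nat.cast_ofNat] at e7 e2
  have eε : -ε = -(7 * δ) := by rw [hδε]; ring
  have hA' := hA q χ s hs1 hs2 hfar
  rw [← ht] at hA'
  rw [eε]
  rw [e7, e2] at hA'
  rw [e7]
  by_cases hsq : χ ^ 2 ≠ 1 ∨ κ * ((conductorSize q t ^ δ) ^ 2)⁻¹ ≤ |t|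
  · refine le_trans ?_ (hA' hsq)
    gcongr
    exact min_le_left _ _
  push Not at hsq
  obtain ⟨hχ2, htκ⟩ := hsq
  have hPY : conductorSize q t ^ δ = conductorSize q t ^ δ := rfl
  set P := conductorSize q t ^ δ with hP
  have hPinv : (P ^ 2)⁻¹ ≤ 1 := inv_le_one_of_one_le₀ (one_le_pow₀ hP1)
  have hχ1 : χ ≠ 1 := by
    refine hfar.resolve_right fun h ↦ ?_
    nlinarith
  by_cases hre : κ * (P ^ 2)⁻¹ ≤ s.re - 1
  · have h1 := LSeries.mul_mu_eq_one χ hs1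
    rw [← DirichletCharacter.LFunction_eq_LSeries χ hs1] at h1
    have h2 := congrArg norm h1
    rw [norm_mul, norm_one] at h2
    have h3 := hK' ((fun n : ℕ ↦ χ n) * fun n : ℕ ↦ ((ArithmeticFunction.moebius n : ℤ) : ℂ)) s
      (fun n ↦ by
        rw [Pi.mul_apply, norm_mul]
        refine mul_le_one₀ (χ.norm_le_one _) (norm_nonneg _) ?_
        rw [norm_intCast]
        exact_mod_cast ArithmeticFunction.abs_moebius_le_one) hs1 (by linarith)
    have h4 : K / (s.re - 1) ≤ K / (κ * (P ^ 2)⁻¹) := by gcongr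
    have h5 : 1 ≤ ‖χ.LFunction s‖ * (K / (κ * (P ^ 2)⁻¹)) := by
      rw [← h2]; gcongr; exact h3.trans h4
    have h6 : κ * (P ^ 2)⁻¹ / K ≤ ‖χ.LFunction s‖ := by
      rw [mul_div_assoc', one_le_div (by positivity)] at h5
      rw [div_le_iff₀ (by positivity)]
      exact h5
    refine le_trans ?_ h6
    calc min c₂ (min (κ / K) (c₁ / 2)) * (P ^ 7)⁻¹ ≤ κ / K * (P ^ 2)⁻¹ := by
          gcongr
          · exact (min_le_right _ _).trans (min_le_left _ _)
          · norm_num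
      _ = _ := by ring
  · push Not at hre
    have hconv : Convex ℝ (Set.Icc (1 : ℝ) 2 ×ℂ Set.Icc (-|t|) |t|) :=
      convex_reProdIm (convex_Icc 1 2) (convex_Icc _ _)
    have h2 := Convex.norm_image_sub_le_of_norm_deriv_le (f := χ.LFunction) (C := C * P)
      (s := Set.Icc (1 : ℝ) 2 ×ℂ Set.Icc (-|t|) |t|) (x := s) (y := 1)
      (fun z hz ↦ χ.differentiableAt_LFunction z (Or.inr hχ1))
      (fun z hz ↦ by
        rw [mem_reProdIm] at hz
        have him : |z.im| ≤ |t| := abs_le.mpr hz.2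
        refine (hD q χ z (by linarith [hz.1.1]) (by linarith [hz.1.2]) (Or.inl hχ1)).trans ?_
        have := two_le_conductorSize q z.im
        rw [hP]
        gcongr
        unfold conductorSize
        gcongr) hconv
      (by rw [mem_reProdIm]; exact ⟨⟨hs1.le, hs2⟩, ⟨neg_abs_le _, le_abs_self _⟩⟩)
      (by rw [mem_reProdIm]; simp)
    have h3 : ‖1 - s‖ ≤ 2 * (κ * (P ^ 2)⁻¹) := by
      refine (Complex.norm_le_abs_re_add_abs_im _).trans ?_
      rw [sub_re, sub_im, one_re, one_im, zero_sub, abs_neg, abs_sub_comm, abs_of_pos (by linarith)]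
      linarith
    have h4 : C * P * ‖1 - s‖ ≤ c₁ / 2 * P⁻¹ := by
      calc C * P * ‖1 - s‖ ≤ C * P * (2 * (c₁ / (4 * C) * (P ^ 2)⁻¹)) := by
            gcongr
            refine h3.trans ?_
            gcongr
        _ = _ := by field_simp; norm_num
    have h5 : c₁ * P⁻¹ ≤ ‖χ.LFunction 1‖ := by
      refine le_trans ?_ (hS q χ hχ2 hχ1)
      rw [hP, ← Real.rpow_neg (by linarith)]
      have hq0 : (0 : ℝ) < q := by exact_mod_cast NeZero.pos q
      gcongr 1
      refine Real.rpow_le_rpow_of_nonpos hq0 ?_ (by linarith)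
      unfold conductorSize
      nlinarith [abs_nonneg t]
    have h6 := norm_sub_norm_le (χ.LFunction 1) (χ.LFunction s)
    have h7 : c₁ / 2 * P⁻¹ ≤ ‖χ.LFunction s‖ := by
      have : c₁ * P⁻¹ = 2 * (c₁ / 2 * P⁻¹) := by ring
      linarith
    refine le_trans ?_ h7
    gcongr
    · exact (min_le_right _ _).trans (min_le_right _ _)
    · exact le_self_pow₀ hP1 (by norm_num)

end

section

open DirichletCharacter

/-- The twist of the Möbius function by a Dirichlet character. -/
noncomputable def charMoebius {q : ℕ} (χ : DirichletCharacter ℂ q) : ℕ → ℂ :=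
  (fun n : ℕ ↦ χ n) * fun n : ℕ ↦ ((ArithmeticFunction.moebius n : ℤ) : ℂ)

lemma norm_charMoebius_le {q : ℕ} (χ : DirichletCharacter ℂ q) (n : ℕ) :
    ‖charMoebius χ n‖ ≤ 1 := by
  rw [charMoebius, Pi.mul_apply, norm_mul]
  refine mul_le_one₀ (χ.norm_le_one _) (norm_nonneg _) ?_
  rw [norm_intCast]
  exact_mod_cast ArithmeticFunction.abs_moebius_le_one

lemma LSeriesSummable_charMoebius {q : ℕ} (χ : DirichletCharacter ℂ q) {s : ℂ} (hs : 1 < s.re) :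
    LSeriesSummable (charMoebius χ) s :=
  LSeriesSummable_mul χ (ArithmeticFunction.LSeriesSummable_moebius_iff.mpr hs)

lemma abscissaOfAbsConv_charMoebius_lt {q : ℕ} (χ : DirichletCharacter ℂ q) {s : ℂ}
    (hs : 1 < s.re) : LSeries.abscissaOfAbsConv (charMoebius χ) < s.re :=
  (abscissaOfAbsConv_le_one fun _ h ↦ LSeriesSummable_charMoebius χ h).trans_lt
    (by exact_mod_cast hs)

lemma norm_LSeries_logMul_charMoebius {q : ℕ} [NeZero q] (χ : DirichletCharacter ℂ q) (k : ℕ)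
    {G : ℂ → ℂ} (hG : ∀ z : ℂ, 1 < z.re → χ.LFunction z * G z = 1) {s : ℂ} (hs : 1 < s.re) :
    ‖LSeries (LSeries.logMul^[k] (charMoebius χ)) s‖ = ‖iteratedDeriv k G s‖ := by
  have h1 : LSeries (charMoebius χ) =ᶠ[𝓝 s] G := by
    filter_upwards [(isOpen_lt continuous_const continuous_re).mem_nhds hs] with z hz
    have h2 := LSeries.mul_mu_eq_one χ hz
    rw [← DirichletCharacter.LFunction_eq_LSeries χ hz] at h2
    exact mul_left_cancel₀ (LFunction_ne_zero_of_one_le_re χ (Or.inr fun h ↦ by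
      simp [h] at hz) (le_of_lt hz)) (h2.trans (hG z hz).symm)
  rw [← h1.iteratedDeriv_eq, LSeries_iteratedDeriv k (abscissaOfAbsConv_charMoebius_lt χ hs),
    norm_mul, norm_pow, norm_neg, norm_one, one_pow, one_mul]

lemma exists_norm_LSeries_logMul_charMoebius_le_of_far (k : ℕ) :
    ∃ C : ℝ, 0 < C ∧ ∀ (q : ℕ) [NeZero q] (χ : DirichletCharacter ℂ q) (s : ℂ),
      1 < s.re → s.re ≤ 2 → (χ ≠ 1 ∨ 1 / 2 ≤ |s.im|) →
        ‖LSeries (LSeries.logMul^[k] (charMoebius χ)) s‖ ≤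
          C * conductorSize q s.im ^ (1 / 2 : ℝ) := by
  set δ : ℝ := 1 / (4 * (k + 1)) with hδdef
  have hδ : 0 < δ := by positivity
  have hδ1 : δ ≤ 1 := by
    rw [hδdef, div_le_one (by positivity)]
    have : (0 : ℝ) ≤ k := k.cast_nonneg
    linarith
  obtain ⟨c₀, hc₀, hL⟩ := exists_norm_LFunction_ge hδ hδ1
  obtain ⟨C, hC, hD⟩ := norm_deriv_LFunction_le hδ hδ1
  set c := min c₀ 1 with hc
  have hc0 : 0 < c := lt_min hc₀ one_pos
  have hc1 : c ≤ 1 := min_le_right _ _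
  refine ⟨k.factorial * (2 / c) * (16 * C / (c * δ)) ^ k, by positivity,
    fun q _ χ s hs1 hs2 hfar ↦ ?_⟩
  have hY2 := two_le_conductorSize q s.im
  have hP1 : 1 ≤ conductorSize q s.im ^ δ := Real.one_le_rpow (by linarith) hδ.le
  have hLs := hL q χ s hs1 hs2 (hfar.imp_right fun h ↦ by linarith)
  have e1 := conductorSize_rpow_neg_nat_mul (q := q) (t := s.im) (δ := δ) 1
  rw [Nat.cast_one, one_mul, pow_one] at e1
  rw [e1] at hLs
  have hdist : ∀ z : ℂ, |z.im| ≤ 2 * |s.im| + 2 →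
    conductorSize q z.im ^ δ ≤ 2 * conductorSize q s.im ^ δ :=
      fun z hz ↦ conductorSize_rpow_le hδ hδ1 hz
  have hPY : (conductorSize q s.im ^ δ) ^ (2 * k + 1) ≤ conductorSize q s.im ^ (1 / 2 : ℝ) := by
    rw [← Real.rpow_natCast, ← Real.rpow_mul (by linarith)]
    refine Real.rpow_le_rpow_of_exponent_le (by linarith) ?_
    rw [hδdef, one_div_mul_eq_div, div_le_iff₀ (by positivity)]
    push_cast
    linarith
  refine le_trans ?_ (mul_le_mul_of_nonneg_left hPY (by positivity))
  set P := conductorSize q s.im ^ δ with hP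
  set R := c * δ / (16 * C * P ^ 2) with hR
  have hR0 : 0 < R := by positivity
  have hP2 : 1 ≤ P ^ 2 := one_le_pow₀ hP1
  have hR1 : R ≤ δ / 8 := by
    rw [hR, div_le_iff₀ (by positivity)]
    have : 1 ≤ C * P ^ 2 := by nlinarith
    nlinarith
  have hball (z : ℂ) (hz : z ∈ Metric.closedBall s R) :
      |z.re - s.re| ≤ R ∧ |z.im - s.im| ≤ R := by
    rw [mem_closedBall_iff_norm] at hz
    have h1 := abs_re_le_norm (z - s)
    have h2 := abs_im_le_norm (z - s)
    rw [sub_re] at h1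
    rw [sub_im] at h2
    exact ⟨h1.trans hz, h2.trans hz⟩
  have hfar' (z : ℂ) (hz : z ∈ Metric.closedBall s R) : χ ≠ 1 ∨ 3 / 8 ≤ |z.im| := by
    refine hfar.imp_right fun h ↦ ?_
    have h1 := abs_sub_abs_le_abs_sub s.im z.im
    rw [abs_sub_comm] at h1
    linarith [(hball z hz).2]
  have hdiff (z : ℂ) (hz : z ∈ Metric.closedBall s R) : DifferentiableAt ℂ χ.LFunction z := by
    refine χ.differentiableAt_LFunction z ((hfar' z hz).symm.imp_left fun h h1 ↦ ?_)
    rw [h1, one_im, abs_zero] at h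
    norm_num at h
  have hlow (z : ℂ) (hz : z ∈ Metric.closedBall s R) : c / (2 * P) ≤ ‖χ.LFunction z‖ := by
    have h1 := Convex.norm_image_sub_le_of_norm_deriv_le (f := χ.LFunction) (C := C * (2 * P))
      (s := Metric.closedBall s R) (x := z) (y := s) hdiff
      (fun w hw ↦ by
        obtain ⟨h1, h2⟩ := hball w hw
        rw [abs_le] at h1
        refine (hD q χ w (by linarith) (by linarith) (hfar' w hw)).trans ?_
        gcongr
        refine hdist w ?_
        have h3 := abs_sub_abs_le_abs_sub w.im s.im
        linarith [abs_nonneg s.im]) (convex_closedBall _ _) hz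
      (Metric.mem_closedBall_self hR0.le)
    have h2 : C * (2 * P) * ‖s - z‖ ≤ C * (2 * P) * R := by
      gcongr
      rw [norm_sub_rev]
      exact mem_closedBall_iff_norm.mp hz
    have h3 : C * (2 * P) * R ≤ c / (2 * P) := by
      rw [hR, le_div_iff₀ (by positivity)]
      have : C * (2 * P) * (c * δ / (16 * C * P ^ 2)) * (2 * P) = c * δ / 4 := by
        field_simp; norm_num
      rw [this]
      nlinarith
    have h4 : 2 * (c / (2 * P)) ≤ ‖χ.LFunction s‖ := by
      refine le_trans ?_ hLs
      calc 2 * (c / (2 * P)) = c * P⁻¹ := by field_simp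
        _ ≤ c₀ * P⁻¹ := by gcongr; exact min_le_left _ _
    have h5 := norm_sub_norm_le (χ.LFunction s) (χ.LFunction z)
    linarith
  have hne (z : ℂ) (hz : z ∈ Metric.closedBall s R) : χ.LFunction z ≠ 0 := by
    rw [← norm_pos_iff]
    exact lt_of_lt_of_le (by positivity) (hlow z hz)
  rw [norm_LSeries_logMul_charMoebius χ k (G := fun z ↦ (χ.LFunction z)⁻¹) (fun z hz ↦
    mul_inv_cancel₀ (LFunction_ne_zero_of_one_le_re χ (Or.inr fun h ↦ by
      simp [h] at hz) (le_of_lt hz))) hs1]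
  have := norm_iteratedDeriv_le_of_forall_mem_sphere_norm_le (f := fun z ↦ (χ.LFunction z)⁻¹)
    (C := 2 * P / c) k hR0
    (DifferentiableOn.diffContOnCl_ball (fun z hz ↦
      ((hdiff z hz).inv (hne z hz)).differentiableWithinAt) subset_rfl)
    fun z hz ↦ by
      have := hlow z (Metric.sphere_subset_closedBall hz)
      rw [norm_inv]
      refine (inv_anti₀ (by positivity) this).trans (le_of_eq ?_)
      rw [inv_div]
  refine this.trans (le_of_eq ?_)
  have hRinv : R = (16 * C / (c * δ) * P ^ 2)⁻¹ := by
    rw [hR, ← inv_div]; congr 1; field_simp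
  rw [hRinv, inv_pow, div_inv_eq_mul, mul_pow, ← pow_mul]
  ring

lemma norm_one_sub_prime_cpow_ge {p : ℕ} (hp : p.Prime) {z : ℂ} (hz : 1 / 2 ≤ z.re) :
    1 ≤ (p : ℝ) ^ 2 * ‖1 - (p : ℂ) ^ (-z)‖ := by
  have hp2 : (2 : ℝ) ≤ p := by exact_mod_cast hp.two_le
  have h1 : ‖(p : ℂ) ^ (-z)‖ ≤ 3 / 4 := by
    rw [norm_natCast_cpow_of_pos hp.pos, neg_re, Real.rpow_neg (by linarith)]
    rw [inv_le_comm₀ (by positivity) (by norm_num)]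
    calc (3 / 4 : ℝ)⁻¹ ≤ √2 := Real.le_sqrt_of_sq_le (by norm_num)
      _ = (2 : ℝ) ^ (1 / 2 : ℝ) := Real.sqrt_eq_rpow 2
      _ ≤ (p : ℝ) ^ (1 / 2 : ℝ) := by gcongr
      _ ≤ (p : ℝ) ^ z.re := Real.rpow_le_rpow_of_exponent_le (by linarith) hz
  have h2 := norm_sub_norm_le 1 ((p : ℂ) ^ (-z))
  rw [norm_one] at h2
  nlinarith

lemma exists_norm_LSeries_logMul_charMoebius_le_of_near (k : ℕ) :
    ∃ C : ℝ, 0 < C ∧ ∀ (q : ℕ) [NeZero q] (s : ℂ), 1 < s.re → s.re ≤ 2 → |s.im| ≤ 1 / 2 →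
        ‖LSeries (LSeries.logMul^[k] (charMoebius (1 : DirichletCharacter ℂ q))) s‖ ≤
          C * q ^ 2 := by
  set K : Set ℂ := Set.Icc (1 : ℝ) 2 ×ℂ Set.Icc (-(1 / 2)) (1 / 2) with hK
  have hKc : IsCompact K := isCompact_Icc.reProdIm isCompact_Icc
  have hU : IsOpen {z : ℂ | zetaEntire z ≠ 0} :=
    isOpen_ne_fun differentiable_zetaEntire.continuous continuous_const
  obtain ⟨ρ, hρ, hsub⟩ := hKc.exists_cthickening_subset_open hU fun z hz ↦
    zetaEntire_ne_zero_of_one_le_re (mem_reProdIm.mp hz).1.1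
  have hTc : IsCompact (Metric.cthickening ρ K) := hKc.cthickening
  obtain ⟨M, hM⟩ := hTc.exists_bound_of_continuousOn (f := fun z ↦ (zetaEntire z)⁻¹)
    (differentiable_zetaEntire.continuous.continuousOn.inv₀ fun z hz ↦ hsub hz)
  set R := min ρ (1 / 2) with hR
  have hR0 : 0 < R := lt_min hρ (by norm_num)
  have hR2 : R ≤ 1 / 2 := min_le_right _ _
  refine ⟨k.factorial * (2 * max M 1) / R ^ k, by positivity, fun q _ s hs1 hs2 him ↦ ?_⟩
  have hsK : s ∈ K := mem_reProdIm.mpr ⟨⟨hs1.le, hs2⟩, abs_le.mp him⟩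
  have hball (z : ℂ) (hz : z ∈ Metric.closedBall s R) : 1 / 2 ≤ z.re := by
    rw [mem_closedBall_iff_norm] at hz
    have h1 := (abs_re_le_norm (z - s)).trans hz
    rw [sub_re, abs_le] at h1
    linarith
  have hmem (z : ℂ) (hz : z ∈ Metric.closedBall s R) : z ∈ Metric.cthickening ρ K :=
    Metric.mem_cthickening_of_dist_le z s ρ K hsK
      ((Metric.mem_closedBall.mp hz).trans (min_le_left _ _))
  set E : ℂ → ℂ := fun z ↦ ∏ p ∈ q.primeFactors, (1 - (p : ℂ) ^ (-z)) with hE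
  have hElow (z : ℂ) (hz : 1 / 2 ≤ z.re) : 1 ≤ (q : ℝ) ^ 2 * ‖E z‖ := by
    have h1 : (∏ p ∈ q.primeFactors, (p : ℝ)) ≤ q := by
      rw [← Nat.cast_prod]
      exact_mod_cast Nat.le_of_dvd (NeZero.pos q) (Nat.prod_primeFactors_dvd q)
    calc (1 : ℝ) ≤ ∏ p ∈ q.primeFactors, ((p : ℝ) ^ 2 * ‖1 - (p : ℂ) ^ (-z)‖) :=
          Finset.one_le_prod fun p hp ↦
            norm_one_sub_prime_cpow_ge (Nat.prime_of_mem_primeFactors hp) hz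
      _ = (∏ p ∈ q.primeFactors, (p : ℝ)) ^ 2 * ‖E z‖ := by
          rw [Finset.prod_mul_distrib, Finset.prod_pow, hE, norm_prod]
      _ ≤ _ := by gcongr
  have hEne (z : ℂ) (hz : 1 / 2 ≤ z.re) : E z ≠ 0 := by
    intro h
    have := hElow z hz
    rw [h, norm_zero, mul_zero] at this
    linarith
  have hEdiff : Differentiable ℂ E := by
    refine Differentiable.fun_finsetProd fun p hp ↦ ?_
    have hp0 : (p : ℂ) ≠ 0 := by
      exact_mod_cast (Nat.prime_of_mem_primeFactors hp).ne_zero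
    exact (differentiable_const _).sub (differentiable_neg.const_cpow (Or.inl hp0))
  set G : ℂ → ℂ := fun z ↦ (z - 1) * (zetaEntire z)⁻¹ * (E z)⁻¹ with hG
  rw [norm_LSeries_logMul_charMoebius (1 : DirichletCharacter ℂ q) k (G := G) (fun z hz ↦ by
    have hz1 : z ≠ 1 := fun h ↦ by simp [h] at hz
    have h1 := LFunctionTrivChar_eq_mul_riemannZeta (N := q) hz1
    have h2 : riemannZeta z ≠ 0 := riemannZeta_ne_zero_of_one_le_re hz.le
    have h3 : z - 1 ≠ 0 := sub_ne_zero.mpr hz1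
    have h4 := hEne z (by linarith)
    rw [LFunctionTrivChar] at h1
    rw [h1, hG]
    simp only
    rw [zetaEntire_of_ne hz1]
    change E z * riemannZeta z * _ = 1
    field_simp) hs1]
  have := norm_iteratedDeriv_le_of_forall_mem_sphere_norm_le (f := G)
    (C := 2 * max M 1 * q ^ 2) k hR0
    (DifferentiableOn.diffContOnCl_ball (fun z hz ↦ by
      have h1 := (differentiable_zetaEntire z).inv (hsub (hmem z hz))
      have h2 := (hEdiff z).inv (hEne z (hball z hz))
      have h3 : DifferentiableAt ℂ (fun z : ℂ ↦ z - 1) z := by fun_prop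
      exact ((h3.mul h1).mul h2).differentiableWithinAt) subset_rfl)
    fun z hz ↦ by
      have hz' := Metric.sphere_subset_closedBall hz
      rw [hG]
      simp only [norm_mul]
      gcongr
      · have h1 : ‖z - 1‖ ≤ ‖z - s‖ + ‖s - 1‖ := norm_sub_le_norm_sub_add_norm_sub z s 1
        have h2 := Complex.norm_le_abs_re_add_abs_im (s - 1)
        rw [sub_re, sub_im, one_re, one_im, sub_zero, abs_of_pos (by linarith)] at h2
        have h3 := mem_closedBall_iff_norm.mp hz'
        linarith
      · exact (hM z (hmem z hz')).trans (le_max_left _ _)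
      · rw [norm_inv]
        have h1 := hElow z (hball z hz')
        have h2 : 0 < ‖E z‖ := norm_pos_iff.mpr (hEne z (hball z hz'))
        rwa [inv_le_iff_one_le_mul₀ h2]
  refine this.trans (le_of_eq ?_)
  ring

theorem exists_norm_LSeries_logMul_charMoebius_le (k : ℕ) :
    ∃ C : ℝ, 0 < C ∧ ∀ (q : ℕ) [NeZero q] (χ : DirichletCharacter ℂ q) (s : ℂ),
      1 < s.re → s.re ≤ 2 →
        ‖LSeries (LSeries.logMul^[k] (charMoebius χ)) s‖ ≤
          C * q ^ 2 * (|s.im| + 2) ^ (1 / 2 : ℝ) := by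
  obtain ⟨C₁, hC₁, h₁⟩ := exists_norm_LSeries_logMul_charMoebius_le_of_far k
  obtain ⟨C₂, hC₂, h₂⟩ := exists_norm_LSeries_logMul_charMoebius_le_of_near k
  refine ⟨C₁ + C₂, by positivity, fun q _ χ s hs1 hs2 ↦ ?_⟩
  have hq1 : (1 : ℝ) ≤ q := by exact_mod_cast NeZero.one_le
  have ht : 1 ≤ |s.im| + 2 := by linarith [abs_nonneg s.im]
  have ht1 : 1 ≤ (|s.im| + 2) ^ (1 / 2 : ℝ) := Real.one_le_rpow ht (by norm_num)
  by_cases hfar : χ ≠ 1 ∨ 1 / 2 ≤ |s.im|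
  · refine (h₁ q χ s hs1 hs2 hfar).trans ?_
    rw [conductorSize, Real.mul_rpow (by linarith) (by linarith), ← mul_assoc]
    gcongr
    · linarith
    · calc (q : ℝ) ^ (1 / 2 : ℝ) ≤ (q : ℝ) ^ (2 : ℝ) :=
            Real.rpow_le_rpow_of_exponent_le hq1 (by norm_num)
        _ = (q : ℝ) ^ 2 := by norm_cast
  · push Not at hfar
    obtain ⟨rfl, him⟩ := hfar
    refine (h₂ q s hs1 hs2 him.le).trans ?_
    calc C₂ * (q : ℝ) ^ 2 ≤ (C₁ + C₂) * q ^ 2 := by gcongr; linarith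
      _ = (C₁ + C₂) * q ^ 2 * 1 := (mul_one _).symm
      _ ≤ _ := by gcongr

end

/-- The Fejér-type weight `(1 - u)₊` used for smoothing. -/
noncomputable def tentWeight (u : ℝ) : ℂ := ((max (1 - u) 0 : ℝ) : ℂ)

lemma continuous_tentWeight : Continuous tentWeight := by
  unfold tentWeight
  fun_prop

lemma hasMellin_tentWeight {s : ℂ} (hs : 0 < s.re) :
    HasMellin tentWeight s (1 / (s * (s + 1))) := by
  have h1 := hasMellin_one_Ioc hs
  have h2 := hasMellin_cpow_Ioc 1 (s := s) (by simpa using by linarith)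
  have h3 := hasMellin_sub h1.1 h2.1
  rw [h1.2, h2.2] at h3
  have hs0 : s ≠ 0 := fun h ↦ by simp [h] at hs
  have hs1 : s + 1 ≠ 0 := fun h ↦ by
    have := congrArg re h
    simp at this
    linarith
  have heq : Set.EqOn (fun t : ℝ ↦ (t : ℂ) ^ (s - 1) • tentWeight t)
      (fun t : ℝ ↦ (t : ℂ) ^ (s - 1) • ((Set.Ioc 0 1).indicator (fun _ : ℝ ↦ (1 : ℂ)) t -
        (Set.Ioc 0 1).indicator (fun t : ℝ ↦ (t : ℂ) ^ (1 : ℂ)) t)) (Set.Ioi 0) := by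
    intro t ht
    rw [Set.mem_Ioi] at ht
    simp only
    congr 1
    by_cases h : t ≤ 1
    · have hmem : t ∈ Set.Ioc (0 : ℝ) 1 := ⟨ht, h⟩
      rw [Set.indicator_of_mem hmem, Set.indicator_of_mem hmem, tentWeight,
        max_eq_left (by linarith), cpow_one]
      push_cast; ring
    · have hmem : t ∉ Set.Ioc (0 : ℝ) 1 := fun h' ↦ h h'.2
      rw [Set.indicator_of_notMem hmem, Set.indicator_of_notMem hmem,
        tentWeight, max_eq_right (by linarith)]
      simp
  refine ⟨?_, ?_⟩
  · exact (integrableOn_congr_fun heq measurableSet_Ioi).mpr h3.1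
  · have h4 : mellin tentWeight s = 1 / s - 1 / (s + 1) := by
      rw [← h3.2]
      exact setIntegral_congr_fun measurableSet_Ioi heq
    rw [h4]
    field_simp
    ring

lemma one_add_abs_rpow_le {σ y : ℝ} (hσ : 1 ≤ σ) :
    ‖1 / (((σ : ℂ) + y * I) * (σ + y * I + 1))‖ ≤ 2 * (1 + |y|) ^ (-2 : ℝ) := by
  have h1 : (1 + |y|) ^ 2 ≤ 2 * (σ ^ 2 + y ^ 2) := by
    rw [← sq_abs y]; nlinarith [sq_nonneg (1 - |y|)]
  have h2 : ‖(σ : ℂ) + y * I‖ ^ 2 = σ ^ 2 + y ^ 2 := by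
    rw [Complex.sq_norm, normSq_apply]; simp; ring
  have h3 : ‖(σ : ℂ) + y * I‖ ≤ ‖(σ : ℂ) + y * I + 1‖ := by
    refine (sq_le_sq₀ (norm_nonneg _) (norm_nonneg _)).mp ?_
    rw [Complex.sq_norm, Complex.sq_norm, normSq_apply, normSq_apply]
    simp
    nlinarith
  have hy : 0 < 1 + |y| := by positivity
  have h4 : (1 + |y|) ^ 2 / 2 ≤ ‖(σ : ℂ) + y * I‖ * ‖(σ : ℂ) + y * I + 1‖ := by
    nlinarith [norm_nonneg ((σ : ℂ) + y * I)]
  rw [norm_div, norm_one, norm_mul, Real.rpow_neg hy.le, Real.rpow_two]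
  calc 1 / (‖(σ : ℂ) + y * I‖ * ‖(σ : ℂ) + y * I + 1‖) ≤ 1 / ((1 + |y|) ^ 2 / 2) := by gcongr
    _ = _ := by field_simp

lemma integrable_one_div_mul_add_one {σ : ℝ} (hσ : 1 ≤ σ) :
    Integrable fun y : ℝ ↦ 1 / (((σ : ℂ) + y * I) * (σ + y * I + 1)) := by
  have h : Integrable fun y : ℝ ↦ 2 * (1 + ‖y‖) ^ (-2 : ℝ) :=
    (integrable_one_add_norm (by simp)).const_mul 2
  refine h.mono' ?_ (Eventually.of_forall fun y ↦ one_add_abs_rpow_le hσ)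
  refine Measurable.aestronglyMeasurable ?_
  fun_prop

lemma integral_cpow_neg_mul {σ : ℝ} (hσ : 1 ≤ σ) {u : ℝ} (hu : 0 < u) :
    ∫ y : ℝ, (u : ℂ) ^ (-((σ : ℂ) + y * I)) * (1 / (((σ : ℂ) + y * I) * (σ + y * I + 1))) =
      2 * Real.pi * tentWeight u := by
  have hre (y : ℝ) : 0 < ((σ : ℂ) + y * I).re := by simp; linarith
  have hm (y : ℝ) : mellin tentWeight ((σ : ℂ) + y * I) =
      1 / (((σ : ℂ) + y * I) * (σ + y * I + 1)) := (hasMellin_tentWeight (hre y)).2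
  have h := mellinInv_mellin_eq σ tentWeight hu
    (hasMellin_tentWeight (by simpa using by linarith)).1
    (by
      unfold VerticalIntegrable
      simp only [hm]
      exact integrable_one_div_mul_add_one hσ)
    continuous_tentWeight.continuousAt
  rw [← h, mellinInv]
  simp only [hm, smul_eq_mul]
  rw [real_smul]
  have : (Real.pi : ℂ) ≠ 0 := by exact_mod_cast Real.pi_ne_zero
  rw [← mul_assoc]
  push_cast
  rw [mul_one_div_cancel (mul_ne_zero two_ne_zero this), one_mul]

lemma exists_norm_sum_mul_sub_le :
    ∃ C : ℝ, 0 < C ∧ ∀ (b : ℕ → ℂ) (A : ℝ), (∀ s : ℂ, 1 < s.re → LSeriesSummable b s) →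
      (∀ s : ℂ, 1 < s.re → s.re ≤ 2 → ‖LSeries b s‖ ≤ A * (|s.im| + 2) ^ (1 / 2 : ℝ)) →
      ∀ N : ℕ, 3 ≤ N → ‖∑ n ∈ Finset.Icc 1 N, b n * ((N : ℂ) - n)‖ ≤ C * A * N ^ 2 := by
  set J : ℝ := ∫ y : ℝ, (1 + ‖y‖) ^ (-(3 / 2) : ℝ) with hJ
  have hJi : Integrable fun y : ℝ ↦ (1 + ‖y‖) ^ (-(3 / 2) : ℝ) :=
    integrable_one_add_norm (by norm_num)
  have hJ0 : 0 ≤ J := integral_nonneg fun y ↦ by positivity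
  refine ⟨Real.exp 1 * 4 * (J + 1), by positivity, fun b A hsum hb N hN ↦ ?_⟩
  have hN3 : (3 : ℝ) ≤ N := by exact_mod_cast hN
  have hN0 : (0 : ℝ) < N := by linarith
  have hlog : 1 ≤ Real.log N := by
    rw [Real.le_log_iff_exp_le hN0]
    linarith [Real.exp_one_lt_d9]
  set σ : ℝ := 1 + 1 / Real.log N with hσ
  have hinv : 0 < 1 / Real.log N := by positivity
  have hinv1 : 1 / Real.log N ≤ 1 := by rw [div_le_one (by linarith)]; exact hlog
  have hσ1 : 1 < σ := by linarith
  have hσ2 : σ ≤ 2 := by linarith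
  have hNσ : (N : ℝ) ^ σ = N * Real.exp 1 := by
    rw [hσ, Real.rpow_add hN0, Real.rpow_one, Real.rpow_def_of_pos hN0,
      mul_one_div_cancel (by linarith)]
  set S : ℝ → ℂ := fun y ↦ (σ : ℂ) + y * I with hS
  have hre (y : ℝ) : (S y).re = σ := by simp [hS]
  have him (y : ℝ) : (S y).im = y := by simp [hS]
  set W : ℝ → ℂ := fun y ↦ 1 / (S y * (S y + 1)) with hW
  have hWi : Integrable W := integrable_one_div_mul_add_one hσ1.le
  set F : ℕ → ℝ → ℂ := fun n y ↦ LSeries.term b (S y) n * (N : ℂ) ^ (S y) * W y with hF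
  have hA0 : 0 ≤ A := by
    have h1 := (norm_nonneg _).trans (hb 2 (by simp) (by simp))
    have h2 : (0 : ℝ) < (|(2 : ℂ).im| + 2) ^ (1 / 2 : ℝ) := by positivity
    exact nonneg_of_mul_nonneg_left h1 h2
  have hnormN (y : ℝ) : ‖(N : ℂ) ^ (S y)‖ = N ^ σ := by
    rw [norm_natCast_cpow_of_pos (by omega), hre]
  have hnormF (n : ℕ) (y : ℝ) : ‖F n y‖ = ‖LSeries.term b (σ : ℂ) n‖ * N ^ σ * ‖W y‖ := by
    rw [hF]
    simp only [norm_mul, hnormN]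
    congr 2
    rw [LSeries.norm_term_eq, LSeries.norm_term_eq, hre, ofReal_re]
  have hSm : Measurable S := by rw [hS]; fun_prop
  have hFi (n : ℕ) : Integrable (F n) := by
    refine (hWi.norm.const_mul (‖LSeries.term b (σ : ℂ) n‖ * (N : ℝ) ^ σ)).mono' ?_
      (Eventually.of_forall fun y ↦ (hnormF n y).le)
    refine Measurable.aestronglyMeasurable ?_
    rcases eq_or_ne n 0 with rfl | hn
    · simp only [hF, LSeries.term_zero, zero_mul]
      exact measurable_const
    · simp only [hF, LSeries.term_of_ne_zero hn, hW]
      fun_prop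
  have hFs : Summable fun n ↦ ∫ y, ‖F n y‖ := by
    simp only [hnormF, integral_const_mul]
    refine Summable.mul_right _ (Summable.mul_right _ ?_)
    exact (hsum σ (by simpa using hσ1)).norm
  have hHas := hasSum_integral_of_summable_integral_norm hFi hFs
  have hint (n : ℕ) : ∫ y, F n y = if n = 0 then 0 else
      2 * Real.pi * (b n * tentWeight (n / N)) := by
    rcases eq_or_ne n 0 with rfl | hn
    · simp [hF]
    · rw [if_neg hn]
      have hn0 : (0 : ℝ) < n := by exact_mod_cast Nat.pos_of_ne_zero hn
      have h1 (y : ℝ) : F n y = b n * ((((n / N : ℝ) : ℂ)) ^ (-S y) * W y) := by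
        have h2 : (((n / N : ℝ) : ℂ)) ^ (-S y) = (N : ℂ) ^ (S y) / (n : ℂ) ^ (S y) := by
          rw [ofReal_div, div_cpow_ofReal_nonneg hn0.le hN0.le, ofReal_natCast, ofReal_natCast, cpow_neg,
            cpow_neg, inv_div_inv]
        simp only [hF, LSeries.term_of_ne_zero hn]
        rw [h2]; ring
      simp only [h1]
      rw [integral_const_mul, hW, hS]
      rw [integral_cpow_neg_mul hσ1.le (by positivity)]
      ring
  have htsum (y : ℝ) : ∑' n, F n y = LSeries b (S y) * (N : ℂ) ^ (S y) * W y := by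
    simp only [hF]
    rw [tsum_mul_right, tsum_mul_right, LSeries]
  simp only [htsum, hint] at hHas
  have hfin := hHas.unique (hasSum_sum_of_ne_finset_zero (s := Finset.Icc 1 N) fun n hn ↦ by
    rcases eq_or_ne n 0 with rfl | hn0
    · simp
    · rw [if_neg hn0]
      have : N < n := by
        rw [Finset.mem_Icc] at hn; omega
      have h1 : (1 : ℝ) ≤ n / N := by
        rw [one_le_div hN0]; exact_mod_cast this.le
      rw [tentWeight, max_eq_right (by linarith)]
      simp)
  have hbound : ‖∫ y : ℝ, LSeries b (S y) * (N : ℂ) ^ (S y) * W y‖ ≤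
      A * (N * Real.exp 1) * 4 * J := by
    rw [hJ, ← integral_const_mul]
    refine norm_integral_le_of_norm_le (hJi.const_mul _) (Eventually.of_forall fun y ↦ ?_)
    rw [norm_mul, norm_mul, hnormN, hNσ]
    have h1 := hb (S y) (by rw [hre]; exact hσ1) (by rw [hre]; exact hσ2)
    rw [him] at h1
    have hy : 0 < 1 + ‖y‖ := by positivity
    have h2 : (|y| + 2) ^ (1 / 2 : ℝ) ≤ 2 * (1 + ‖y‖) ^ (1 / 2 : ℝ) := by
      calc (|y| + 2) ^ (1 / 2 : ℝ) ≤ (2 ^ (2 : ℝ) * (1 + ‖y‖)) ^ (1 / 2 : ℝ) := by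
            gcongr
            rw [Real.norm_eq_abs, Real.rpow_two]
            linarith [abs_nonneg y]
        _ = _ := by
            rw [Real.mul_rpow (by positivity) (by positivity), ← Real.rpow_mul (by norm_num)]
            norm_num
    have h3 : (1 + ‖y‖) ^ (-(3 / 2) : ℝ) = (1 + ‖y‖) ^ (1 / 2 : ℝ) * (1 + ‖y‖) ^ (-2 : ℝ) := by
      rw [← Real.rpow_add hy]; norm_num
    rw [h3]
    calc ‖LSeries b (S y)‖ * (N * Real.exp 1) * ‖W y‖ ≤
        (A * (2 * (1 + ‖y‖) ^ (1 / 2 : ℝ))) * (N * Real.exp 1) *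
          (2 * (1 + ‖y‖) ^ (-2 : ℝ)) := by
          gcongr
          · exact h1.trans (by gcongr)
          · exact one_add_abs_rpow_le hσ1.le
      _ = _ := by ring
  have hfinal : ∑ n ∈ Finset.Icc 1 N, b n * ((N : ℂ) - n) =
      N / (2 * Real.pi) * ∫ y : ℝ, LSeries b (S y) * (N : ℂ) ^ (S y) * W y := by
    rw [hfin, Finset.mul_sum]
    refine Finset.sum_congr rfl fun n hn ↦ ?_
    rw [Finset.mem_Icc] at hn
    have hnN : (n : ℝ) / N ≤ 1 := by
      rw [div_le_one hN0]; exact_mod_cast hn.2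
    have : (Real.pi : ℂ) ≠ 0 := by exact_mod_cast Real.pi_ne_zero
    have hNc : (N : ℂ) ≠ 0 := by exact_mod_cast hN0.ne'
    rw [if_neg (by omega), tentWeight, max_eq_left (by linarith)]
    push_cast
    field_simp
  rw [hfinal, norm_mul]
  have h5 : ‖(N : ℂ) / (2 * Real.pi)‖ ≤ N := by
    rw [norm_div, norm_natCast, norm_mul, norm_real, Real.norm_of_nonneg Real.pi_pos.le,
      Complex.norm_ofNat]
    exact div_le_self hN0.le (by linarith [Real.pi_gt_three])
  calc ‖(N : ℂ) / (2 * Real.pi)‖ * ‖∫ y : ℝ, LSeries b (S y) * (N : ℂ) ^ (S y) * W y‖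
      ≤ N * (A * (N * Real.exp 1) * 4 * J) := by gcongr
    _ = Real.exp 1 * 4 * J * A * N ^ 2 := by ring
    _ ≤ _ := by gcongr; linarith

lemma logMul_iterate_apply (f : ℕ → ℂ) (k n : ℕ) :
    LSeries.logMul^[k] f n = ((Real.log n ^ k : ℝ) : ℂ) * f n := by
  induction k with
  | zero => simp
  | succ k ih =>
    rw [Function.iterate_succ_apply', LSeries.logMul, ih, ← natCast_log]
    push_cast
    ring

/-- Abel's inequality for sums weighted by a nonnegative antitone sequence. -/
lemma norm_sum_antitone_smul_le {b : ℕ → ℂ} {g : ℕ → ℝ} (hg : Antitone g) (hg0 : ∀ n, 0 ≤ g n)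
    {D : ℝ} {N : ℕ} (hD : ∀ n ≤ N, ‖∑ i ∈ Finset.range n, b i‖ ≤ D) :
    ‖∑ i ∈ Finset.range N, (g i : ℂ) * b i‖ ≤ g 0 * D := by
  have hD0 : 0 ≤ D := by simpa using hD 0 N.zero_le
  rcases Nat.eq_zero_or_pos N with rfl | hN
  · simpa using mul_nonneg (hg0 0) hD0
  have h := Finset.sum_range_by_parts (fun i ↦ (g i : ℂ)) b N
  simp only [smul_eq_mul] at h
  rw [h]
  refine (norm_sub_le _ _).trans ?_
  have h1 : ‖(g (N - 1) : ℂ) * ∑ i ∈ Finset.range N, b i‖ ≤ g (N - 1) * D := by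
    rw [norm_mul, norm_real, Real.norm_of_nonneg (hg0 _)]
    exact mul_le_mul_of_nonneg_left (hD N le_rfl) (hg0 _)
  have h2 : ‖∑ i ∈ Finset.range (N - 1), ((g (i + 1) : ℂ) - g i) *
      ∑ j ∈ Finset.range (i + 1), b j‖ ≤ ∑ i ∈ Finset.range (N - 1), (g i - g (i + 1)) * D := by
    refine norm_sum_le_of_le _ fun i hi ↦ ?_
    rw [Finset.mem_range] at hi
    have h3 := hg (Nat.le_succ i)
    rw [norm_mul, ← ofReal_sub, norm_real, Real.norm_eq_abs, abs_sub_comm,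
      abs_of_nonneg (sub_nonneg.mpr h3)]
    exact mul_le_mul_of_nonneg_left (hD _ (by omega)) (sub_nonneg.mpr h3)
  rw [← Finset.sum_mul, Finset.sum_range_sub'] at h2
  linarith

lemma sum_Icc_eq_sum_add_sum_range {M : Type*} [AddCommMonoid M] (b : ℕ → M) (m N : ℕ)
    (h : m ≤ N) : ∑ n ∈ Finset.Icc 1 N, b n =
      ∑ n ∈ Finset.Icc 1 m, b n + ∑ i ∈ Finset.range (N - m), b (m + 1 + i) := by
  obtain ⟨d, rfl⟩ := Nat.exists_eq_add_of_le h
  rw [Nat.add_sub_cancel_left]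
  induction d with
  | zero => simp
  | succ d ih =>
    rw [← Nat.add_assoc, Finset.sum_Icc_succ_top (by omega), ih (by omega), Finset.sum_range_succ,
      add_assoc]
    congr 3
    ring

lemma exists_log_pow_le (j : ℕ) : ∃ C : ℝ, 0 < C ∧ ∀ x : ℝ, 1 ≤ x →
    Real.log x ^ j ≤ C * √x := by
  refine ⟨(2 * (j + 1)) ^ j, by positivity, fun x hx ↦ ?_⟩
  have h1 := Real.log_le_rpow_div (x := x) (ε := 1 / (2 * (j + 1))) (by linarith) (by positivity)
  have h2 : Real.log x ≤ 2 * (j + 1) * x ^ (1 / (2 * (j + 1)) : ℝ) := by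
    refine h1.trans (le_of_eq ?_)
    rw [div_div_eq_mul_div, div_one]; ring
  calc Real.log x ^ j ≤ (2 * (j + 1) * x ^ (1 / (2 * (j + 1)) : ℝ)) ^ j := by
        have := Real.log_nonneg hx
        gcongr
    _ = (2 * (j + 1)) ^ j * x ^ (1 / (2 * (j + 1)) * j : ℝ) := by
        rw [mul_pow, ← Real.rpow_natCast (x ^ _) j, ← Real.rpow_mul (by linarith)]
    _ ≤ (2 * (j + 1)) ^ j * √x := by
        rw [Real.sqrt_eq_rpow]
        gcongr 2
        rw [one_div_mul_eq_div, div_le_iff₀ (by positivity)]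
        linarith

lemma norm_sum_le_of_norm_sum_mul_sub_le {b : ℕ → ℂ} {D : ℝ} {N h : ℕ} (hh : 0 < h) (hhN : h ≤ N)
    (h₁ : ‖∑ n ∈ Finset.Icc 1 N, b n * ((N : ℂ) - n)‖ ≤ D)
    (h₂ : ‖∑ n ∈ Finset.Icc 1 (N + h), b n * (((N + h : ℕ) : ℂ) - n)‖ ≤ 4 * D) {L : ℝ}
    (hb : ∀ n ≤ 2 * N, ‖b n‖ ≤ L) :
    ‖∑ n ∈ Finset.Icc 1 N, b n‖ ≤ 5 * D / h + h * L := by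
  have hh0 : (0 : ℝ) < h := by exact_mod_cast hh
  have hL : 0 ≤ L := (norm_nonneg _).trans (hb 0 (by omega))
  rw [sum_Icc_eq_sum_add_sum_range _ N (N + h) (by omega), Nat.add_sub_cancel_left] at h₂
  have h3 : ∑ n ∈ Finset.Icc 1 N, b n * (((N + h : ℕ) : ℂ) - n) =
      ∑ n ∈ Finset.Icc 1 N, b n * ((N : ℂ) - n) + h * ∑ n ∈ Finset.Icc 1 N, b n := by
    rw [Finset.mul_sum, ← Finset.sum_add_distrib]
    refine Finset.sum_congr rfl fun n _ ↦ ?_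
    push_cast; ring
  rw [h3] at h₂
  set X := ∑ n ∈ Finset.Icc 1 N, b n * ((N : ℂ) - n)
  set B := ∑ n ∈ Finset.Icc 1 N, b n
  set E := ∑ i ∈ Finset.range h, b (N + 1 + i) * (((N + h : ℕ) : ℂ) - ((N + 1 + i : ℕ) : ℂ)) with hE
  have h4 : ‖E‖ ≤ h * (h * L) := by
    refine (norm_sum_le_of_le (Finset.range h) (f := fun i ↦ b (N + 1 + i) *
      (((N + h : ℕ) : ℂ) - ((N + 1 + i : ℕ) : ℂ))) (n := fun _ ↦ h * L) fun i hi ↦ ?_).trans ?_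
    · rw [Finset.mem_range] at hi
      rw [norm_mul, ← Nat.cast_sub (by omega), norm_natCast, mul_comm]
      gcongr
      · omega
      · exact hb _ (by omega)
    · rw [Finset.sum_const, Finset.card_range, nsmul_eq_mul]
  have h5 : ‖(h : ℂ) * B‖ ≤ 4 * D + D + h * (h * L) := by
    have : (h : ℂ) * B = (X + h * B + E) - X - E := by ring
    rw [this]
    refine (norm_sub_le _ _).trans (add_le_add ((norm_sub_le _ _).trans (add_le_add h₂ h₁)) h4)
  rw [norm_mul, norm_natCast] at h5
  rw [div_add' _ _ _ hh0.ne', le_div_iff₀ hh0]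
  linarith

lemma one_le_log_of_three_le {N : ℕ} (hN : 3 ≤ N) : 1 ≤ Real.log N := by
  have : (3 : ℝ) ≤ N := by exact_mod_cast hN
  rw [Real.le_log_iff_exp_le (by linarith)]
  linarith [Real.exp_one_lt_d9]

lemma exists_norm_sum_logMul_charMoebius_le (j : ℕ) :
    ∃ C : ℝ, 0 < C ∧ ∀ (q : ℕ) [NeZero q] (χ : DirichletCharacter ℂ q) (N : ℕ), 3 ≤ N →
      ‖∑ n ∈ Finset.Icc 1 N, LSeries.logMul^[2 * j] (charMoebius χ) n‖ ≤
        C * q ^ 2 * (N * Real.log N ^ j) := by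
  obtain ⟨C₁, hC₁, h₁⟩ := exists_norm_LSeries_logMul_charMoebius_le (2 * j)
  obtain ⟨C₂, hC₂, h₂⟩ := exists_norm_sum_mul_sub_le
  obtain ⟨C₃, hC₃, h₃⟩ := exists_log_pow_le j
  refine ⟨5 * (C₂ * C₁) + (1 + C₃) * 2 ^ (2 * j), by positivity, fun q _ χ N hN ↦ ?_⟩
  set b := LSeries.logMul^[2 * j] (charMoebius χ) with hb
  have hq1 : (1 : ℝ) ≤ q := by exact_mod_cast NeZero.one_le
  have hN3 : (3 : ℝ) ≤ N := by exact_mod_cast hN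
  have hlog : 1 ≤ Real.log N := one_le_log_of_three_le hN
  set l := Real.log N with hl
  have hT := h₂ b (C₁ * q ^ 2) (fun s hs ↦ LSeriesSummable_of_abscissaOfAbsConv_lt_re (by
      rw [hb, LSeries.absicssaOfAbsConv_logPowMul]
      exact abscissaOfAbsConv_charMoebius_lt χ hs)) (fun s hs hs2 ↦ h₁ q χ s hs hs2)
  have hlj : 1 ≤ l ^ j := one_le_pow₀ hlog
  set h := ⌈(N : ℝ) / l ^ j⌉₊ with hh
  have hh1 : (N : ℝ) / l ^ j ≤ h := Nat.le_ceil _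
  have hh0 : 0 < h := Nat.ceil_pos.mpr (by positivity)
  have hhN : h ≤ N := Nat.ceil_le.mpr (div_le_self (by positivity) hlj)
  have hh2 : (h : ℝ) ≤ (1 + C₃) * (N / l ^ j) := by
    have h3 : (h : ℝ) < N / l ^ j + 1 := Nat.ceil_lt_add_one (by positivity)
    have h4 : √(N : ℝ) ≤ N := Real.sqrt_le_iff.mpr ⟨by linarith, by nlinarith⟩
    have h5 : l ^ j ≤ C₃ * N := (h₃ N (by linarith)).trans (by gcongr)
    have h6 : 1 ≤ C₃ * (N / l ^ j) := by
      rw [← mul_div_assoc, one_le_div (by positivity)]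
      exact h5
    linarith
  have hL (n : ℕ) (hn : n ≤ 2 * N) : ‖b n‖ ≤ (2 * l) ^ (2 * j) := by
    rw [hb, logMul_iterate_apply, norm_mul, norm_real, Real.norm_eq_abs, abs_pow]
    have h3 : |Real.log n| ≤ 2 * l := by
      rw [abs_of_nonneg (Real.log_natCast_nonneg n)]
      rcases Nat.eq_zero_or_pos n with rfl | hn0
      · simp only [Nat.cast_zero, Real.log_zero]; linarith
      · have h4 : (n : ℝ) ≤ N ^ 2 := by
          have : (n : ℝ) ≤ 2 * N := by exact_mod_cast hn
          nlinarith
        calc Real.log n ≤ Real.log ((N : ℝ) ^ 2) :=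
              Real.log_le_log (by exact_mod_cast hn0) h4
          _ = 2 * l := by rw [Real.log_pow]; norm_num [hl]
    calc |Real.log n| ^ (2 * j) * ‖charMoebius χ n‖ ≤ (2 * l) ^ (2 * j) * 1 := by
          gcongr
          exact norm_charMoebius_le χ n
      _ = _ := mul_one _
  have hmain := norm_sum_le_of_norm_sum_mul_sub_le hh0 hhN (hT N hN) (by
    refine (hT (N + h) (by omega)).trans ?_
    have : ((N + h : ℕ) : ℝ) ≤ 2 * N := by exact_mod_cast (by omega : N + h ≤ 2 * N)
    calc C₂ * (C₁ * (q : ℝ) ^ 2) * ((N + h : ℕ) : ℝ) ^ 2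
        ≤ C₂ * (C₁ * (q : ℝ) ^ 2) * (2 * N) ^ 2 := by gcongr
      _ = _ := by ring) hL
  refine hmain.trans ?_
  have h7 : 5 * (C₂ * (C₁ * (q : ℝ) ^ 2) * N ^ 2) / h ≤
      5 * (C₂ * C₁) * q ^ 2 * (N * l ^ j) := by
    calc 5 * (C₂ * (C₁ * (q : ℝ) ^ 2) * N ^ 2) / h
        ≤ 5 * (C₂ * (C₁ * (q : ℝ) ^ 2) * N ^ 2) / (N / l ^ j) := by gcongr
      _ = _ := by field_simp
  have h8 : h * (2 * l) ^ (2 * j) ≤ (1 + C₃) * 2 ^ (2 * j) * q ^ 2 * (N * l ^ j) := by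
    calc h * (2 * l) ^ (2 * j) ≤ (1 + C₃) * (N / l ^ j) * (2 * l) ^ (2 * j) := by gcongr
      _ = (1 + C₃) * 2 ^ (2 * j) * 1 * (N * l ^ j) := by
          rw [mul_pow, two_mul j, pow_add l]; field_simp
      _ ≤ _ := by
          gcongr
          exact one_le_pow₀ hq1
  calc _ ≤ _ := add_le_add h7 h8
    _ = _ := by ring

/-- The Siegel–Walfisz theorem for character twists of the Möbius function. -/
theorem exists_norm_sum_charMoebius_le (j : ℕ) :
    ∃ C : ℝ, 0 < C ∧ ∀ (q : ℕ) [NeZero q] (χ : DirichletCharacter ℂ q) (N : ℕ), 2 ≤ N →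
      ‖∑ n ∈ Finset.Icc 1 N, charMoebius χ n‖ ≤ C * q ^ 2 * (N / Real.log N ^ j) := by
  obtain ⟨C₁, hC₁, h₁⟩ := exists_norm_sum_logMul_charMoebius_le j
  obtain ⟨C₂, hC₂, h₂⟩ := exists_log_pow_le j
  refine ⟨1 + C₂ + 2 ^ (2 * j) * (2 * (C₁ + 2)), by positivity, fun q _ χ N hN2 ↦ ?_⟩
  have hq1 : (1 : ℝ) ≤ q := by exact_mod_cast NeZero.one_le
  have hq2 : 1 ≤ (q : ℝ) ^ 2 := one_le_pow₀ hq1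
  have htriv (m : ℕ) : ‖∑ n ∈ Finset.Icc 1 m, charMoebius χ n‖ ≤ m := by
    refine (norm_sum_le_of_le _ fun n _ ↦ norm_charMoebius_le χ n).trans ?_
    simp
  have hNpos : (0 : ℝ) < N := by exact_mod_cast (by omega : 0 < N)
  rcases eq_or_lt_of_le hN2 with rfl | hN
  · refine (htriv 2).trans ?_
    have h3 : Real.log (2 : ℕ) ^ j ≤ 1 := by
      refine pow_le_one₀ (Real.log_natCast_nonneg 2) ?_
      push_cast
      linarith [Real.log_two_lt_d9]
    have h4 : 0 < Real.log (2 : ℕ) ^ j := pow_pos (Real.log_pos (by norm_num)) _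
    have h5 : ((2 : ℕ) : ℝ) ≤ (2 : ℕ) / Real.log (2 : ℕ) ^ j := by
      rw [le_div_iff₀ h4]
      nlinarith
    refine h5.trans (le_mul_of_one_le_left (by positivity) ?_)
    have : 0 < 2 ^ (2 * j) * (2 * (C₁ + 2)) := by positivity
    nlinarith
  have hN3 : 3 ≤ N := hN
  have hlog : 1 ≤ Real.log N := one_le_log_of_three_le hN3
  have h₂' := h₂ N (by exact_mod_cast (by omega : 1 ≤ N))
  set l := Real.log N with hl
  set m := Nat.sqrt N with hm
  have hmN : m ≤ N := Nat.sqrt_le_self N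
  have hm1 : 1 ≤ m := Nat.sqrt_pos.mpr (by omega)
  set b := LSeries.logMul^[2 * j] (charMoebius χ) with hb
  set D : ℝ := (C₁ + 2) * q ^ 2 * (N * l ^ j) with hD
  have hB (n : ℕ) (hn : n ≤ N) : ‖∑ i ∈ Finset.Icc 1 n, b i‖ ≤ D := by
    by_cases hn3 : 3 ≤ n
    · refine (h₁ q χ n hn3).trans ?_
      have h3 : Real.log n ≤ l :=
        Real.log_le_log (by exact_mod_cast (by omega : 0 < n)) (by exact_mod_cast hn)
      have h4 : 0 ≤ Real.log n := Real.log_natCast_nonneg n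
      rw [hD]
      gcongr
      linarith
    · have h3 (i : ℕ) (hi : i ∈ Finset.Icc 1 n) : ‖b i‖ ≤ 1 := by
        rw [Finset.mem_Icc] at hi
        rw [hb, logMul_iterate_apply, norm_mul, norm_real, Real.norm_eq_abs, abs_pow]
        refine mul_le_one₀ ?_ (norm_nonneg _) (norm_charMoebius_le χ i)
        refine pow_le_one₀ (abs_nonneg _) ?_
        rw [abs_of_nonneg (Real.log_natCast_nonneg i)]
        have : (i : ℝ) ≤ 2 := by exact_mod_cast (by omega : i ≤ 2)
        calc Real.log i ≤ Real.log 2 :=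
              Real.log_le_log (by exact_mod_cast (by omega : 0 < i)) this
          _ ≤ 1 := by linarith [Real.log_two_lt_d9]
      refine (norm_sum_le_of_le _ h3).trans ?_
      rw [Finset.sum_const, Nat.card_Icc, nsmul_eq_mul, mul_one, Nat.add_sub_cancel]
      have h4 : (n : ℝ) ≤ N := by exact_mod_cast hn
      have h5 : 1 ≤ (C₁ + 2) * q ^ 2 := by nlinarith
      have h6 : (N : ℝ) ≤ N * l ^ j := le_mul_of_one_le_right hNpos.le (one_le_pow₀ hlog)
      nlinarith
  set g : ℕ → ℝ := fun i ↦ (Real.log ((m + 1 + i : ℕ) : ℝ) ^ (2 * j))⁻¹ with hg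
  have hpos (i : ℕ) : 0 < Real.log ((m + 1 + i : ℕ) : ℝ) :=
    Real.log_pos (by exact_mod_cast (by omega : 1 < m + 1 + i))
  have hganti : Antitone g := by
    intro i i' hii
    have := hpos i
    simp only [hg]
    gcongr
  have hg0 (i : ℕ) : 0 ≤ g i := by
    have := hpos i
    positivity
  have habel := norm_sum_antitone_smul_le (b := fun i ↦ b (m + 1 + i)) (D := 2 * D) (N := N - m)
    hganti hg0 fun n hn ↦ by
      have h3 := sum_Icc_eq_sum_add_sum_range b m (m + n) (by omega)
      rw [Nat.add_sub_cancel_left] at h3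
      rw [← sub_eq_iff_eq_add'.mpr h3]
      refine (norm_sub_le _ _).trans ?_
      linarith [hB (m + n) (by omega), hB m hmN]
  have hterm (i : ℕ) : (g i : ℂ) * b (m + 1 + i) = charMoebius χ (m + 1 + i) := by
    have h3 : ((Real.log ((m + 1 + i : ℕ) : ℝ) ^ (2 * j) : ℝ) : ℂ) ≠ 0 := by
      exact_mod_cast (pow_pos (hpos i) _).ne'
    rw [hb, logMul_iterate_apply, hg, ← mul_assoc]
    simp only [ofReal_inv]
    rw [inv_mul_cancel₀ h3, one_mul]
  simp only [hterm] at habel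
  have hg00 : g 0 ≤ 2 ^ (2 * j) / l ^ (2 * j) := by
    simp only [hg]
    rw [← inv_div, ← div_pow]
    refine inv_anti₀ (by positivity) ?_
    gcongr
    have h3 : (N : ℝ) ≤ ((m + 1 + 0 : ℕ) : ℝ) ^ 2 := by
      exact_mod_cast (Nat.lt_succ_sqrt' N).le
    have h4 := Real.log_le_log hNpos h3
    rw [Real.log_pow] at h4
    rw [div_le_iff₀ two_pos]
    push_cast at h4 ⊢
    linarith
  have hmsqrt : (m : ℝ) ≤ C₂ * (N / l ^ j) := by
    have h3 : (m : ℝ) ≤ √(N : ℝ) := by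
      refine Real.le_sqrt_of_sq_le ?_
      exact_mod_cast Nat.sqrt_le' N
    rw [mul_div_assoc', le_div_iff₀ (by positivity)]
    calc (m : ℝ) * l ^ j ≤ √N * (C₂ * √N) := by gcongr
      _ = C₂ * (√N * √N) := by ring
      _ = C₂ * N := by rw [Real.mul_self_sqrt hNpos.le]
  rw [sum_Icc_eq_sum_add_sum_range _ m N hmN]
  calc _ ≤ (m : ℝ) + g 0 * (2 * D) := (norm_add_le _ _).trans (add_le_add (htriv m) habel)
    _ ≤ C₂ * (N / l ^ j) + 2 ^ (2 * j) / l ^ (2 * j) * (2 * D) := by gcongr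
    _ = C₂ * 1 * (N / l ^ j) + 2 ^ (2 * j) * (2 * (C₁ + 2)) * q ^ 2 * (N / l ^ j) := by
        rw [hD, two_mul j, pow_add l]; field_simp
    _ ≤ C₂ * q ^ 2 * (N / l ^ j) + 2 ^ (2 * j) * (2 * (C₁ + 2)) * q ^ 2 * (N / l ^ j) := by
        gcongr
    _ ≤ _ := by
        have : 0 ≤ (q : ℝ) ^ 2 * (N / l ^ j) := by positivity
        linarith

lemma exists_norm_sum_charMoebius_le_of_le (j : ℕ) :
    ∃ C : ℝ, 0 < C ∧ ∀ (q : ℕ) [NeZero q] (χ : DirichletCharacter ℂ q) (M N : ℕ), 3 ≤ N → M ≤ N →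
      ‖∑ n ∈ Finset.Icc 1 M, charMoebius χ n‖ ≤ C * q ^ 2 * (N / Real.log N ^ j) := by
  obtain ⟨C₁, hC₁, h₁⟩ := exists_norm_sum_charMoebius_le j
  obtain ⟨C₂, hC₂, h₂⟩ := exists_log_pow_le j
  refine ⟨C₂ + 2 ^ j * C₁, by positivity, fun q _ χ M N hN hMN ↦ ?_⟩
  have hq1 : (1 : ℝ) ≤ q := by exact_mod_cast NeZero.one_le
  have hq2 : 1 ≤ (q : ℝ) ^ 2 := one_le_pow₀ hq1
  have hlog : 1 ≤ Real.log N := one_le_log_of_three_le hN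
  have hN1 : (1 : ℝ) ≤ N := by exact_mod_cast (by omega : 1 ≤ N)
  have hlogj : 0 < Real.log N ^ j := by positivity
  have hMN' : (M : ℝ) ≤ N := by exact_mod_cast hMN
  rcases le_or_gt (M ^ 2) N with h | h
  · have h3 : ‖∑ n ∈ Finset.Icc 1 M, charMoebius χ n‖ ≤ M := by
      refine (norm_sum_le_of_le _ fun n _ ↦ norm_charMoebius_le χ n).trans ?_
      simp
    have h4 : (M : ℝ) ≤ √N := Real.le_sqrt_of_sq_le (by exact_mod_cast h)
    have h5 : √(N : ℝ) ≤ C₂ * (N / Real.log N ^ j) := by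
      rw [mul_div_assoc', le_div_iff₀ hlogj]
      calc √(N : ℝ) * Real.log N ^ j ≤ √(N : ℝ) * (C₂ * √N) := by gcongr; exact h₂ N hN1
        _ = C₂ * (√(N : ℝ) * √N) := by ring
        _ = _ := by rw [Real.mul_self_sqrt (by positivity)]
    calc _ ≤ C₂ * 1 * (N / Real.log N ^ j) := by rw [mul_one]; exact h3.trans (h4.trans h5)
      _ ≤ _ := by
        gcongr
        linarith [mul_pos (pow_pos two_pos j) hC₁]
  · have hM2 : 2 ≤ M := by
      by_contra! h6
      have : M ^ 2 ≤ 1 ^ 2 := Nat.pow_le_pow_left (by omega) 2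
      omega
    have h6 : Real.log N ≤ 2 * Real.log M := by
      have : Real.log N ≤ Real.log ((M : ℝ) ^ 2) :=
        Real.log_le_log (by linarith) (by exact_mod_cast h.le)
      rwa [Real.log_pow] at this
    have h7 : (M : ℝ) / Real.log M ^ j ≤ 2 ^ j * (N / Real.log N ^ j) := by
      have h8 : 0 < Real.log M := by linarith
      rw [mul_div_assoc', div_le_div_iff₀ (by positivity) hlogj]
      calc (M : ℝ) * Real.log N ^ j ≤ N * (2 * Real.log M) ^ j := by gcongr
        _ = _ := by rw [mul_pow]; ring
    calc _ ≤ C₁ * q ^ 2 * (M / Real.log M ^ j) := h₁ q χ M hM2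
      _ ≤ C₁ * q ^ 2 * (2 ^ j * (N / Real.log N ^ j)) := by gcongr
      _ = (0 + 2 ^ j * C₁) * q ^ 2 * (N / Real.log N ^ j) := by ring
      _ ≤ _ := by gcongr

lemma exists_sum_character_eq {q : ℕ} [NeZero q] (F : ZMod q → ℂ) (hF : ∀ x, ‖F x‖ ≤ 1) :
    ∃ c : DirichletCharacter ℂ q → ℂ, (∀ χ, ‖c χ‖ ≤ 1) ∧
      ∀ x, IsUnit x → F x = ∑ χ : DirichletCharacter ℂ q, c χ * χ x := by
  have hφ : (q.totient : ℂ) ≠ 0 := by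
    exact_mod_cast (Nat.totient_pos.mpr (NeZero.pos q)).ne'
  refine ⟨fun χ ↦ (q.totient : ℂ)⁻¹ * ∑ u : (ZMod q)ˣ, F u * χ (u : ZMod q)⁻¹, fun χ ↦ ?_,
    fun x hx ↦ ?_⟩
  · have h1 : ‖∑ u : (ZMod q)ˣ, F u * χ (u : ZMod q)⁻¹‖ ≤ q.totient := by
      refine (norm_sum_le_of_le (n := fun _ ↦ (1 : ℝ)) _ fun u _ ↦ ?_).trans ?_
      · rw [norm_mul]
        exact mul_le_one₀ (hF _) (norm_nonneg _) (χ.norm_le_one _)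
      · simp [ZMod.card_units_eq_totient]
    rw [norm_mul, norm_inv, Complex.norm_natCast, inv_mul_le_iff₀ (by simpa using NeZero.pos q),
      mul_one]
    exact h1
  · simp_rw [mul_assoc, Finset.sum_mul, ← Finset.mul_sum]
    rw [Finset.sum_comm]
    have h2 (u : (ZMod q)ˣ) : ∑ χ : DirichletCharacter ℂ q, F u * χ (u : ZMod q)⁻¹ * χ x =
        if u = hx.unit then F u * q.totient else 0 := by
      simp_rw [mul_assoc, ← Finset.mul_sum, DirichletCharacter.sum_char_inv_mul_char_eq ℂ u.isUnit]
      have : (u : ZMod q) = x ↔ u = hx.unit := by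
        rw [← Units.val_inj, IsUnit.unit_spec]
      simp [this]
    simp_rw [h2]
    simp
    field_simp

lemma exists_norm_sum_coprime_le (j : ℕ) :
    ∃ C : ℝ, 0 < C ∧ ∀ (q : ℕ) [NeZero q] (F : ZMod q → ℂ), (∀ x, ‖F x‖ ≤ 1) →
      ∀ M N : ℕ, 3 ≤ N → M ≤ N →
      ‖∑ n ∈ Finset.Icc 1 M with n.Coprime q, ((ArithmeticFunction.moebius n : ℤ) : ℂ) * F n‖
        ≤ C * q ^ 3 * (N / Real.log N ^ j) := by
  obtain ⟨C, hC, h⟩ := exists_norm_sum_charMoebius_le_of_le j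
  refine ⟨C, hC, fun q _ F hF M N hN hMN ↦ ?_⟩
  obtain ⟨c, hc, hcF⟩ := exists_sum_character_eq F hF
  have h1 : ∑ n ∈ Finset.Icc 1 M with n.Coprime q, ((ArithmeticFunction.moebius n : ℤ) : ℂ) * F n =
      ∑ χ : DirichletCharacter ℂ q, c χ * ∑ n ∈ Finset.Icc 1 M, charMoebius χ n := by
    simp_rw [Finset.mul_sum]
    rw [Finset.sum_comm, Finset.sum_filter]
    refine Finset.sum_congr rfl fun n _ ↦ ?_
    split_ifs with hn
    · rw [hcF _ ((ZMod.isUnit_iff_coprime n q).mpr hn), Finset.mul_sum]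
      refine Finset.sum_congr rfl fun χ _ ↦ ?_
      rw [charMoebius, Pi.mul_apply]; ring
    · refine (Finset.sum_eq_zero fun χ _ ↦ ?_).symm
      rw [charMoebius, Pi.mul_apply,
        χ.map_nonunit (fun h ↦ hn ((ZMod.isUnit_iff_coprime n q).mp h))]
      simp
  rw [h1]
  calc _ ≤ ∑ χ : DirichletCharacter ℂ q, C * q ^ 2 * (N / Real.log N ^ j) := by
        refine norm_sum_le_of_le _ fun χ _ ↦ ?_
        rw [norm_mul]
        exact (mul_le_of_le_one_left (norm_nonneg _) (hc χ)).trans (h q χ M N hN hMN)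
    _ = q.totient * (C * q ^ 2 * (N / Real.log N ^ j)) := by
        rw [Finset.sum_const, nsmul_eq_mul, Finset.card_univ, ← Nat.card_eq_fintype_card,
          DirichletCharacter.card_eq_totient_of_hasEnoughRootsOfUnity]
    _ ≤ q * (C * q ^ 2 * (N / Real.log N ^ j)) := by
        have := Real.log_natCast_nonneg N
        gcongr
        exact Nat.totient_le q
    _ = _ := by ring

lemma sum_gcd_eq_moebius_mul {q d : ℕ} [NeZero q] (hd : d ∣ q) (F : ZMod q → ℂ) (N : ℕ) :
    ∑ n ∈ Finset.Icc 1 N with n.gcd q = d, ((ArithmeticFunction.moebius n : ℤ) : ℂ) * F n =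
      (ArithmeticFunction.moebius d : ℤ) * ∑ m ∈ Finset.Icc 1 (N / d) with m.Coprime q,
        ((ArithmeticFunction.moebius m : ℤ) : ℂ) * F (d * m) := by
  have hd0 : 0 < d := Nat.pos_of_dvd_of_pos hd (NeZero.pos q)
  rw [Finset.mul_sum]
  symm
  refine Finset.sum_of_injOn (fun m ↦ d * m) ?_ ?_ ?_ ?_
  · intro a _ b _ hab
    exact Nat.eq_of_mul_eq_mul_left hd0 hab
  · intro m hm
    simp only [Finset.coe_filter, Finset.mem_Icc, Set.mem_ofPred_eq] at hm ⊢
    refine ⟨⟨Nat.mul_pos hd0 hm.1.1, ?_⟩, ?_⟩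
    · rw [mul_comm]
      exact (Nat.le_div_iff_mul_le hd0).mp hm.1.2
    · rw [Nat.Coprime.gcd_mul_right_cancel _ hm.2]
      exact Nat.gcd_eq_left hd
  · intro n hn hn'
    simp only [Finset.mem_filter, Finset.mem_Icc] at hn
    obtain ⟨⟨hn1, hnN⟩, hnd⟩ := hn
    obtain ⟨m, rfl⟩ : d ∣ n := hnd ▸ Nat.gcd_dvd_left n q
    by_cases hdm : d.Coprime m
    · refine absurd ?_ hn'
      refine ⟨m, ?_, rfl⟩
      simp only [Finset.coe_filter, Finset.mem_Icc, Set.mem_ofPred_eq]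
      refine ⟨⟨Nat.pos_of_ne_zero (by rintro rfl; simp at hn1), ?_⟩, ?_⟩
      · rw [Nat.le_div_iff_mul_le hd0, mul_comm]
        exact hnN
      · obtain ⟨e, rfl⟩ := hd
        rw [Nat.gcd_mul_left] at hnd
        exact Nat.Coprime.mul_right hdm.symm
          (Nat.eq_of_mul_eq_mul_left hd0 (by rw [hnd, mul_one]))
    · have : ArithmeticFunction.moebius (d * m) = 0 :=
        ArithmeticFunction.moebius_eq_zero_of_not_squarefree
          fun h ↦ hdm (Nat.coprime_of_squarefree_mul h)
      simp [this]
  · intro m hm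
    simp only [Finset.mem_filter] at hm
    rw [ArithmeticFunction.isMultiplicative_moebius.map_mul_of_coprime
      (Nat.Coprime.coprime_dvd_left hd hm.2.symm)]
    push_cast
    ring

/-- The Möbius function is asymptotically orthogonal to functions of small period. -/
theorem exists_norm_sum_moebius_mul_le (j : ℕ) :
    ∃ C : ℝ, 0 < C ∧ ∀ (q : ℕ) [NeZero q] (F : ZMod q → ℂ), (∀ x, ‖F x‖ ≤ 1) →
      ∀ M N : ℕ, 3 ≤ N → M ≤ N →
      ‖∑ n ∈ Finset.Icc 1 M, ((ArithmeticFunction.moebius n : ℤ) : ℂ) * F n‖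
        ≤ C * q ^ 4 * (N / Real.log N ^ j) := by
  obtain ⟨C, hC, h⟩ := exists_norm_sum_coprime_le j
  refine ⟨C, hC, fun q _ F hF M N hN hMN ↦ ?_⟩
  rw [← Finset.sum_fiberwise_of_maps_to (s := Finset.Icc 1 M) (t := q.divisors)
    (g := fun n ↦ n.gcd q) fun n _ ↦ Nat.mem_divisors.mpr ⟨Nat.gcd_dvd_right n q, NeZero.ne q⟩]
  calc _ ≤ ∑ d ∈ q.divisors, C * q ^ 3 * (N / Real.log N ^ j) := by
        refine norm_sum_le_of_le _ fun d hd ↦ ?_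
        rw [sum_gcd_eq_moebius_mul (Nat.dvd_of_mem_divisors hd), norm_mul]
        refine (mul_le_of_le_one_left (norm_nonneg _) ?_).trans
          (h q (fun x ↦ F (d * x)) (fun x ↦ hF _) (M / d) N hN ((Nat.div_le_self _ _).trans hMN))
        rw [Complex.norm_intCast]
        exact_mod_cast ArithmeticFunction.abs_moebius_le_one
    _ = q.divisors.card * (C * q ^ 3 * (N / Real.log N ^ j)) := by
        rw [Finset.sum_const, nsmul_eq_mul]
    _ ≤ q * (C * q ^ 3 * (N / Real.log N ^ j)) := by
        have := Real.log_natCast_nonneg N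
        gcongr
        exact Nat.card_divisors_le_self q
    _ = _ := by ring

/-- The additive character `x ↦ exp (2πix)` of `ℝ`. -/
noncomputable def unitExp (x : ℝ) : ℂ := Complex.exp (Complex.I * ((2 * Real.pi * x : ℝ) : ℂ))

lemma norm_unitExp (x : ℝ) : ‖unitExp x‖ = 1 := by
  rw [unitExp, mul_comm, Complex.norm_exp_ofReal_mul_I]

lemma unitExp_zero : unitExp 0 = 1 := by simp [unitExp]

lemma unitExp_add (x y : ℝ) : unitExp (x + y) = unitExp x * unitExp y := by
  rw [unitExp, unitExp, unitExp, ← Complex.exp_add]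
  congr 1
  push_cast
  ring

lemma unitExp_intCast (n : ℤ) : unitExp n = 1 := by
  rw [unitExp, ← Complex.exp_int_mul_two_pi_mul_I n]
  congr 1
  push_cast
  ring

lemma unitExp_add_intCast (x : ℝ) (n : ℤ) : unitExp (x + n) = unitExp x := by
  rw [unitExp_add, unitExp_intCast, mul_one]

lemma unitExp_natCast_mul (n : ℕ) (x : ℝ) : unitExp (n * x) = unitExp x ^ n := by
  induction n with
  | zero => simp [unitExp_zero]
  | succ n ih => rw [pow_succ, ← ih, ← unitExp_add]; push_cast; ring_nf

lemma conj_unitExp (x : ℝ) : (starRingEnd ℂ) (unitExp x) = unitExp (-x) := by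
  rw [unitExp, unitExp, ← Complex.exp_conj, map_mul, Complex.conj_I, Complex.conj_ofReal]
  congr 1
  push_cast
  ring

lemma norm_unitExp_sub_one_le (x : ℝ) : ‖unitExp x - 1‖ ≤ 2 * Real.pi * |x| := by
  refine Real.norm_exp_I_mul_ofReal_sub_one_le.trans ?_
  rw [Real.norm_eq_abs, abs_mul, abs_of_pos (by positivity)]

lemma four_mul_abs_sub_round_le_norm_unitExp_sub_one (x : ℝ) :
    4 * |x - round x| ≤ ‖unitExp x - 1‖ := by
  have h1 : unitExp x = unitExp (x - round x) := by
    have := unitExp_add_intCast (x - round x) (round x)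
    rwa [sub_add_cancel] at this
  have h2 (y : ℝ) (hy : |y| ≤ 1 / 2) : 4 * |y| ≤ ‖unitExp y - 1‖ := by
    have h3 := Real.mul_le_sin (x := Real.pi * |y|) (by positivity)
      (by nlinarith [Real.pi_pos])
    have h4 : 2 / Real.pi * (Real.pi * |y|) = 2 * |y| := by field_simp
    have h5 : |Real.sin (Real.pi * y)| = Real.sin (Real.pi * |y|) := by
      rcases abs_cases y with ⟨h, _⟩ | ⟨h, _⟩
      · rw [h4, h] at h3
        rw [h]
        exact abs_of_nonneg (by linarith)
      · rw [h4, h, mul_neg, mul_neg, Real.sin_neg] at h3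
        rw [h, mul_neg, Real.sin_neg]
        exact abs_of_nonpos (by linarith)
    rw [unitExp, Complex.norm_exp_I_mul_ofReal_sub_one, norm_mul, Real.norm_eq_abs,
      Real.norm_eq_abs, show 2 * Real.pi * y / 2 = Real.pi * y by ring, h5, abs_two]
    linarith
  rw [h1]
  exact h2 _ (abs_sub_round x)

lemma norm_sum_unitExp_mul_le (L : ℕ) (x : ℝ) :
    ‖∑ k ∈ Finset.Icc 1 L, unitExp (k * x)‖ * (2 * |x - round x|) ≤ 1 := by
  have h1 : (unitExp x - 1) * ∑ k ∈ Finset.Icc 1 L, unitExp (k * x) =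
      unitExp x * (unitExp x ^ L - 1) := by
    rw [← mul_geom_sum, ← mul_assoc, mul_comm (unitExp x), mul_assoc]
    congr 1
    rw [sum_Icc_eq_sum_add_sum_range _ 0 L (Nat.zero_le L)]
    simp only [Finset.Icc_eq_empty_of_lt zero_lt_one, Finset.sum_empty, zero_add, Nat.sub_zero]
    rw [Finset.mul_sum]
    refine Finset.sum_congr rfl fun i _ ↦ ?_
    rw [unitExp_natCast_mul, add_comm, pow_succ']
  have h2 : ‖unitExp x * (unitExp x ^ L - 1)‖ ≤ 2 := by
    rw [norm_mul, norm_unitExp, one_mul]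
    refine (norm_sub_le _ _).trans ?_
    rw [norm_pow, norm_unitExp, one_pow, norm_one]
    norm_num
  rw [← h1, norm_mul] at h2
  nlinarith [four_mul_abs_sub_round_le_norm_unitExp_sub_one x,
    norm_nonneg (∑ k ∈ Finset.Icc 1 L, unitExp (k * x))]

/-- A uniform bound for the sums `∑ e(kx)` over at most `K` consecutive integers, essentially
`min K (1 / (2‖x‖))`. -/
noncomputable def geomBound (K x : ℝ) : ℝ := K / max 1 (2 * K * |x - round x|)

lemma geomBound_nonneg {K : ℝ} (hK : 0 ≤ K) (x : ℝ) : 0 ≤ geomBound K x := by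
  unfold geomBound; positivity

lemma geomBound_le {K : ℝ} (hK : 0 ≤ K) (x : ℝ) : geomBound K x ≤ K :=
  div_le_self hK (le_max_left _ _)

lemma geomBound_mul_le (K x : ℝ) :
    geomBound K x * (2 * |x - round x|) ≤ 1 := by
  rw [geomBound, div_mul_eq_mul_div, div_le_one (by positivity)]
  exact le_trans (by linarith) (le_max_right _ _)

lemma norm_sum_unitExp_mul_le_geomBound {K : ℝ} {L : ℕ} (hL : L ≤ K) (x : ℝ) :
    ‖∑ k ∈ Finset.Icc 1 L, unitExp (k * x)‖ ≤ geomBound K x := by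
  have hK : 0 ≤ K := (Nat.cast_nonneg L).trans hL
  rw [geomBound, le_div_iff₀ (by positivity)]
  have h1 : ‖∑ k ∈ Finset.Icc 1 L, unitExp (k * x)‖ ≤ L := by
    refine (norm_sum_le_of_le _ fun k _ ↦ (norm_unitExp _).le).trans ?_
    simp
  rcases max_cases 1 (2 * K * |x - round x|) with ⟨h, _⟩ | ⟨h, _⟩
  · rw [h, mul_one]; exact h1.trans hL
  · rw [h]
    nlinarith [norm_sum_unitExp_mul_le L x]

lemma sum_range_eq_sum_zmod {q : ℕ} [NeZero q] (G : ZMod q → ℝ) :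
    ∑ j ∈ Finset.range q, G j = ∑ x, G x := by
  refine Finset.sum_nbij' (fun j ↦ (j : ZMod q)) ZMod.val (fun _ _ ↦ Finset.mem_univ _)
    (fun x _ ↦ Finset.mem_range.mpr x.val_lt) (fun j hj ↦ ?_) (fun x _ ↦ ?_) (fun _ _ ↦ rfl)
  · exact ZMod.val_cast_of_lt (Finset.mem_range.mp hj)
  · exact ZMod.natCast_zmod_val x

lemma sum_range_zmod_val_affine {q : ℕ} [NeZero q] (g : ℕ → ℝ) {a : ℤ} (ha : IsCoprime a q)
    (b : ℤ) :
    ∑ j ∈ Finset.range q, g (((b + j * a : ℤ) : ZMod q)).val = ∑ r ∈ Finset.range q, g r := by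
  have hu : IsUnit (a : ZMod q) := by
    obtain ⟨u, v, huv⟩ := ha
    refine IsUnit.of_mul_eq_one (u : ZMod q) ?_
    have := congrArg (Int.cast : ℤ → ZMod q) huv
    push_cast at this
    rw [ZMod.natCast_self, mul_zero, add_zero] at this
    rw [mul_comm]; exact this
  have h1 := sum_range_eq_sum_zmod (q := q) fun x ↦ g ((b : ZMod q) + x * a).val
  have h2 := sum_range_eq_sum_zmod (q := q) fun x ↦ g x.val
  have hinj : Function.Injective fun x : ZMod q ↦ (b : ZMod q) + x * a := fun x y hxy ↦
    hu.mul_right_cancel (add_left_cancel hxy)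
  have h3 : ∑ x : ZMod q, g ((b : ZMod q) + x * a).val = ∑ x : ZMod q, g x.val :=
    Fintype.sum_bijective _ (Finite.injective_iff_bijective.mp hinj) _ _ fun _ ↦ rfl
  push_cast
  rw [h1, h3, ← h2]
  refine Finset.sum_congr rfl fun j hj ↦ ?_
  rw [ZMod.val_cast_of_lt (Finset.mem_range.mp hj)]

lemma sum_range_ite_le (K : ℝ) (hK : 0 ≤ K) (q : ℕ) :
    ∑ r ∈ Finset.range q, (if r ≤ 1 then K else q / (2 * ((r : ℝ) - 1))) ≤
      2 * K + q * (1 + Real.log q) / 2 := by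
  have h1 (n : ℕ) : ∑ r ∈ Finset.range (n + 2), (if r ≤ 1 then K else q / (2 * ((r : ℝ) - 1))) =
      2 * K + q / 2 * (harmonic n : ℝ) := by
    induction n with
    | zero => simp [Finset.sum_range_succ]; ring
    | succ n ih =>
      rw [add_right_comm, Finset.sum_range_succ, ih, harmonic_succ, if_neg (by omega)]
      push_cast
      rw [show (n : ℝ) + 2 - 1 = n + 1 by ring]
      field_simp
      ring
  have h2 : ∑ r ∈ Finset.range q, (if r ≤ 1 then K else q / (2 * ((r : ℝ) - 1))) ≤
      ∑ r ∈ Finset.range (q + 2), (if r ≤ 1 then K else q / (2 * ((r : ℝ) - 1))) := by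
    refine Finset.sum_le_sum_of_subset_of_nonneg (Finset.range_mono (by omega)) fun r _ _ ↦ ?_
    split_ifs with h
    · exact hK
    · have : (1 : ℝ) ≤ r := by exact_mod_cast (by omega : 1 ≤ r)
      have : 0 ≤ (r : ℝ) - 1 := by linarith
      positivity
  refine h2.trans ((h1 q).le.trans ?_)
  have h3 := harmonic_le_one_add_log q
  have : q / 2 * (harmonic q : ℝ) ≤ q / 2 * (1 + Real.log q) := by gcongr
  linarith

lemma sum_range_le_of_rational_approx {f : ℤ → ℝ} {α K : ℝ} {q : ℕ} [NeZero q] {a : ℤ}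
    (ha : IsCoprime a q) (hα : |α - a / q| ≤ 1 / (q : ℝ) ^ 2) (hK : 0 ≤ K)
    (hfK : ∀ h, f h ≤ K) (hf : ∀ h : ℤ, f h * (2 * |h * α - round (h * α)|) ≤ 1) (h₀ : ℤ) :
    ∑ j ∈ Finset.range q, f (h₀ + j) ≤ 4 * K + q * (1 + Real.log q) := by
  have hq : (0 : ℝ) < q := by exact_mod_cast NeZero.pos q
  set φ : ℕ → ℝ := fun r ↦ if r ≤ 1 then K else q / (2 * ((r : ℝ) - 1)) with hφ
  have hφ0 (r : ℕ) : 0 ≤ φ r := by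
    simp only [hφ]
    split_ifs with h
    · exact hK
    · have : (1 : ℝ) ≤ r := by exact_mod_cast (by omega : 1 ≤ r)
      have : 0 ≤ (r : ℝ) - 1 := by linarith
      positivity
  set b : ℤ := ⌊q * (h₀ * α)⌋ with hb
  have key (j : ℕ) (hj : j < q) : f (h₀ + j) ≤ φ ((b + j * a : ℤ) : ZMod q).val +
      φ (q - 1 - ((b + j * a : ℤ) : ZMod q).val) := by
    set r := ((b + j * a : ℤ) : ZMod q).val with hr
    have hrq : r < q := ZMod.val_lt _
    set s := min r (q - 1 - r) with hs
    have h1 : f (h₀ + j) ≤ φ s := by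
      simp only [hφ]
      split_ifs with hs1
      · exact hfK _
      · obtain ⟨t, ht⟩ : ∃ t : ℤ, b + j * a - q * round (((h₀ + j : ℤ) : ℝ) * α) = r + q * t := by
          have : (r : ℤ) = (b + j * a) % q := by rw [hr, ZMod.val_intCast]
          refine ⟨(b + j * a) / q - round (((h₀ + j : ℤ) : ℝ) * α), ?_⟩
          have h2 := Int.emod_add_mul_ediv (b + j * a) q
          rw [this]; linear_combination -h2
        have hb1 := Int.floor_le (q * (h₀ * α))
        have hb2 := Int.lt_floor_add_one (q * (h₀ * α))
        rw [← hb] at hb1 hb2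
        have hη : |j * q * (α - a / q)| ≤ 1 := by
          rw [abs_mul, abs_of_nonneg (by positivity)]
          calc j * q * |α - a / q| ≤ q * q * (1 / (q : ℝ) ^ 2) := by gcongr
            _ = 1 := by field_simp
        have hη1 := abs_le.mp hη
        have hη2 : j * q * (α - a / q) = j * q * α - j * a := by field_simp
        rw [hη2] at hη1
        have ht' : (b : ℝ) + j * a - q * (round (((h₀ + j : ℤ) : ℝ) * α) : ℤ) = r + q * t := by
          exact_mod_cast ht
        have hfin : (s : ℝ) - 1 ≤ q * |((h₀ + j : ℤ) : ℝ) * α - round (((h₀ + j : ℤ) : ℝ) * α)| := by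
          have habs (y : ℝ) : q * |y| = |q * y| := by rw [abs_mul, abs_of_pos hq]
          rw [habs, mul_sub]
          have hexp : (q : ℝ) * (((h₀ + j : ℤ) : ℝ) * α) = q * (h₀ * α) + j * q * α := by
            push_cast; ring
          rcases le_or_gt 0 t with h0 | h0
          · have h0' : (0 : ℝ) ≤ q * t := mul_nonneg hq.le (by exact_mod_cast h0)
            have hsr : (s : ℝ) ≤ r := by exact_mod_cast min_le_left _ _
            refine le_trans ?_ (le_abs_self _)
            rw [hexp]; linarith
          · have h0' : (q : ℝ) * t ≤ q * (-1) := by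
              gcongr; exact_mod_cast (by omega : t ≤ -1)
            have hsr : (s : ℝ) ≤ q - 1 - r := by
              have : s + 1 + r ≤ q := by omega
              have : (s : ℝ) + 1 + r ≤ q := by exact_mod_cast this
              linarith
            refine le_trans ?_ (neg_le_abs _)
            rw [hexp]; linarith
        have hs2 : (0 : ℝ) < s - 1 := by
          have : (2 : ℝ) ≤ s := by exact_mod_cast (by omega : 2 ≤ s)
          linarith
        rcases le_or_gt (f (h₀ + j)) 0 with hneg | hpos
        · exact hneg.trans (by positivity)
        rw [le_div_iff₀ (by positivity)]
        have h3 := hf (h₀ + j)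
        calc f (h₀ + j) * (2 * ((s : ℝ) - 1)) ≤ f (h₀ + j) * (2 *
              (q * |((h₀ + j : ℤ) : ℝ) * α - round (((h₀ + j : ℤ) : ℝ) * α)|)) := by gcongr
          _ = q * (f (h₀ + j) * (2 *
              |((h₀ + j : ℤ) : ℝ) * α - round (((h₀ + j : ℤ) : ℝ) * α)|)) := by ring
          _ ≤ q * 1 := by gcongr
          _ = q := mul_one _
    refine h1.trans ?_
    rcases min_choice r (q - 1 - r) with h | h
    · rw [hs, h]; linarith [hφ0 (q - 1 - r)]
    · rw [hs, h]; linarith [hφ0 r]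
  calc _ ≤ ∑ j ∈ Finset.range q, (fun r ↦ φ r + φ (q - 1 - r)) ((b + j * a : ℤ) : ZMod q).val :=
        Finset.sum_le_sum fun j hj ↦ key j (Finset.mem_range.mp hj)
    _ = ∑ r ∈ Finset.range q, (φ r + φ (q - 1 - r)) :=
        sum_range_zmod_val_affine (fun r ↦ φ r + φ (q - 1 - r)) ha b
    _ = 2 * ∑ r ∈ Finset.range q, φ r := by
        rw [Finset.sum_add_distrib, Finset.sum_range_reflect]; ring
    _ ≤ _ := by linarith [sum_range_ite_le K hK q]

lemma sum_range_le_of_rational_approx' {f : ℤ → ℝ} {α K : ℝ} {q : ℕ} [NeZero q] {a : ℤ}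
    (ha : IsCoprime a q) (hα : |α - a / q| ≤ 1 / (q : ℝ) ^ 2) (hK : 0 ≤ K) (hf0 : ∀ h, 0 ≤ f h)
    (hfK : ∀ h, f h ≤ K) (hf : ∀ h : ℤ, f h * (2 * |h * α - round (h * α)|) ≤ 1) (h₀ : ℤ) (H : ℕ) :
    ∑ j ∈ Finset.range H, f (h₀ + j) ≤ (H / q + 1) * (4 * K + q * (1 + Real.log q)) := by
  have hq : (0 : ℝ) < q := by exact_mod_cast NeZero.pos q
  have h1 (n : ℕ) : ∑ j ∈ Finset.range (n * q), f (h₀ + j) ≤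
      n * (4 * K + q * (1 + Real.log q)) := by
    induction n with
    | zero => simp
    | succ n ih =>
      rw [add_mul, one_mul, Finset.sum_range_add]
      have h2 := sum_range_le_of_rational_approx ha hα hK hfK hf (h₀ + (n * q : ℕ))
      have h3 : ∑ j ∈ Finset.range q, f (h₀ + (n * q + j : ℕ)) =
          ∑ j ∈ Finset.range q, f (h₀ + (n * q : ℕ) + j) := by
        refine Finset.sum_congr rfl fun j _ ↦ ?_
        push_cast; ring_nf
      rw [h3]
      push_cast at *
      linarith
  calc _ ≤ ∑ j ∈ Finset.range ((H / q + 1) * q), f (h₀ + j) := by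
        refine Finset.sum_le_sum_of_subset_of_nonneg (Finset.range_mono ?_) fun _ _ _ ↦ hf0 _
        have := Nat.lt_div_mul_add (a := H) (NeZero.pos q)
        rw [add_mul, one_mul]; exact this.le
    _ ≤ _ := h1 _
    _ ≤ _ := by
      have := Real.log_natCast_nonneg q
      push_cast
      gcongr
      exact Nat.cast_div_le

lemma sum_sum_geomBound_le {α : ℝ} {q : ℕ} [NeZero q] {a : ℤ} (ha : IsCoprime a q)
    (hα : |α - a / q| ≤ 1 / (q : ℝ) ^ 2) (M K : ℕ) :
    ∑ m ∈ Finset.Ico M (2 * M), ∑ m' ∈ Finset.Ico M (2 * M), geomBound K (((m : ℝ) - m') * α) ≤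
      M * ((M / q + 1) * (4 * K + q * (1 + Real.log q))) := by
  rw [Finset.sum_comm]
  calc _ ≤ ∑ m' ∈ Finset.Ico M (2 * M), (M / q + 1 : ℝ) * (4 * K + q * (1 + Real.log q)) := by
        refine Finset.sum_le_sum fun m' _ ↦ ?_
        have h := sum_range_le_of_rational_approx' (f := fun h : ℤ ↦ geomBound K (h * α)) ha hα
          (Nat.cast_nonneg K) (fun h ↦ geomBound_nonneg (Nat.cast_nonneg K) _)
          (fun h ↦ geomBound_le (Nat.cast_nonneg K) _) (fun h ↦ geomBound_mul_le _ _)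
          ((M : ℤ) - m') M
        rw [Finset.sum_Ico_eq_sum_range, two_mul, Nat.add_sub_cancel_left]
        refine le_trans (le_of_eq (Finset.sum_congr rfl fun j _ ↦ ?_)) h
        congr 2
        push_cast
        ring
    _ = _ := by
        rw [Finset.sum_const, nsmul_eq_mul, Nat.card_Ico, two_mul, Nat.add_sub_cancel]

lemma sum_norm_sq_le {α : ℝ} {q : ℕ} [NeZero q] {r : ℤ} (hr : IsCoprime r q)
    (hα : |α - r / q| ≤ 1 / (q : ℝ) ^ 2) {a : ℕ → ℂ} (ha : ∀ m, ‖a m‖ ≤ 1) {M : ℕ} (hM : 0 < M)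
    (N : ℕ) :
    ∑ k ∈ Finset.Icc 1 (N / M), ‖∑ m ∈ Finset.Ico M (2 * M),
        if k ≤ N / m then a m * unitExp (m * k * α) else 0‖ ^ 2 ≤
      M * ((M / q + 1) * (4 * (N / M : ℕ) + q * (1 + Real.log q))) := by
  refine le_trans ?_ (sum_sum_geomBound_le hr hα M (N / M))
  set B : ℕ → ℂ := fun k ↦ ∑ m ∈ Finset.Ico M (2 * M),
    if k ≤ N / m then a m * unitExp (m * k * α) else 0 with hB
  have h1 : ((∑ k ∈ Finset.Icc 1 (N / M), ‖B k‖ ^ 2 : ℝ) : ℂ) =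
      ∑ m ∈ Finset.Ico M (2 * M), ∑ m' ∈ Finset.Ico M (2 * M),
        a m * (starRingEnd ℂ) (a m') * ∑ k ∈ Finset.Icc 1 (min (N / m) (N / m')),
          unitExp (k * (((m : ℝ) - m') * α)) := by
    push_cast
    have h2 (k : ℕ) : (‖B k‖ : ℂ) ^ 2 = ∑ m ∈ Finset.Ico M (2 * M), ∑ m' ∈ Finset.Ico M (2 * M),
        if k ≤ min (N / m) (N / m') then a m * (starRingEnd ℂ) (a m') *
          unitExp (k * (((m : ℝ) - m') * α)) else 0 := by
      rw [← Complex.mul_conj', hB, map_sum, Finset.sum_mul_sum]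
      refine Finset.sum_congr rfl fun m _ ↦ Finset.sum_congr rfl fun m' _ ↦ ?_
      by_cases h3 : k ≤ N / m <;> by_cases h4 : k ≤ N / m' <;> simp [h3, h4]
      rw [conj_unitExp, show (k : ℝ) * (((m : ℝ) - m') * α) = m * k * α + -(m' * k * α) by ring,
        unitExp_add]
      ring
    simp_rw [h2]
    rw [Finset.sum_comm]
    refine Finset.sum_congr rfl fun m hm ↦ ?_
    rw [Finset.sum_comm]
    refine Finset.sum_congr rfl fun m' _ ↦ ?_
    rw [← Finset.sum_filter, ← Finset.mul_sum]
    congr 2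
    ext k
    have : N / m ≤ N / M := Nat.div_le_div_left (Finset.mem_Ico.mp hm).1 hM
    simp only [Finset.mem_filter, Finset.mem_Icc]
    omega
  have h5 : (∑ k ∈ Finset.Icc 1 (N / M), ‖B k‖ ^ 2 : ℝ) =
      ‖((∑ k ∈ Finset.Icc 1 (N / M), ‖B k‖ ^ 2 : ℝ) : ℂ)‖ := by
    rw [Complex.norm_of_nonneg (by positivity)]
  rw [h5, h1]
  refine norm_sum_le_of_le _ fun m hm ↦ norm_sum_le_of_le _ fun m' hm' ↦ ?_
  rw [norm_mul]
  refine (mul_le_of_le_one_left (norm_nonneg _) ?_).trans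
    (norm_sum_unitExp_mul_le_geomBound ?_ _)
  · rw [norm_mul, RCLike.norm_conj]
    exact mul_le_one₀ (ha m) (norm_nonneg _) (ha m')
  · exact_mod_cast (min_le_left _ _).trans (Nat.div_le_div_left (Finset.mem_Ico.mp hm).1 hM)

/-- A bilinear (type II) estimate for exponential sums over a dyadic block. -/
lemma norm_sum_bilinear_sq_le {α : ℝ} {q : ℕ} [NeZero q] {r : ℤ} (hr : IsCoprime r q)
    (hα : |α - r / q| ≤ 1 / (q : ℝ) ^ 2) {a : ℕ → ℂ} (ha : ∀ m, ‖a m‖ ≤ 1) (c : ℕ → ℂ) {M : ℕ}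
    (hM : 0 < M) (N : ℕ) :
    ‖∑ m ∈ Finset.Ico M (2 * M), ∑ k ∈ Finset.Icc 1 (N / m),
        a m * c k * unitExp (m * k * α)‖ ^ 2 ≤
      (∑ k ∈ Finset.Icc 1 (N / M), ‖c k‖ ^ 2) *
        (M * ((M / q + 1) * (4 * (N / M : ℕ) + q * (1 + Real.log q)))) := by
  have h1 : ∑ m ∈ Finset.Ico M (2 * M), ∑ k ∈ Finset.Icc 1 (N / m),
      a m * c k * unitExp (m * k * α) = ∑ k ∈ Finset.Icc 1 (N / M), c k *
        ∑ m ∈ Finset.Ico M (2 * M), if k ≤ N / m then a m * unitExp (m * k * α) else 0 := by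
    simp_rw [Finset.mul_sum]
    rw [Finset.sum_comm (s := Finset.Icc 1 (N / M))]
    refine Finset.sum_congr rfl fun m hm ↦ ?_
    have h2 : Finset.Icc 1 (N / m) = {k ∈ Finset.Icc 1 (N / M) | k ≤ N / m} := by
      ext k
      have : N / m ≤ N / M := Nat.div_le_div_left (Finset.mem_Ico.mp hm).1 hM
      simp only [Finset.mem_filter, Finset.mem_Icc]
      omega
    rw [h2, Finset.sum_filter]
    refine Finset.sum_congr rfl fun k _ ↦ ?_
    split_ifs
    · ring
    · simp
  rw [h1]
  calc _ ≤ (∑ k ∈ Finset.Icc 1 (N / M), ‖c k‖ * ‖∑ m ∈ Finset.Ico M (2 * M),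
        if k ≤ N / m then a m * unitExp (m * k * α) else 0‖) ^ 2 := by
        gcongr
        exact norm_sum_le_of_le _ fun k _ ↦ (norm_mul _ _).le
    _ ≤ _ := Finset.sum_mul_sq_le_sq_mul_sq _ _ _
    _ ≤ _ := by
        gcongr
        exact sum_norm_sq_le hr hα ha hM N

lemma card_divisors_mul_le (m n : ℕ) :
    (m * n).divisors.card ≤ m.divisors.card * n.divisors.card := by
  rw [Nat.divisors_mul]
  exact Finset.card_mul_le

lemma sum_Icc_sum_divisors_eq {M : Type*} [AddCommMonoid M] (F : ℕ → ℕ → M) (N : ℕ) :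
    ∑ n ∈ Finset.Icc 1 N, ∑ x ∈ n.divisorsAntidiagonal, F x.1 x.2 =
      ∑ m ∈ Finset.Icc 1 N, ∑ k ∈ Finset.Icc 1 (N / m), F m k := by
  rw [Finset.sum_sigma', Finset.sum_sigma']
  refine Finset.sum_bij' (fun x _ ↦ ⟨x.2.1, x.2.2⟩) (fun x _ ↦ ⟨x.1 * x.2, (x.1, x.2)⟩) ?_ ?_ ?_ ?_ ?_
  · rintro ⟨n, m, k⟩ h
    simp only [Finset.mem_sigma, Finset.mem_Icc, Nat.mem_divisorsAntidiagonal] at h ⊢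
    obtain ⟨⟨h1, h2⟩, rfl, h3⟩ := h
    have hm : 0 < m := Nat.pos_of_ne_zero (by rintro rfl; simp at h3)
    have hk : 0 < k := Nat.pos_of_ne_zero (by rintro rfl; simp at h3)
    refine ⟨⟨hm, (Nat.le_mul_of_pos_right m hk).trans h2⟩, hk, ?_⟩
    rw [Nat.le_div_iff_mul_le hm, mul_comm]
    exact h2
  · rintro ⟨m, k⟩ h
    simp only [Finset.mem_sigma, Finset.mem_Icc, Nat.mem_divisorsAntidiagonal] at h ⊢
    obtain ⟨⟨h1, h2⟩, h3, h4⟩ := h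
    rw [Nat.le_div_iff_mul_le h1, mul_comm] at h4
    have : 0 < m * k := Nat.mul_pos h1 h3
    exact ⟨⟨this, h4⟩, trivial, this.ne'⟩
  · rintro ⟨n, m, k⟩ h
    simp only [Finset.mem_sigma, Nat.mem_divisorsAntidiagonal] at h
    obtain ⟨_, rfl, _⟩ := h
    rfl
  · rintro ⟨m, k⟩ _
    rfl
  · rintro ⟨n, m, k⟩ _
    rfl

lemma sum_Icc_inv_le (N : ℕ) : ∑ k ∈ Finset.Icc 1 N, (k : ℝ)⁻¹ ≤ 1 + Real.log N := by
  refine le_trans (le_of_eq ?_) (harmonic_le_one_add_log N)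
  rw [harmonic_eq_sum_Icc]
  push_cast
  rfl

lemma sum_card_divisors_mul_eq (w : ℕ → ℝ) (N : ℕ) :
    ∑ n ∈ Finset.Icc 1 N, (n.divisors.card : ℝ) * w n =
      ∑ m ∈ Finset.Icc 1 N, ∑ k ∈ Finset.Icc 1 (N / m), w (m * k) := by
  rw [← sum_Icc_sum_divisors_eq (fun m k ↦ w (m * k))]
  refine Finset.sum_congr rfl fun n _ ↦ ?_
  rw [Finset.sum_congr rfl fun x hx ↦ by rw [(Nat.mem_divisorsAntidiagonal.mp hx).1],
    Nat.sum_divisorsAntidiagonal fun _ _ ↦ w n, Finset.sum_const, nsmul_eq_mul]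

lemma sum_card_divisors_le (N : ℕ) :
    ∑ n ∈ Finset.Icc 1 N, (n.divisors.card : ℝ) ≤ N * (1 + Real.log N) := by
  have h := sum_card_divisors_mul_eq (fun _ ↦ 1) N
  simp only [mul_one, Finset.sum_const, Nat.card_Icc, Nat.add_sub_cancel, nsmul_eq_mul] at h
  rw [h]
  calc _ ≤ ∑ m ∈ Finset.Icc 1 N, (N : ℝ) * (m : ℝ)⁻¹ :=
        Finset.sum_le_sum fun m _ ↦ Nat.cast_div_le.trans_eq (div_eq_mul_inv _ _)
    _ ≤ _ := by
        rw [← Finset.mul_sum]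
        gcongr
        exact sum_Icc_inv_le N

lemma sum_card_divisors_mul_inv_le (N : ℕ) :
    ∑ n ∈ Finset.Icc 1 N, (n.divisors.card : ℝ) * (n : ℝ)⁻¹ ≤ (1 + Real.log N) ^ 2 := by
  rw [sum_card_divisors_mul_eq (fun n ↦ (n : ℝ)⁻¹) N]
  calc _ ≤ ∑ m ∈ Finset.Icc 1 N, ∑ k ∈ Finset.Icc 1 N, (m : ℝ)⁻¹ * (k : ℝ)⁻¹ := by
        refine Finset.sum_le_sum fun m _ ↦ ?_
        simp only [Nat.cast_mul, mul_inv]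
        refine Finset.sum_le_sum_of_subset_of_nonneg
          (Finset.Icc_subset_Icc_right (Nat.div_le_self _ _)) fun _ _ _ ↦ by positivity
    _ ≤ _ := by
        rw [← Finset.sum_mul_sum, sq]
        have := Real.log_natCast_nonneg N
        have := sum_Icc_inv_le N
        gcongr

lemma sum_card_divisors_sq_le (N : ℕ) :
    ∑ n ∈ Finset.Icc 1 N, (n.divisors.card : ℝ) ^ 2 ≤ N * (1 + Real.log N) ^ 3 := by
  have hl := Real.log_natCast_nonneg N
  simp_rw [sq]
  rw [sum_card_divisors_mul_eq (fun n ↦ (n.divisors.card : ℝ)) N]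
  calc _ ≤ ∑ m ∈ Finset.Icc 1 N, N * (1 + Real.log N) * ((m.divisors.card : ℝ) * (m : ℝ)⁻¹) := by
        refine Finset.sum_le_sum fun m hm ↦ ?_
        have h1 : ∑ k ∈ Finset.Icc 1 (N / m), ((m * k).divisors.card : ℝ) ≤
            m.divisors.card * ∑ k ∈ Finset.Icc 1 (N / m), (k.divisors.card : ℝ) := by
          rw [Finset.mul_sum]
          exact Finset.sum_le_sum fun k _ ↦ by exact_mod_cast card_divisors_mul_le m k
        have h2 : Real.log (N / m : ℕ) ≤ Real.log N := by
          rcases Nat.eq_zero_or_pos (N / m) with h | h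
          · rw [h]; simpa using hl
          · exact Real.log_le_log (by exact_mod_cast h) (by exact_mod_cast Nat.div_le_self _ _)
        have h3 := Real.log_natCast_nonneg (N / m)
        calc _ ≤ (m.divisors.card : ℝ) * ((N / m : ℕ) * (1 + Real.log (N / m : ℕ))) := by
              refine h1.trans ?_
              gcongr
              exact sum_card_divisors_le _
          _ ≤ (m.divisors.card : ℝ) * ((N / m : ℝ) * (1 + Real.log N)) := by
              gcongr
              exact Nat.cast_div_le
          _ = _ := by ring
    _ ≤ N * (1 + Real.log N) * (1 + Real.log N) ^ 2 := by
        rw [← Finset.mul_sum]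
        gcongr
        exact sum_card_divisors_mul_inv_le N
    _ = _ := by ring

/-- The Möbius function truncated to arguments at most `U`. -/
noncomputable def moebiusLow (U : ℝ) : ArithmeticFunction ℂ :=
  ⟨fun n ↦ if n ≤ U then ((ArithmeticFunction.moebius n : ℤ) : ℂ) else 0, by simp⟩

/-- The Möbius function truncated to arguments larger than `U`. -/
noncomputable def moebiusHigh (U : ℝ) : ArithmeticFunction ℂ :=
  ⟨fun n ↦ if n ≤ U then 0 else ((ArithmeticFunction.moebius n : ℤ) : ℂ), by simp⟩

lemma moebiusLow_apply (U : ℝ) (n : ℕ) :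
    moebiusLow U n = if n ≤ U then ((ArithmeticFunction.moebius n : ℤ) : ℂ) else 0 := rfl

lemma moebiusHigh_apply (U : ℝ) (n : ℕ) :
    moebiusHigh U n = if n ≤ U then 0 else ((ArithmeticFunction.moebius n : ℤ) : ℂ) := rfl

lemma norm_moebius_le_one (n : ℕ) : ‖((ArithmeticFunction.moebius n : ℤ) : ℂ)‖ ≤ 1 := by
  rw [Complex.norm_intCast]
  exact_mod_cast ArithmeticFunction.abs_moebius_le_one

lemma norm_moebiusHigh_le (U : ℝ) (n : ℕ) : ‖moebiusHigh U n‖ ≤ 1 := by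
  rw [moebiusHigh_apply]
  split_ifs
  · simp
  · exact norm_moebius_le_one n

lemma sum_norm_moebiusLow_le {U : ℝ} (hU : 0 ≤ U) (N : ℕ) :
    ∑ n ∈ Finset.Icc 1 N, ‖moebiusLow U n‖ ≤ U := by
  calc _ ≤ ∑ n ∈ Finset.Icc 1 N, if n ≤ U then (1 : ℝ) else 0 := by
        refine Finset.sum_le_sum fun n _ ↦ ?_
        rw [moebiusLow_apply]
        split_ifs
        · exact norm_moebius_le_one n
        · simp
    _ = (((Finset.Icc 1 N).filter fun n : ℕ ↦ (n : ℝ) ≤ U).card : ℝ) := by simp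
    _ ≤ ((Finset.Icc 1 ⌊U⌋₊).card : ℝ) := by
        gcongr
        intro n hn
        simp only [Finset.mem_filter, Finset.mem_Icc] at hn ⊢
        exact ⟨hn.1.1, Nat.le_floor hn.2⟩
    _ ≤ U := by simpa using Nat.floor_le hU

lemma moebius_eq_add (U : ℝ) :
    ((ArithmeticFunction.moebius : ArithmeticFunction ℤ) : ArithmeticFunction ℂ) =
      moebiusLow U + moebiusHigh U := by
  ext n
  rw [ArithmeticFunction.add_apply, moebiusLow_apply, moebiusHigh_apply,
    ArithmeticFunction.intCoe_apply]
  split_ifs <;> simp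

/-- Vaughan's identity for the Möbius function. -/
lemma moebius_eq_vaughan (U : ℝ) :
    ((ArithmeticFunction.moebius : ArithmeticFunction ℤ) : ArithmeticFunction ℂ) =
      2 * moebiusLow U - moebiusLow U * (moebiusLow U * (ArithmeticFunction.zeta :
        ArithmeticFunction ℂ)) +
      moebiusHigh U * (moebiusHigh U * (ArithmeticFunction.zeta : ArithmeticFunction ℂ)) := by
  have h1 := ArithmeticFunction.coe_moebius_mul_coe_zeta (R := ℂ)
  have h2 := moebius_eq_add U
  rw [h2] at h1 ⊢
  linear_combination (moebiusLow U - moebiusHigh U) * h1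

lemma sum_mul_unitExp_eq (f g : ArithmeticFunction ℂ) (N : ℕ) (α : ℝ) :
    ∑ n ∈ Finset.Icc 1 N, (f * g) n * unitExp (n * α) =
      ∑ m ∈ Finset.Icc 1 N, ∑ k ∈ Finset.Icc 1 (N / m), f m * g k * unitExp (m * k * α) := by
  rw [← sum_Icc_sum_divisors_eq fun m k ↦ f m * g k * unitExp (m * k * α)]
  refine Finset.sum_congr rfl fun n _ ↦ ?_
  rw [ArithmeticFunction.mul_apply, Finset.sum_mul]
  refine Finset.sum_congr rfl fun x hx ↦ ?_
  rw [← (Nat.mem_divisorsAntidiagonal.mp hx).1]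
  push_cast
  rfl

lemma norm_sum_unitExp_le_of_rational_approx {α : ℝ} {q : ℕ} {r : ℤ} (hr : IsCoprime r q)
    (hα : |α - r / q| ≤ 1 / (q : ℝ) ^ 2) {D : ℕ} (hD : 0 < D) (hDq : 2 * D ≤ q) (L : ℕ) :
    ‖∑ k ∈ Finset.Icc 1 L, unitExp (k * (D * α))‖ ≤ q := by
  have hq : (0 : ℝ) < q := by exact_mod_cast (by omega : 0 < q)
  set n : ℤ := round (D * α) with hn
  have h1 : (1 : ℝ) ≤ |(D : ℝ) * r - n * q| := by
    have : D * r - n * q ≠ 0 := by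
      intro h
      have h2 : (q : ℤ) ∣ D := by
        refine hr.symm.dvd_of_dvd_mul_right (Dvd.intro_left n ?_)
        linarith
      have := Nat.le_of_dvd hD (by exact_mod_cast h2)
      omega
    exact_mod_cast Int.one_le_abs this
  have h2 : 1 ≤ 2 * q * |D * α - n| := by
    have h3 : (D : ℝ) * r - n * q = q * (D * α - n) - D * q * (α - r / q) := by
      field_simp
      ring
    have h4 : |D * q * (α - r / q)| ≤ 1 / 2 := by
      rw [abs_mul, abs_of_nonneg (by positivity)]
      have h5 : (2 : ℝ) * D ≤ q := by exact_mod_cast hDq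
      calc D * q * |α - r / q| ≤ (q / 2) * q * (1 / (q : ℝ) ^ 2) := by gcongr; linarith
        _ = 1 / 2 := by field_simp
    have h6 := h1.trans ((congrArg abs h3).le.trans (abs_sub _ _))
    rw [abs_mul, abs_of_pos hq] at h6
    linarith
  have h7 := norm_sum_unitExp_mul_le L (D * α)
  rw [← hn] at h7
  set S := ‖∑ k ∈ Finset.Icc 1 L, unitExp (k * (D * α))‖
  calc S = S * 1 := (mul_one _).symm
    _ ≤ S * (2 * q * |D * α - n|) := by gcongr
    _ = q * (S * (2 * |D * α - n|)) := by ring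
    _ ≤ q * 1 := by gcongr
    _ = q := mul_one _

lemma norm_sum_typeI_le {α : ℝ} {q : ℕ} {r : ℤ} (hr : IsCoprime r q)
    (hα : |α - r / q| ≤ 1 / (q : ℝ) ^ 2) {U : ℝ} (hU : 0 ≤ U) (hUq : 2 * U ^ 2 ≤ q) (N : ℕ) :
    ‖∑ n ∈ Finset.Icc 1 N, (moebiusLow U * (moebiusLow U * (ArithmeticFunction.zeta :
        ArithmeticFunction ℂ))) n * unitExp (n * α)‖ ≤ U ^ 2 * q := by
  have h0 {m : ℕ} (hm : ¬ (m : ℝ) ≤ U) : moebiusLow U m = 0 := by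
    rw [moebiusLow_apply, if_neg hm]
  rw [sum_mul_unitExp_eq]
  have h1 (m : ℕ) (hm : 0 < m) : ‖∑ k ∈ Finset.Icc 1 (N / m), moebiusLow U m * (moebiusLow U *
      (ArithmeticFunction.zeta : ArithmeticFunction ℂ)) k * unitExp (m * k * α)‖ ≤
      ‖moebiusLow U m‖ * (U * q) := by
    by_cases hmU : (m : ℝ) ≤ U
    swap
    · simp [h0 hmU]
    have h2 : ∑ k ∈ Finset.Icc 1 (N / m), moebiusLow U m * (moebiusLow U *
        (ArithmeticFunction.zeta : ArithmeticFunction ℂ)) k * unitExp (m * k * α) =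
        moebiusLow U m * ∑ d ∈ Finset.Icc 1 (N / m), moebiusLow U d *
          ∑ k ∈ Finset.Icc 1 (N / m / d), unitExp (k * ((d * m : ℕ) * α)) := by
      have h3 := sum_mul_unitExp_eq (moebiusLow U) (ArithmeticFunction.zeta : ArithmeticFunction ℂ)
        (N / m) (m * α)
      calc _ = moebiusLow U m * ∑ k ∈ Finset.Icc 1 (N / m), (moebiusLow U *
          (ArithmeticFunction.zeta : ArithmeticFunction ℂ)) k * unitExp (k * (m * α)) := by
            rw [Finset.mul_sum]
            refine Finset.sum_congr rfl fun k _ ↦ ?_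
            rw [mul_assoc, show (m : ℝ) * k * α = k * (m * α) by ring]
        _ = _ := by
            rw [h3]
            congr 1
            refine Finset.sum_congr rfl fun d _ ↦ ?_
            rw [Finset.mul_sum]
            refine Finset.sum_congr rfl fun k hk ↦ ?_
            have hk0 : k ≠ 0 := by
              have := (Finset.mem_Icc.mp hk).1
              omega
            rw [ArithmeticFunction.natCoe_apply, ArithmeticFunction.zeta_apply_ne hk0, Nat.cast_one,
              mul_one]
            congr 2
            push_cast
            ring
    rw [h2, norm_mul]
    gcongr
    calc _ ≤ ∑ d ∈ Finset.Icc 1 (N / m), ‖moebiusLow U d‖ * q := by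
          refine norm_sum_le_of_le _ fun d hd ↦ ?_
          by_cases hdU : (d : ℝ) ≤ U
          swap
          · simp [h0 hdU]
          rw [norm_mul]
          gcongr
          refine norm_sum_unitExp_le_of_rational_approx hr hα
            (Nat.mul_pos (Finset.mem_Icc.mp hd).1 hm) ?_ _
          have : 2 * ((d : ℝ) * m) ≤ q := by
            refine le_trans ?_ hUq
            rw [sq]
            gcongr
          exact_mod_cast this
      _ ≤ _ := by
          rw [← Finset.sum_mul]
          gcongr
          exact sum_norm_moebiusLow_le hU _
  calc _ ≤ ∑ m ∈ Finset.Icc 1 N, ‖moebiusLow U m‖ * (U * q) :=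
        norm_sum_le_of_le _ fun m hm ↦ h1 m (Finset.mem_Icc.mp hm).1
    _ ≤ U * (U * q) := by
        rw [← Finset.sum_mul]
        gcongr
        exact sum_norm_moebiusLow_le hU _
    _ = _ := by ring

lemma norm_moebiusHigh_mul_zeta_le (U : ℝ) (k : ℕ) :
    ‖(moebiusHigh U * (ArithmeticFunction.zeta : ArithmeticFunction ℂ)) k‖ ≤ k.divisors.card := by
  rw [ArithmeticFunction.coe_mul_zeta_apply]
  refine (norm_sum_le_of_le _ fun d _ ↦ norm_moebiusHigh_le U d).trans ?_
  simp

lemma moebiusHigh_mul_zeta_eq_zero {U : ℝ} {k : ℕ} (hk : k ≤ U) :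
    (moebiusHigh U * (ArithmeticFunction.zeta : ArithmeticFunction ℂ)) k = 0 := by
  rw [ArithmeticFunction.coe_mul_zeta_apply]
  refine Finset.sum_eq_zero fun d hd ↦ ?_
  have : (d : ℝ) ≤ k := by exact_mod_cast Nat.divisor_le hd
  rw [moebiusHigh_apply, if_pos (this.trans hk)]

lemma norm_sum_typeII_block_sq_le {α : ℝ} {q : ℕ} [NeZero q] {r : ℤ} (hr : IsCoprime r q)
    (hα : |α - r / q| ≤ 1 / (q : ℝ) ^ 2) {U : ℝ} (hU : 1 ≤ U) {N : ℕ} (hN : 3 ≤ N)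
    (hqN : q ≤ 2 * N) {M : ℕ} (hM : 0 < M) :
    ‖∑ m ∈ Finset.Ico M (2 * M), ∑ k ∈ Finset.Icc 1 (N / m), moebiusHigh U m *
        (moebiusHigh U * (ArithmeticFunction.zeta : ArithmeticFunction ℂ)) k *
          unitExp (m * k * α)‖ ^ 2 ≤
      32 * Real.log N ^ 4 * N * (N / q + 3 * (N / U) + q) := by
  have hl : 1 ≤ Real.log N := one_le_log_of_three_le hN
  have hq : (0 : ℝ) < q := by exact_mod_cast NeZero.pos q
  have hN0 : (0 : ℝ) < N := by exact_mod_cast (by omega : 0 < N)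
  have hM0 : (0 : ℝ) < M := by exact_mod_cast hM
  have hRHS : 0 ≤ 32 * Real.log N ^ 4 * N * (N / q + 3 * (N / U) + q) := by positivity
  rcases le_or_gt (2 * M : ℝ) U with hMU | hMU
  · rw [Finset.sum_eq_zero]
    · simpa using hRHS
    intro m hm
    have : (m : ℝ) ≤ 2 * M := by exact_mod_cast (Finset.mem_Ico.mp hm).2.le
    simp [moebiusHigh_apply, this.trans hMU]
  refine (norm_sum_bilinear_sq_le hr hα (norm_moebiusHigh_le U) _ hM N).trans ?_
  set K := N / M with hK
  rcases le_or_gt (K : ℝ) U with hKU | hKU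
  · rw [Finset.sum_eq_zero, zero_mul]
    · exact hRHS
    intro k hk
    have : (k : ℝ) ≤ K := by exact_mod_cast (Finset.mem_Icc.mp hk).2
    rw [moebiusHigh_mul_zeta_eq_zero (this.trans hKU)]
    simp
  have hMK : (M : ℝ) * K ≤ N := by exact_mod_cast Nat.mul_div_le N M
  have hK0 : (0 : ℝ) < K := by linarith
  have hMN : (M : ℝ) ≤ N / U := by
    rw [le_div_iff₀ (by linarith)]
    exact (mul_le_mul_of_nonneg_left hKU.le hM0.le).trans hMK
  have hKN : (K : ℝ) ≤ 2 * (N / U) := by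
    rw [mul_div_assoc', le_div_iff₀ (by linarith)]
    nlinarith
  have hlogK : 1 + Real.log K ≤ 2 * Real.log N := by
    have : Real.log K ≤ Real.log N :=
      Real.log_le_log hK0 (by exact_mod_cast Nat.div_le_self N M)
    linarith
  have hlogq : 1 + Real.log q ≤ 3 * Real.log N := by
    have : Real.log q ≤ Real.log (2 * N) := Real.log_le_log hq (by exact_mod_cast hqN)
    rw [Real.log_mul two_ne_zero hN0.ne'] at this
    linarith [Real.log_two_lt_d9]
  have hc : ∑ k ∈ Finset.Icc 1 K, ‖(moebiusHigh U * (ArithmeticFunction.zeta :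
      ArithmeticFunction ℂ)) k‖ ^ 2 ≤ K * (2 * Real.log N) ^ 3 := by
    have := Real.log_natCast_nonneg K
    calc _ ≤ ∑ k ∈ Finset.Icc 1 K, (k.divisors.card : ℝ) ^ 2 := by
          gcongr
          exact norm_moebiusHigh_mul_zeta_le U _
      _ ≤ K * (1 + Real.log K) ^ 3 := sum_card_divisors_sq_le K
      _ ≤ _ := by gcongr
  have hlogq0 := Real.log_natCast_nonneg q
  set l := Real.log N with hldef
  calc _ ≤ K * (2 * l) ^ 3 * (M * ((M / q + 1) * (4 * K + q * (3 * l)))) := by gcongr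
    _ = 8 * l ^ 3 * (M * K) * (4 * (M * K / q) + 3 * l * M + 4 * K + 3 * l * q) := by
        field_simp
        ring
    _ ≤ 8 * l ^ 3 * N * (4 * l * (N / q) + 4 * l * (N / U) + 4 * l * (2 * (N / U)) + 4 * l * q) := by
        gcongr 8 * l ^ 3 * ?_ * (?_ + ?_ + ?_ + ?_)
        · calc 4 * (M * K / q : ℝ) ≤ 4 * 1 * (N / q) := by rw [mul_one]; gcongr
            _ ≤ _ := by gcongr
        · gcongr
          norm_num
        · calc 4 * (K : ℝ) ≤ 4 * 1 * (2 * (N / U)) := by rw [mul_one]; gcongr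
            _ ≤ _ := by gcongr
        · gcongr
          norm_num
    _ = _ := by ring

lemma sum_range_sum_Ico_two_pow {A : Type*} [AddCommMonoid A] (F : ℕ → A) (I : ℕ) :
    ∑ i ∈ Finset.range I, ∑ m ∈ Finset.Ico (2 ^ i) (2 * 2 ^ i), F m =
      ∑ m ∈ Finset.Ico 1 (2 ^ I), F m := by
  induction I with
  | zero => simp
  | succ I ih =>
    rw [Finset.sum_range_succ, ih, pow_succ', Finset.sum_Ico_consecutive _ Nat.one_le_two_pow
      (by omega)]

lemma norm_sum_typeII_le {α : ℝ} {q : ℕ} [NeZero q] {r : ℤ} (hr : IsCoprime r q)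
    (hα : |α - r / q| ≤ 1 / (q : ℝ) ^ 2) {U : ℝ} (hU : 1 ≤ U) {N : ℕ} (hN : 3 ≤ N)
    (hqN : q ≤ 2 * N) :
    ‖∑ n ∈ Finset.Icc 1 N, (moebiusHigh U * (moebiusHigh U * (ArithmeticFunction.zeta :
        ArithmeticFunction ℂ))) n * unitExp (n * α)‖ ≤
      3 * Real.log N * √(32 * Real.log N ^ 4 * N * (N / q + 3 * (N / U) + q)) := by
  have hl : 1 ≤ Real.log N := one_le_log_of_three_le hN
  set I := Nat.log 2 N + 1 with hI
  have hIl : (I : ℝ) ≤ 3 * Real.log N := by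
    have h1 := Real.natLog_le_logb N 2
    rw [Real.logb, le_div_iff₀ (Real.log_pos (by norm_num))] at h1
    have h2 := Real.log_two_gt_d9
    push_cast [hI] at h1 ⊢
    nlinarith
  rw [sum_mul_unitExp_eq]
  set F : ℕ → ℂ := fun m ↦ ∑ k ∈ Finset.Icc 1 (N / m), moebiusHigh U m *
        (moebiusHigh U * (ArithmeticFunction.zeta : ArithmeticFunction ℂ)) k *
          unitExp (m * k * α) with hF
  have h2 : ∑ m ∈ Finset.Icc 1 N, F m = ∑ m ∈ Finset.Ico 1 (2 ^ I), F m := by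
    have h3 : N < 2 ^ I := Nat.lt_pow_succ_log_self one_lt_two N
    refine Finset.sum_subset (fun m hm ↦ ?_) fun m hm hm' ↦ ?_
    · simp only [Finset.mem_Icc, Finset.mem_Ico] at hm ⊢
      omega
    · have : N / m = 0 := by
        rw [Nat.div_eq_zero_iff]
        simp only [Finset.mem_Icc, Finset.mem_Ico] at hm hm'
        omega
      simp [hF, this]
  rw [h2, ← sum_range_sum_Ico_two_pow]
  calc _ ≤ ∑ i ∈ Finset.range I,
        √(32 * Real.log N ^ 4 * N * (N / q + 3 * (N / U) + q)) := by
        refine norm_sum_le_of_le _ fun i _ ↦ Real.le_sqrt_of_sq_le ?_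
        exact norm_sum_typeII_block_sq_le hr hα hU hN hqN (by positivity)
    _ = I * √(32 * Real.log N ^ 4 * N * (N / q + 3 * (N / U) + q)) := by simp
    _ ≤ _ := by gcongr

lemma norm_sum_moebius_unitExp_le {α : ℝ} {q : ℕ} [NeZero q] {r : ℤ} (hr : IsCoprime r q)
    (hα : |α - r / q| ≤ 1 / (q : ℝ) ^ 2) {U : ℝ} (hU : 1 ≤ U) (hUq : 2 * U ^ 2 ≤ q) {N : ℕ}
    (hN : 3 ≤ N) (hqN : q ≤ 2 * N) :
    ‖∑ n ∈ Finset.Icc 1 N, ((ArithmeticFunction.moebius n : ℤ) : ℂ) * unitExp (n * α)‖ ≤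
      2 * U + U ^ 2 * q +
        3 * Real.log N * √(32 * Real.log N ^ 4 * N * (N / q + 3 * (N / U) + q)) := by
  have hU0 : 0 ≤ U := by linarith
  have h1 : ‖∑ n ∈ Finset.Icc 1 N, 2 * moebiusLow U n * unitExp (n * α)‖ ≤ 2 * U := by
    calc _ ≤ ∑ n ∈ Finset.Icc 1 N, 2 * ‖moebiusLow U n‖ := by
          refine norm_sum_le_of_le _ fun n _ ↦ ?_
          rw [norm_mul, norm_mul, norm_unitExp, mul_one, Complex.norm_two]
      _ ≤ _ := by
          rw [← Finset.mul_sum]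
          gcongr
          exact sum_norm_moebiusLow_le hU0 N
  have h2 : ∑ n ∈ Finset.Icc 1 N, ((ArithmeticFunction.moebius n : ℤ) : ℂ) * unitExp (n * α) =
      ∑ n ∈ Finset.Icc 1 N, 2 * moebiusLow U n * unitExp (n * α) -
      ∑ n ∈ Finset.Icc 1 N, (moebiusLow U * (moebiusLow U * (ArithmeticFunction.zeta :
        ArithmeticFunction ℂ))) n * unitExp (n * α) +
      ∑ n ∈ Finset.Icc 1 N, (moebiusHigh U * (moebiusHigh U * (ArithmeticFunction.zeta :
        ArithmeticFunction ℂ))) n * unitExp (n * α) := by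
    rw [← Finset.sum_sub_distrib, ← Finset.sum_add_distrib]
    refine Finset.sum_congr rfl fun n _ ↦ ?_
    have h3 := DFunLike.congr_fun (moebius_eq_vaughan U) n
    simp only [ArithmeticFunction.intCoe_apply, two_mul, sub_eq_add_neg,
      ArithmeticFunction.add_apply, ArithmeticFunction.neg_apply] at h3
    rw [h3]
    ring
  rw [h2]
  exact (norm_add_le _ _).trans (add_le_add ((norm_sub_le _ _).trans
    (add_le_add h1 (norm_sum_typeI_le hr hα hU0 hUq N))) (norm_sum_typeII_le hr hα hU hN hqN))

lemma exists_norm_sum_moebius_unitExp_minor_le (A : ℕ) :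
    ∃ C : ℝ, 0 < C ∧ ∀ (α : ℝ) (q : ℕ) (r : ℤ) (N : ℕ), IsCoprime r q →
      |α - r / q| ≤ 1 / (q : ℝ) ^ 2 → 3 ≤ N → 2 * Real.log N ^ (5 * A + 12) ≤ q →
      q ≤ N / Real.log N ^ (5 * A + 12) + 1 →
      ‖∑ n ∈ Finset.Icc 1 N, ((ArithmeticFunction.moebius n : ℤ) : ℂ) * unitExp (n * α)‖ ≤
        C * (N / Real.log N ^ A) := by
  obtain ⟨C, hC, h⟩ := exists_log_pow_le (6 * A + 12)
  refine ⟨2 * C + (1 + C) + 3 * √(32 * (5 + C)), by positivity,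
    fun α q r N hr hα hN hq1 hq2 ↦ ?_⟩
  have hl : 1 ≤ Real.log N := one_le_log_of_three_le hN
  have hN1 : (1 : ℝ) ≤ N := by exact_mod_cast (by omega : 1 ≤ N)
  have hlog (p : ℕ) (hp : p ≤ 6 * A + 12) : Real.log N ^ p ≤ C * N := by
    calc _ ≤ Real.log N ^ (6 * A + 12) := by gcongr
      _ ≤ C * √N := h N hN1
      _ ≤ C * N := by
        gcongr
        rw [Real.sqrt_le_left (by positivity)]
        nlinarith
  set l := Real.log N with hldef
  have hl0 : 0 < l := by linarith
  have hq0 : (0 : ℝ) < q := lt_of_lt_of_le (by positivity) hq1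
  have : NeZero q := ⟨by rintro rfl; simp at hq0⟩
  have hqN : q ≤ 2 * N := by
    have : (N : ℝ) / l ^ (5 * A + 12) ≤ N := div_le_self (by positivity) (one_le_pow₀ hl)
    have : (q : ℝ) ≤ 2 * N := by linarith
    exact_mod_cast this
  have hU : 1 ≤ l ^ (2 * A + 6) := one_le_pow₀ hl
  have hU2 : (l ^ (2 * A + 6)) ^ 2 ≤ l ^ (5 * A + 12) := by
    rw [← pow_mul]
    exact pow_le_pow_right₀ hl (by omega)
  refine (norm_sum_moebius_unitExp_le hr hα hU (by linarith) hN hqN).trans ?_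
  rw [← hldef]
  have h1 : 2 * l ^ (2 * A + 6) ≤ 2 * C * (N / l ^ A) := by
    rw [mul_div_assoc', le_div_iff₀ (by positivity), mul_assoc, mul_assoc, ← pow_add]
    gcongr
    exact hlog _ (by omega)
  have h2 : (l ^ (2 * A + 6)) ^ 2 * q ≤ (1 + C) * (N / l ^ A) := by
    have e1 : l ^ (5 * A + 12) = l ^ A * (l ^ (2 * A + 6)) ^ 2 := by
      rw [← pow_mul, ← pow_add]
      congr 1
      ring
    have e2 : (l ^ (2 * A + 6)) ^ 2 = l ^ (4 * A + 12) := by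
      rw [← pow_mul]
      congr 1
      ring
    calc _ ≤ (l ^ (2 * A + 6)) ^ 2 * (N / l ^ (5 * A + 12) + 1) := by gcongr
      _ = (l ^ (2 * A + 6)) ^ 2 * (N / (l ^ A * (l ^ (2 * A + 6)) ^ 2)) +
          l ^ (4 * A + 12) := by
        rw [mul_add, mul_one, e1, ← e2]
      _ = N / l ^ A + l ^ (4 * A + 12) := by
        congr 1
        field_simp
      _ ≤ N / l ^ A + C * (N / l ^ A) := by
        gcongr
        rw [mul_div_assoc', le_div_iff₀ (by positivity), ← pow_add]
        exact hlog _ (by omega)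
      _ = _ := by ring
  have h3 : N / q + 3 * (N / l ^ (2 * A + 6)) + q ≤ (5 + C) * (N / l ^ (2 * A + 6)) := by
    have h4 : l ^ (2 * A + 6) ≤ l ^ (5 * A + 12) := pow_le_pow_right₀ hl (by omega)
    have h5 : (N : ℝ) / q ≤ N / l ^ (2 * A + 6) := by
      gcongr
      nlinarith
    have h6 : N / l ^ (5 * A + 12) ≤ N / l ^ (2 * A + 6) := by gcongr
    have h7 : 1 ≤ C * (N / l ^ (2 * A + 6)) := by
      rw [mul_div_assoc', le_div_iff₀ (by positivity), one_mul]
      exact hlog _ (by omega)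
    have h8 : 0 ≤ N / l ^ (2 * A + 6) := by positivity
    linarith
  have h9 : 3 * l * √(32 * l ^ 4 * N * (N / q + 3 * (N / l ^ (2 * A + 6)) + q)) ≤
      3 * √(32 * (5 + C)) * (N / l ^ A) := by
    calc _ ≤ 3 * l * √(32 * l ^ 4 * N * ((5 + C) * (N / l ^ (2 * A + 6)))) := by gcongr
      _ = 3 * l * √(32 * (5 + C) * (N * l ^ 2 / l ^ (A + 3)) ^ 2) := by
        congr 2
        rw [show 2 * A + 6 = 2 * (A + 3) by ring, pow_mul']
        field_simp
      _ = 3 * l * (√(32 * (5 + C)) * (N * l ^ 2 / l ^ (A + 3))) := by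
        rw [Real.sqrt_mul (by positivity), Real.sqrt_sq (by positivity)]
      _ = _ := by
        rw [pow_add]
        field_simp
  linarith

lemma norm_sum_mul_le_of_norm_sub_le {b g : ℕ → ℂ} {N : ℕ} {D δ : ℝ}
    (hb : ∀ M ≤ N, ‖∑ n ∈ Finset.Icc 1 M, b n‖ ≤ D) (hg : ∀ n, ‖g n‖ ≤ 1)
    (hδ : ∀ n, ‖g (n + 1) - g n‖ ≤ δ) :
    ‖∑ n ∈ Finset.Icc 1 N, b n * g n‖ ≤ D * (1 + N * δ) := by
  have hD : 0 ≤ D := (norm_nonneg _).trans (hb 0 (Nat.zero_le N))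
  have h1 (n : ℕ) : ∑ i ∈ Finset.Icc 1 n, b i * g i = (∑ i ∈ Finset.Icc 1 n, b i) * g n -
      ∑ m ∈ Finset.range n, (∑ i ∈ Finset.Icc 1 m, b i) * (g (m + 1) - g m) := by
    induction n with
    | zero => simp
    | succ n ih =>
      rw [Finset.sum_Icc_succ_top (by omega), Finset.sum_Icc_succ_top (by omega), ih,
        Finset.sum_range_succ]
      ring
  rw [h1]
  calc _ ≤ D * 1 + ∑ m ∈ Finset.range N, D * δ := by
        refine (norm_sub_le _ _).trans (add_le_add ?_ (norm_sum_le_of_le _ fun m hm ↦ ?_))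
        · rw [norm_mul]
          exact mul_le_mul (hb N le_rfl) (hg N) (norm_nonneg _) hD
        · rw [norm_mul]
          exact mul_le_mul (hb m (Finset.mem_range.mp hm).le) (hδ m) (norm_nonneg _) hD
    _ = _ := by
        rw [Finset.sum_const, Finset.card_range, nsmul_eq_mul]
        ring

lemma unitExp_val_eq {q : ℕ} [NeZero q] (r : ℤ) (n : ℕ) :
    unitExp (r * (n : ZMod q).val / q) = unitExp (n * (r / q)) := by
  have hq : (q : ℝ) ≠ 0 := by exact_mod_cast NeZero.ne q
  rw [ZMod.val_natCast, ← unitExp_add_intCast _ (r * ((n / q : ℕ) : ℤ))]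
  congr 1
  have h : ((n % q : ℕ) : ℝ) + q * (n / q : ℕ) = n := by exact_mod_cast Nat.mod_add_div n q
  rw [Int.cast_mul, Int.cast_natCast]
  field_simp
  linear_combination r * h

lemma exists_norm_sum_moebius_unitExp_major_le (A B : ℕ) :
    ∃ C : ℝ, 0 < C ∧ ∀ (α : ℝ) (q : ℕ) (r : ℤ) (N : ℕ), 0 < q →
      |α - r / q| ≤ Real.log N ^ B / N → 3 ≤ N → q ≤ 2 * Real.log N ^ B →
      ‖∑ n ∈ Finset.Icc 1 N, ((ArithmeticFunction.moebius n : ℤ) : ℂ) * unitExp (n * α)‖ ≤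
        C * (N / Real.log N ^ A) := by
  obtain ⟨C, hC, h⟩ := exists_norm_sum_moebius_mul_le (5 * B + A)
  refine ⟨16 * C * (1 + 2 * Real.pi), by positivity, fun α q r N hq0 hα hN hq ↦ ?_⟩
  have : NeZero q := ⟨hq0.ne'⟩
  have hN0 : (0 : ℝ) < N := by exact_mod_cast (by omega : 0 < N)
  have hl : 1 ≤ Real.log N := one_le_log_of_three_le hN
  have hD := h q (fun x ↦ unitExp (r * x.val / q)) (fun x ↦ (norm_unitExp _).le)
  simp_rw [unitExp_val_eq] at hD
  set l := Real.log N with hldef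
  have hl0 : 0 < l := by linarith
  have h1 (n : ℕ) : ((ArithmeticFunction.moebius n : ℤ) : ℂ) * unitExp (n * α) =
      ((ArithmeticFunction.moebius n : ℤ) : ℂ) * unitExp (n * (r / q)) *
        unitExp (n * (α - r / q)) := by
    rw [mul_assoc, ← unitExp_add]
    ring_nf
  simp_rw [h1]
  have h2 := norm_sum_mul_le_of_norm_sub_le (g := fun n ↦ unitExp (n * (α - r / q)))
    (δ := 2 * Real.pi * (l ^ B / N)) (fun M hM ↦ hD M N hN hM) (fun n ↦ (norm_unitExp _).le)
    fun n ↦ by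
      rw [Nat.cast_succ, add_mul, one_mul, unitExp_add, ← mul_sub_one, norm_mul, norm_unitExp,
        one_mul]
      exact (norm_unitExp_sub_one_le _).trans (by gcongr)
  refine h2.trans ?_
  have h3 : (N : ℝ) * (2 * Real.pi * (l ^ B / N)) = 2 * Real.pi * l ^ B := by field_simp
  rw [h3, ← hldef]
  calc _ ≤ C * (2 * l ^ B) ^ 4 * (N / l ^ (5 * B + A)) * (1 * l ^ B + 2 * Real.pi * l ^ B) := by
        gcongr
        rw [one_mul]
        exact one_le_pow₀ hl
    _ = _ := by
        rw [pow_add, pow_mul']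
        field_simp
        ring

/-- Davenport's theorem on exponential sums with the Möbius function. -/
theorem exists_norm_sum_moebius_unitExp_le (A : ℕ) :
    ∃ C : ℝ, 0 < C ∧ ∀ (N : ℕ), 3 ≤ N → ∀ α : ℝ,
      ‖∑ n ∈ Finset.Icc 1 N, ((ArithmeticFunction.moebius n : ℤ) : ℂ) * unitExp (n * α)‖ ≤
        C * (N / Real.log N ^ A) := by
  obtain ⟨C₁, hC₁, h₁⟩ := exists_norm_sum_moebius_unitExp_minor_le A
  obtain ⟨C₂, hC₂, h₂⟩ := exists_norm_sum_moebius_unitExp_major_le A (5 * A + 12)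
  refine ⟨C₁ + C₂, by positivity, fun N hN α ↦ ?_⟩
  have hN0 : (0 : ℝ) < N := by exact_mod_cast (by omega : 0 < N)
  have hl : 1 ≤ Real.log N := one_le_log_of_three_le hN
  have hl0 : 0 < Real.log N := by linarith
  have hpos : 0 ≤ N / Real.log N ^ A := by positivity
  set Q := N / Real.log N ^ (5 * A + 12) with hQ
  have hQ0 : 0 < Q := by positivity
  obtain ⟨x, hx, hxQ⟩ := Real.exists_rat_abs_sub_le_and_den_le α (Nat.succ_pos ⌊Q⌋₊)
  have hq1 : (1 : ℝ) ≤ x.den := by exact_mod_cast x.den_pos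
  have hcop : IsCoprime x.num (x.den : ℤ) := by
    rw [Int.isCoprime_iff_gcd_eq_one]
    exact x.reduced
  have hxQ' : (x.den : ℝ) ≤ (⌊Q⌋₊ : ℝ) + 1 := by exact_mod_cast hxQ
  have hQf := Nat.lt_floor_add_one Q
  rw [Rat.cast_def] at hx
  push_cast at hx
  rcases le_or_gt (2 * Real.log N ^ (5 * A + 12)) x.den with hq | hq
  · have h3 : |α - x.num / x.den| ≤ 1 / (x.den : ℝ) ^ 2 := by
      refine hx.trans ?_
      rw [sq]
      gcongr
      linarith
    refine (h₁ α x.den x.num N hcop h3 hN hq ?_).trans ?_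
    · linarith [Nat.floor_le hQ0.le]
    · gcongr
      linarith
  · have h3 : |α - x.num / x.den| ≤ Real.log N ^ (5 * A + 12) / N := by
      refine hx.trans ?_
      rw [show Real.log N ^ (5 * A + 12) / N = 1 / Q by rw [hQ, one_div_div]]
      gcongr
      nlinarith
    refine (h₂ α x.den x.num N x.den_pos h3 hN hq.le).trans ?_
    gcongr
    linarith

lemma sum_range_unitExp_eq {P : ℕ} (hP : 0 < P) (h : ℤ) :
    ∑ k ∈ Finset.range P, unitExp (k * (h / P)) = if (P : ℤ) ∣ h then (P : ℂ) else 0 := by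
  have hP0 : (P : ℝ) ≠ 0 := by exact_mod_cast hP.ne'
  split_ifs with hdvd
  · obtain ⟨t, rfl⟩ := hdvd
    have h1 (k : ℕ) : unitExp (k * (((P * t : ℤ) : ℝ) / P)) = 1 := by
      rw [← unitExp_intCast (k * t)]
      congr 1
      push_cast
      field_simp
    rw [Finset.sum_congr rfl fun k _ ↦ h1 k]
    simp
  · simp_rw [unitExp_natCast_mul]
    have h1 : unitExp (h / P) ^ P = 1 := by
      rw [← unitExp_natCast_mul, mul_div_cancel₀ _ hP0, unitExp_intCast]
    have h2 : unitExp (h / P) - 1 ≠ 0 := by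
      intro h3
      have h4 := four_mul_abs_sub_round_le_norm_unitExp_sub_one (h / P)
      rw [h3, norm_zero] at h4
      have h5 : |(h : ℝ) / P - round ((h : ℝ) / P)| = 0 := le_antisymm (by linarith) (abs_nonneg _)
      rw [abs_eq_zero, sub_eq_zero, div_eq_iff hP0] at h5
      exact hdvd ⟨round ((h : ℝ) / P), by rw [mul_comm]; exact_mod_cast h5⟩
    have h6 := mul_geom_sum (unitExp (h / P)) P
    rw [h1, sub_self] at h6
    exact (mul_eq_zero.mp h6).resolve_left h2

lemma sum_range_norm_sq_le {P X : ℕ} (hP : 0 < P) (hXP : X ≤ P) {b : ℕ → ℂ}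
    (hb : ∀ n, ‖b n‖ ≤ 1) :
    ∑ k ∈ Finset.range P, ‖∑ n ∈ Finset.Icc 1 X, b n * unitExp (n * (k / P))‖ ^ 2 ≤ P * X := by
  have h1 : ((∑ k ∈ Finset.range P, ‖∑ n ∈ Finset.Icc 1 X, b n * unitExp (n * (k / P))‖ ^ 2 : ℝ) :
      ℂ) = ∑ n ∈ Finset.Icc 1 X, b n * (starRingEnd ℂ) (b n) * P := by
    push_cast
    simp_rw [← Complex.mul_conj', map_sum, Finset.sum_mul_sum]
    rw [Finset.sum_comm]
    refine Finset.sum_congr rfl fun n hn ↦ ?_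
    rw [Finset.sum_comm]
    have h2 (n' : ℕ) (hn' : n' ∈ Finset.Icc 1 X) : ∑ k ∈ Finset.range P,
        b n * unitExp (n * (k / P)) * (starRingEnd ℂ) (b n' * unitExp (n' * (k / P))) =
        if n' = n then b n * (starRingEnd ℂ) (b n') * P else 0 := by
      have h3 (k : ℕ) : b n * unitExp (n * (k / P)) *
          (starRingEnd ℂ) (b n' * unitExp (n' * (k / P))) =
          b n * (starRingEnd ℂ) (b n') * unitExp (k * (((n - n' : ℤ) : ℝ) / P)) := by
        rw [map_mul, conj_unitExp, show (k : ℝ) * (((n - n' : ℤ) : ℝ) / P) =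
          n * (k / P) + -(n' * (k / P)) by push_cast; ring, unitExp_add]
        ring
      simp_rw [h3]
      rw [← Finset.mul_sum, sum_range_unitExp_eq hP]
      have h4 : (P : ℤ) ∣ n - n' ↔ n' = n := by
        constructor
        · intro h
          rw [Finset.mem_Icc] at hn hn'
          have := Int.eq_zero_of_abs_lt_dvd h (by rw [abs_lt]; constructor <;> omega)
          omega
        · rintro rfl
          simp
      simp [h4]
    rw [Finset.sum_congr rfl h2, Finset.sum_ite_eq' _ n, if_pos hn]
  have h5 : (∑ k ∈ Finset.range P, ‖∑ n ∈ Finset.Icc 1 X, b n * unitExp (n * (k / P))‖ ^ 2 : ℝ) =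
      ‖((∑ k ∈ Finset.range P, ‖∑ n ∈ Finset.Icc 1 X, b n * unitExp (n * (k / P))‖ ^ 2 : ℝ) :
      ℂ)‖ := by
    rw [Complex.norm_of_nonneg (by positivity)]
  rw [h5, h1]
  calc _ ≤ ∑ n ∈ Finset.Icc 1 X, (P : ℝ) := by
        refine norm_sum_le_of_le _ fun n _ ↦ ?_
        rw [norm_mul, norm_mul, RCLike.norm_conj, Complex.norm_natCast]
        exact mul_le_of_le_one_left (Nat.cast_nonneg P)
          (mul_le_one₀ (hb n) (norm_nonneg _) (hb n))
    _ = _ := by simp [mul_comm]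

lemma sum_range_mul_conj_eq {N : ℕ} (hN : 0 < N) (f ε : ℕ → ℂ) :
    ∑ k ∈ Finset.range (2 * N), (∑ m ∈ Finset.Icc 1 N, f m * unitExp (m * (k / (2 * N : ℕ)))) *
      (∑ n ∈ Finset.Icc 1 N, ε n * unitExp (n * (k / (2 * N : ℕ)))) *
      (starRingEnd ℂ) (∑ l ∈ Finset.Icc 1 (2 * N), f l * unitExp (l * (k / (2 * N : ℕ)))) =
    (2 * N : ℕ) * ∑ n ∈ Finset.Icc 1 N, ε n *
      ∑ m ∈ Finset.Icc 1 N, f m * (starRingEnd ℂ) (f (m + n)) := by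
  set P := 2 * N with hP
  have h1 (F G : ℕ → ℂ) (H : ℕ → ℂ) :
      (∑ m ∈ Finset.Icc 1 N, F m) * (∑ n ∈ Finset.Icc 1 N, G n) *
        (starRingEnd ℂ) (∑ l ∈ Finset.Icc 1 P, H l) =
      ∑ n ∈ Finset.Icc 1 N, ∑ m ∈ Finset.Icc 1 N, ∑ l ∈ Finset.Icc 1 P,
        F m * G n * (starRingEnd ℂ) (H l) := by
    simp_rw [map_sum, ← Finset.mul_sum, ← Finset.sum_mul]
    rw [← Finset.mul_sum]
  simp_rw [h1, Finset.mul_sum]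
  rw [Finset.sum_comm]
  refine Finset.sum_congr rfl fun n hn ↦ ?_
  rw [Finset.sum_comm]
  refine Finset.sum_congr rfl fun m hm ↦ ?_
  rw [Finset.sum_comm]
  rw [Finset.mem_Icc] at hm hn
  have h2 (l : ℕ) (hl : l ∈ Finset.Icc 1 P) : ∑ k ∈ Finset.range P,
      f m * unitExp (m * (k / P)) * (ε n * unitExp (n * (k / P))) *
        (starRingEnd ℂ) (f l * unitExp (l * (k / P))) =
      if l = m + n then (P : ℂ) * (ε n * (f m * (starRingEnd ℂ) (f l))) else 0 := by
    have h3 (k : ℕ) : f m * unitExp (m * (k / P)) * (ε n * unitExp (n * (k / P))) *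
        (starRingEnd ℂ) (f l * unitExp (l * (k / P))) =
        f m * ε n * (starRingEnd ℂ) (f l) * unitExp (k * (((m + n - l : ℤ) : ℝ) / P)) := by
      rw [map_mul, conj_unitExp, show (k : ℝ) * (((m + n - l : ℤ) : ℝ) / P) =
        m * (k / P) + n * (k / P) + -(l * (k / P)) by push_cast; ring, unitExp_add, unitExp_add]
      ring
    simp_rw [h3]
    rw [← Finset.mul_sum, sum_range_unitExp_eq (by omega)]
    have h4 : (P : ℤ) ∣ m + n - l ↔ l = m + n := by
      constructor
      · intro h
        rw [Finset.mem_Icc] at hl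
        have := Int.eq_zero_of_abs_lt_dvd h (by rw [abs_lt]; constructor <;> omega)
        omega
      · rintro rfl
        simp
    simp only [h4]
    split_ifs
    · ring
    · simp
  rw [Finset.sum_congr rfl h2, Finset.sum_ite_eq' _ (m + n),
    if_pos (Finset.mem_Icc.mpr ⟨by omega, by omega⟩)]

lemma sum_abs_selfcorrelation_le {f : ℕ → ℝ} (hf : ∀ n, |f n| ≤ 1) {N : ℕ} (hN : 0 < N) {D : ℝ}
    (hD : ∀ α : ℝ, ‖∑ n ∈ Finset.Icc 1 N, (f n : ℂ) * unitExp (n * α)‖ ≤ D) :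
    ∑ n ∈ Finset.Icc 1 N, |∑ m ∈ Finset.Icc 1 N, f m * f (m + n)| ≤ 3 / 2 * D * N := by
  have hD0 : 0 ≤ D := (norm_nonneg _).trans (hD 0)
  have hf' (n : ℕ) : ‖(f n : ℂ)‖ ≤ 1 := by
    rw [Complex.norm_real]
    exact hf n
  set c : ℕ → ℝ := fun n ↦ ∑ m ∈ Finset.Icc 1 N, f m * f (m + n) with hc
  set ε : ℕ → ℝ := fun n ↦ if 0 ≤ c n then 1 else -1 with hε
  have hε1 (n : ℕ) : ‖(ε n : ℂ)‖ ≤ 1 := by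
    simp only [hε]
    split_ifs <;> simp
  have hεc (n : ℕ) : ε n * c n = |c n| := by
    simp only [hε]
    split_ifs with h
    · rw [one_mul, abs_of_nonneg h]
    · rw [neg_one_mul, abs_of_neg (not_le.mp h)]
  have h1 := sum_range_mul_conj_eq hN (fun n ↦ (f n : ℂ)) (fun n ↦ (ε n : ℂ))
  have h2 : ((2 * N : ℕ) : ℂ) * ∑ n ∈ Finset.Icc 1 N, (ε n : ℂ) *
      ∑ m ∈ Finset.Icc 1 N, (f m : ℂ) * (starRingEnd ℂ) (f (m + n) : ℂ) =
      (((2 * N : ℕ) * ∑ n ∈ Finset.Icc 1 N, |c n| : ℝ) : ℂ) := by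
    simp_rw [← hεc, hc, Complex.conj_ofReal]
    push_cast
    rfl
  rw [h2] at h1
  set P := 2 * N with hP
  have hP0 : (0 : ℝ) < P := by exact_mod_cast (by omega : 0 < P)
  have hE := sum_range_norm_sq_le (P := P) (X := N) (by omega) (by omega) hε1
  have hT := sum_range_norm_sq_le (P := P) (X := P) (by omega) le_rfl hf'
  have h3 : (P : ℝ) * ∑ n ∈ Finset.Icc 1 N, |c n| ≤ D * (1 / 2 * (P * N + P * P)) := by
    have h4 : (P : ℝ) * ∑ n ∈ Finset.Icc 1 N, |c n| =
        ‖(((P : ℕ) * ∑ n ∈ Finset.Icc 1 N, |c n| : ℝ) : ℂ)‖ := by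
      rw [Complex.norm_of_nonneg (by positivity)]
    rw [h4, ← h1]
    calc _ ≤ ∑ k ∈ Finset.range P, D *
          (1 / 2 * (‖∑ n ∈ Finset.Icc 1 N, (ε n : ℂ) * unitExp (n * (k / P))‖ ^ 2 +
            ‖∑ l ∈ Finset.Icc 1 P, (f l : ℂ) * unitExp (l * (k / P))‖ ^ 2)) := by
          refine norm_sum_le_of_le _ fun k _ ↦ ?_
          rw [norm_mul, norm_mul, RCLike.norm_conj, mul_assoc]
          refine mul_le_mul (hD _) ?_ (by positivity) hD0
          linarith [two_mul_le_add_sq ‖∑ n ∈ Finset.Icc 1 N, (ε n : ℂ) * unitExp (n * (k / P))‖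
            ‖∑ l ∈ Finset.Icc 1 P, (f l : ℂ) * unitExp (l * (k / P))‖]
      _ ≤ _ := by
          rw [← Finset.mul_sum, ← Finset.mul_sum, Finset.sum_add_distrib]
          gcongr
  have h5 : D * (1 / 2 * (P * N + P * P)) = P * (3 / 2 * D * N) := by
    push_cast [hP]
    ring
  rw [h5] at h3
  exact le_of_mul_le_mul_left h3 hP0

end

open Finset ArithmeticFunction

/-- For every `ε > 0` there is a constant `C > 0` such that for every `N ≥ 2`,
`(1/N) ∑_{n=1}^{N} |(1/N) ∑_{m=1}^{N} μ(m) μ(m+n)| ≤ C / (log N)^ε`. -/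
theorem moebius_selfcorrelation_cesaro_bound (ε : ℝ) (hε : 0 < ε) :
    ∃ C : ℝ, 0 < C ∧ ∀ N : ℕ, 2 ≤ N →
      (1 / (N : ℝ)) * ∑ n ∈ Finset.Icc 1 N,
          |(1 / (N : ℝ)) * ∑ m ∈ Finset.Icc 1 N,
            ((ArithmeticFunction.moebius m * ArithmeticFunction.moebius (m + n) : ℤ) : ℝ)|
        ≤ C / (Real.log N) ^ ε := by
  obtain ⟨C, hC, h⟩ := exists_norm_sum_moebius_unitExp_le ⌈ε⌉₊
  refine ⟨1 + 3 / 2 * C, by positivity, fun N hN2 ↦ ?_⟩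
  have hN0 : (0 : ℝ) < N := by exact_mod_cast (by omega : 0 < N)
  have hμ (n : ℕ) : |((ArithmeticFunction.moebius n : ℤ) : ℝ)| ≤ 1 := by
    exact_mod_cast ArithmeticFunction.abs_moebius_le_one
  push_cast
  simp_rw [abs_mul, ← Finset.mul_sum]
  rw [abs_of_pos (by positivity), ← mul_assoc]
  rcases eq_or_lt_of_le hN2 with rfl | hN
  · have h1 : ∑ n ∈ Finset.Icc 1 2, |∑ m ∈ Finset.Icc 1 2,
        ((ArithmeticFunction.moebius m : ℤ) : ℝ) * ((ArithmeticFunction.moebius (m + n) : ℤ) : ℝ)| ≤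
        ∑ n ∈ Finset.Icc 1 2, ∑ m ∈ Finset.Icc 1 2, (1 : ℝ) := by
      refine Finset.sum_le_sum fun n _ ↦ (Finset.abs_sum_le_sum_abs _ _).trans
        (Finset.sum_le_sum fun m _ ↦ ?_)
      rw [abs_mul]
      exact mul_le_one₀ (hμ m) (abs_nonneg _) (hμ _)
    have h2 : Real.log (2 : ℕ) ^ ε ≤ 1 := by
      refine Real.rpow_le_one (Real.log_natCast_nonneg 2) ?_ hε.le
      push_cast
      linarith [Real.log_two_lt_d9]
    have h3 : 0 < Real.log (2 : ℕ) ^ ε := Real.rpow_pos_of_pos (Real.log_pos (by norm_num)) _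
    rw [le_div_iff₀ h3]
    norm_num at h1 ⊢
    norm_num at h2 h3
    nlinarith
  · have hl : 1 ≤ Real.log N := one_le_log_of_three_le hN
    have h1 := sum_abs_selfcorrelation_le (f := fun n ↦ ((ArithmeticFunction.moebius n : ℤ) : ℝ)) hμ
      (by omega : 0 < N) (D := C * (N / Real.log N ^ ⌈ε⌉₊)) (fun α ↦ by simpa using h N hN α)
    have h2 : Real.log N ^ ε ≤ Real.log N ^ ⌈ε⌉₊ := by
      rw [← Real.rpow_natCast]
      exact Real.rpow_le_rpow_of_exponent_le hl (Nat.le_ceil ε)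
    calc _ ≤ 1 / (N : ℝ) * (1 / N) * (3 / 2 * (C * (N / Real.log N ^ ⌈ε⌉₊)) * N) := by
          gcongr
      _ = (0 + 3 / 2 * C) / Real.log N ^ ⌈ε⌉₊ := by
          field_simp
          ring
      _ ≤ _ := by
          gcongr
          norm_num
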